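/- Let n ≥ 3 and let Ω ⊂ ℝⁿ be a smooth bounded and simply connected domain equipped with a C¹ Riemannian metric g. There exists ε₀(n) ∈ (0, 1/(n+1)) such that for every ε ∈ (0, ε₀(n)) and all κ, ς ∈ (0,1) the following holds: if ū : (Ω̄, g) → ℝ^{2n} is a short immersion of class C^{1,κ}, then there exists an isometric immersion u ∈ C^{1,θ}(Ω̄, ℝ^{2n}) of (Ω̄, g), with θ = θ(n,ε), such that ‖u − ū‖₀ < ς. -/

import Mathlib

open MeasureTheory

attribute [local instance] Matrix.normedAddCommGroup Matrix.normedSpace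

noncomputable section

/-- The partial derivative `∂_i f` in the `i`-th coordinate direction. -/
def pder {n : ℕ} {E : Type*} [NormedAddCommGroup E] [NormedSpace ℝ E]
    (i : Fin n) (f : (Fin n → ℝ) → E) : (Fin n → ℝ) → E :=
  fun x => fderiv ℝ f x (Pi.single i 1)

/-- Iterated partial derivatives along a list of coordinate directions. -/
def derivList {n : ℕ} {E : Type*} [NormedAddCommGroup E] [NormedSpace ℝ E] :
    List (Fin n) → ((Fin n → ℝ) → E) → ((Fin n → ℝ) → E)
  | [], f => f
  | i :: l, f => derivList l (pder i f)

/-- The multi-index partial derivative `∂^β f`. -/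
def mderiv {n : ℕ} {E : Type*} [NormedAddCommGroup E] [NormedSpace ℝ E]
    (β : Fin n → ℕ) (f : (Fin n → ℝ) → E) : (Fin n → ℝ) → E :=
  derivList (((List.finRange n).map fun i => List.replicate (β i) i).flatten) f

/-- The sup norm `‖f‖₀` over a set `D`. -/
def sNorm {n : ℕ} {E : Type*} [NormedAddCommGroup E]
    (D : Set (Fin n → ℝ)) (f : (Fin n → ℝ) → E) : ℝ :=
  ⨆ x : D, ‖f x.1‖

/-- The seminorm `[f]_k = Σ_{|β| = k} ‖∂^β f‖₀` over a set `D`. -/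
def semK {n : ℕ} {E : Type*} [NormedAddCommGroup E] [NormedSpace ℝ E]
    (D : Set (Fin n → ℝ)) (k : ℕ) (f : (Fin n → ℝ) → E) : ℝ :=
  ∑ β ∈ Finset.Nat.antidiagonalTuple n k, sNorm D (mderiv β f)

/-- The norm `‖f‖_k = Σ_{j ≤ k} [f]_j` over a set `D`. -/
def nrm {n : ℕ} {E : Type*} [NormedAddCommGroup E] [NormedSpace ℝ E]
    (D : Set (Fin n → ℝ)) (k : ℕ) (f : (Fin n → ℝ) → E) : ℝ :=
  ∑ j ∈ Finset.range (k + 1), semK D j f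

/-- The pullback metric `u^♯e = (∇u)ᵀ ∇u`, i.e. `(u^♯e)_{ij} = ∂_i u · ∂_j u`. -/
def pullback {n d : ℕ} (u : (Fin n → ℝ) → (Fin d → ℝ)) (x : Fin n → ℝ) :
    Matrix (Fin n) (Fin n) ℝ :=
  Matrix.of fun i j => ∑ a, pder i u x a * pder j u x a

/-- `u ∈ C^{1,θ}(D, ℝ^d)`: `u` is `C¹` with `θ`-Hölder continuous first derivatives on `D`. -/
def MemC1Holder {n d : ℕ} (D : Set (Fin n → ℝ)) (θ : ℝ)
    (u : (Fin n → ℝ) → (Fin d → ℝ)) : Prop :=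
  ContDiff ℝ 1 u ∧ ∃ C : ℝ, ∀ i : Fin n, ∀ x ∈ D, ∀ y ∈ D,
    ‖pder i u x - pder i u y‖ ≤ C * ‖x - y‖ ^ θ

/-- The Hölder exponent `θ(n, ε)`: `1/n − ε` for odd `n` and `1/(n+1) − ε` for even `n`. -/
def thetaExp (n : ℕ) (ε : ℝ) : ℝ := if Odd n then 1 / n - ε else 1 / (n + 1) - ε

namespace NK
open Filter Topology
open scoped ContDiff
section A

variable {P : Type} {E G G₁ G₂ G₃ : Type}
  [NormedAddCommGroup E] [NormedSpace ℝ E]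
  [NormedAddCommGroup G] [NormedSpace ℝ G]
  [NormedAddCommGroup G₁] [NormedSpace ℝ G₁]
  [NormedAddCommGroup G₂] [NormedSpace ℝ G₂]
  [NormedAddCommGroup G₃] [NormedSpace ℝ G₃]

/-- Symbol class: families of smooth maps with `‖D^k f‖ ≤ C_k Q^(α + kβ)`, eventually along `l`. -/
def Sy (l : Filter P) (Q : P → ℝ) (α β : ℝ) (f : P → E → G) : Prop :=
  (∀ᶠ p in l, ContDiff ℝ ∞ (f p)) ∧
    ∀ k : ℕ, ∃ C : ℝ, 0 ≤ C ∧ ∀ᶠ p in l, ∀ x, ‖iteratedFDeriv ℝ k (f p) x‖ ≤ C * Q p ^ (α + k * β)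

variable {l : Filter P} {Q : P → ℝ} {α α' β β' : ℝ}

theorem ev_one (hQ : Tendsto Q l atTop) : ∀ᶠ p in l, 1 ≤ Q p := hQ.eventually_ge_atTop 1

theorem Sy.mono (hQ : Tendsto Q l atTop) {f : P → E → G} (h : Sy l Q α β f)
    (ha : α ≤ α') (hb : β ≤ β') : Sy l Q α' β' f := by
  refine ⟨h.1, fun k => ?_⟩
  obtain ⟨C, hC, h2⟩ := h.2 k
  refine ⟨C, hC, ?_⟩
  filter_upwards [h2, ev_one hQ] with p hp hq x
  refine (hp x).trans ?_
  gcongr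

theorem Sy.congr {f g : P → E → G} (h : Sy l Q α β f) (hfg : ∀ᶠ p in l, ∀ x, g p x = f p x) :
    Sy l Q α β g := by
  have hfg' : ∀ᶠ p in l, g p = f p := by
    filter_upwards [hfg] with p hp using funext hp
  refine ⟨?_, fun k => ?_⟩
  · filter_upwards [h.1, hfg'] with p h1 h2
    rwa [h2]
  · obtain ⟨C, hC, h2⟩ := h.2 k
    refine ⟨C, hC, ?_⟩
    filter_upwards [h2, hfg'] with p h1 h2
    rwa [h2]

theorem nn {n : WithTop ℕ∞} (k : ℕ) (h : (∞ : WithTop ℕ∞) ≤ n) : (k : WithTop ℕ∞) ≤ n := by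
  refine le_trans ?_ h
  exact_mod_cast le_top

theorem Sy.add {f g : P → E → G} (hf : Sy l Q α β f) (hg : Sy l Q α β g) :
    Sy l Q α β (fun p x => f p x + g p x) := by
  refine ⟨?_, fun k => ?_⟩
  · filter_upwards [hf.1, hg.1] with p h1 h2 using h1.add h2
  · obtain ⟨C, hC, h2⟩ := hf.2 k
    obtain ⟨C', hC', h2'⟩ := hg.2 k
    refine ⟨C + C', by positivity, ?_⟩
    filter_upwards [h2, h2', hf.1, hg.1] with p h1 h2 h3 h4 x
    have : iteratedFDeriv ℝ k (fun x => f p x + g p x) x =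
        iteratedFDeriv ℝ k (f p) x + iteratedFDeriv ℝ k (g p) x :=
      iteratedFDeriv_add_apply ((h3.of_le (nn k le_rfl)).contDiffAt) ((h4.of_le (nn k le_rfl)).contDiffAt)
    rw [this, add_mul]
    exact (norm_add_le _ _).trans (add_le_add (h1 x) (h2 x))

theorem Sy.clm {f : P → E → G} (hf : Sy l Q α β f) (L : G →L[ℝ] G₁) :
    Sy l Q α β (fun p x => L (f p x)) := by
  refine ⟨?_, fun k => ?_⟩
  · filter_upwards [hf.1] with p h1 using L.contDiff.comp h1
  · obtain ⟨C, hC, h2⟩ := hf.2 k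
    refine ⟨‖L‖ * C, by positivity, ?_⟩
    filter_upwards [h2, hf.1] with p h1 h3 x
    have := L.norm_iteratedFDeriv_comp_left (f := f p) (x := x) (N := ∞) (n := k) h3.contDiffAt (nn k le_rfl)
    refine this.trans ?_
    rw [mul_assoc]
    gcongr
    exact h1 x

theorem Sy.bilin (hQ : Tendsto Q l atTop) (B : G₁ →L[ℝ] G₂ →L[ℝ] G₃) {f : P → E → G₁} {g : P → E → G₂}
    (hf : Sy l Q α β f) (hg : Sy l Q α' β g) :
    Sy l Q (α + α') β (fun p x => B (f p x) (g p x)) := by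
  refine ⟨?_, fun k => ?_⟩
  · filter_upwards [hf.1, hg.1] with p h1 h2
    exact B.isBoundedBilinearMap.contDiff.comp (h1.prodMk h2)
  · choose C hC h2 using hf.2
    choose C' hC' h2' using hg.2
    refine ⟨‖B‖ * ∑ i ∈ Finset.range (k + 1), (k.choose i : ℝ) * C i * C' (k - i), ?_, ?_⟩
    · refine mul_nonneg B.opNorm_nonneg (Finset.sum_nonneg fun i _ => ?_)
      have := hC i
      have := hC' (k - i)
      positivity
    have e1 : ∀ᶠ p in l, ∀ i ∈ Finset.range (k + 1), ∀ x, ‖iteratedFDeriv ℝ i (f p) x‖ ≤ C i * Q p ^ (α + i * β) :=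
      (Finset.range (k + 1)).eventually_all.2 fun i _ => h2 i
    have e2 : ∀ᶠ p in l, ∀ i ∈ Finset.range (k + 1), ∀ x, ‖iteratedFDeriv ℝ (k - i) (g p) x‖ ≤ C' (k - i) * Q p ^ (α' + (k - i : ℕ) * β) :=
      (Finset.range (k + 1)).eventually_all.2 fun i _ => h2' (k - i)
    filter_upwards [e1, e2, hf.1, hg.1, ev_one hQ] with p h1 h2 h3 h4 hq x
    refine (B.norm_iteratedFDeriv_le_of_bilinear h3 h4 x (n := k) (nn k le_rfl)).trans ?_
    rw [mul_assoc]
    gcongr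
    rw [Finset.sum_mul]
    refine Finset.sum_le_sum fun i hi => ?_
    have hik : i ≤ k := by
      have := Finset.mem_range.1 hi
      omega
    have hq0 : 0 < Q p := by linarith
    calc (k.choose i : ℝ) * ‖iteratedFDeriv ℝ i (f p) x‖ * ‖iteratedFDeriv ℝ (k - i) (g p) x‖
        ≤ (k.choose i : ℝ) * (C i * Q p ^ (α + i * β)) * (C' (k - i) * Q p ^ (α' + (k - i : ℕ) * β)) := by
          have := hC i
          gcongr
          · exact h1 i hi x
          · exact h2 i hi x
      _ = (k.choose i : ℝ) * C i * C' (k - i) * (Q p ^ (α + i * β) * Q p ^ (α' + (k - i : ℕ) * β)) := by ring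
      _ = _ := by
          rw [← Real.rpow_add hq0]
          congr 2
          rw [Nat.cast_sub hik]
          ring

theorem Sy.mul (hQ : Tendsto Q l atTop) {f g : P → E → ℝ}
    (hf : Sy l Q α β f) (hg : Sy l Q α' β g) :
    Sy l Q (α + α') β (fun p x => f p x * g p x) := by
  simpa using Sy.bilin hQ (ContinuousLinearMap.mul ℝ ℝ) hf hg

theorem Sy.smul (hQ : Tendsto Q l atTop) {f : P → E → ℝ} {g : P → E → G}
    (hf : Sy l Q α β f) (hg : Sy l Q α' β g) :
    Sy l Q (α + α') β (fun p x => f p x • g p x) := by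
  simpa using Sy.bilin hQ (ContinuousLinearMap.lsmul ℝ ℝ) hf hg

theorem Sy.inner (hQ : Tendsto Q l atTop) {F : Type} [NormedAddCommGroup F] [InnerProductSpace ℝ F]
    {f g : P → E → F} (hf : Sy l Q α β f) (hg : Sy l Q α' β g) :
    Sy l Q (α + α') β (fun p x => inner ℝ (f p x) (g p x)) := by
  exact Sy.bilin hQ (innerSL ℝ (E := F)) hf hg

theorem Sy.const_smul {f : P → E → G} (hf : Sy l Q α β f) (c : ℝ) :
    Sy l Q α β (fun p x => c • f p x) := by
  simpa using hf.clm (c • ContinuousLinearMap.id ℝ G)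

theorem Sy.const_mul {f : P → E → ℝ} (hf : Sy l Q α β f) (c : ℝ) :
    Sy l Q α β (fun p x => c * f p x) := by
  simpa using hf.const_smul c

theorem Sy.mul_const {f : P → E → ℝ} (hf : Sy l Q α β f) (c : ℝ) :
    Sy l Q α β (fun p x => f p x * c) := by
  simpa [mul_comm] using hf.const_smul c

theorem Sy.neg {f : P → E → G} (hf : Sy l Q α β f) :
    Sy l Q α β (fun p x => - f p x) := by
  simpa using hf.const_smul (-1)

theorem Sy.sub {f g : P → E → G} (hf : Sy l Q α β f) (hg : Sy l Q α β g) :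
    Sy l Q α β (fun p x => f p x - g p x) := by
  simpa [sub_eq_add_neg] using hf.add hg.neg

theorem Sy.zero : Sy l Q α β (fun _ _ => 0 : P → E → G) := by
  refine ⟨Eventually.of_forall fun p => contDiff_const, fun k => ⟨0, le_rfl, ?_⟩⟩
  refine Eventually.of_forall fun p x => ?_
  simp

theorem Sy.sum {ι : Type} (s : Finset ι) {f : ι → P → E → G} (hf : ∀ i ∈ s, Sy l Q α β (f i)) :
    Sy l Q α β (fun p x => ∑ i ∈ s, f i p x) := by
  classical
  induction s using Finset.induction_on with
  | empty => simpa using Sy.zero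
  | insert a s ha ih =>
    simp only [Finset.sum_insert ha]
    exact (hf a (by simp)).add (ih fun i hi => hf i (by simp [hi]))

/-- Constants in `x`. -/
theorem Sy.pconst (c : P → G) {C : ℝ} (hC : 0 ≤ C) (h : ∀ᶠ p in l, ‖c p‖ ≤ C * Q p ^ α) :
    Sy l Q α β (fun p (_ : E) => c p) := by
  refine ⟨Eventually.of_forall fun p => contDiff_const, fun k => ?_⟩
  rcases Nat.eq_zero_or_pos k with rfl | hk
  · refine ⟨C, hC, ?_⟩
    filter_upwards [h] with p hp x
    simpa using hp
  · refine ⟨0, le_rfl, Eventually.of_forall fun p x => ?_⟩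
    have := iteratedFDeriv_const_of_ne (𝕜 := ℝ) (E := E) (n := k) (by omega) (c p)
    simp [this]

theorem Sy.const (c : G) : Sy l Q 0 β (fun _ (_ : E) => c) :=
  Sy.pconst (fun _ => c) (norm_nonneg c) (by simp)

theorem Sy.pow (hQ : Tendsto Q l atTop) : Sy l Q α β (fun p (_ : E) => Q p ^ α) := by
  refine Sy.pconst (fun p => Q p ^ α) zero_le_one ?_
  filter_upwards [ev_one hQ] with p hp
  rw [Real.norm_of_nonneg (by positivity), one_mul]

theorem Sy.fderiv {f : P → E → G} (hf : Sy l Q α β f) :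
    Sy l Q (α + β) β (fun p x => fderiv ℝ (f p) x) := by
  refine ⟨?_, fun k => ?_⟩
  · filter_upwards [hf.1] with p h1
    exact h1.fderiv_right (m := ∞) (by simp)
  · obtain ⟨C, hC, h2⟩ := hf.2 (k + 1)
    refine ⟨C, hC, ?_⟩
    filter_upwards [h2] with p hp x
    have := norm_iteratedFDeriv_fderiv (𝕜 := ℝ) (f := f p) (n := k) (x := x)
    rw [this]
    refine (hp x).trans (le_of_eq ?_)
    congr 2
    push_cast
    ring

theorem Sy.bound {f : P → E → G} (hf : Sy l Q α β f) :
    ∃ C, 0 ≤ C ∧ ∀ᶠ p in l, ∀ x, ‖f p x‖ ≤ C * Q p ^ α := by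
  obtain ⟨C, hC, h⟩ := hf.2 0
  refine ⟨C, hC, ?_⟩
  filter_upwards [h] with p hp x
  simpa using hp x

theorem ev_absorb (hQ : Tendsto Q l atTop) (C : ℝ) {ε : ℝ} (hε : 0 < ε) (h : α < α') :
    ∀ᶠ p in l, C * Q p ^ α ≤ ε * Q p ^ α' := by
  have h1 : Tendsto (fun p => Q p ^ (α' - α)) l atTop :=
    (tendsto_rpow_atTop (sub_pos.2 h)).comp hQ
  filter_upwards [h1.eventually_ge_atTop (C / ε), ev_one hQ] with p hp hq
  have hq0 : 0 < Q p := by linarith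
  rw [div_le_iff₀ hε] at hp
  have : Q p ^ α' = Q p ^ (α' - α) * Q p ^ α := by
    rw [← Real.rpow_add hq0]; congr 1; ring
  rw [this]
  have h3 : 0 < Q p ^ α := by positivity
  nlinarith

theorem Sy.small (hQ : Tendsto Q l atTop) {f : P → E → G} (hf : Sy l Q α β f) (h : α < α')
    {ε : ℝ} (hε : 0 < ε) : ∀ᶠ p in l, ∀ x, ‖f p x‖ ≤ ε * Q p ^ α' := by
  obtain ⟨C, hC, h1⟩ := hf.bound
  filter_upwards [h1, ev_absorb hQ C hε h] with p hp hq x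
  exact (hp x).trans hq

/-- Composition with a smooth map, on families with values in a compact set. -/
theorem Sy.comp [FiniteDimensional ℝ G] (hQ : Tendsto Q l atTop) {f : P → E → G} (hf : Sy l Q 0 β f)
    {Φ : G → G₁} {U K : Set G} (hU : IsOpen U) (hK : IsCompact K) (hKU : K ⊆ U)
    (hΦ : ContDiffOn ℝ ∞ Φ U) (hfK : ∀ᶠ p in l, ∀ x, f p x ∈ K) :
    Sy l Q 0 β (fun p x => Φ (f p x)) := by
  have hsm : ∀ᶠ p in l, ContDiff ℝ ∞ (fun x => Φ (f p x)) := by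
    filter_upwards [hf.1, hfK] with p h1 h2
    refine contDiff_iff_contDiffAt.2 fun x => ?_
    exact (hΦ.contDiffAt (hU.mem_nhds (hKU (h2 x)))).comp x h1.contDiffAt
  refine ⟨hsm, fun k => ?_⟩
  choose C hC h2 using hf.2
  -- bounds of derivatives of Φ on K
  have hb : ∀ i : ℕ, ∃ M, ∀ y ∈ K, ‖iteratedFDerivWithin ℝ i Φ U y‖ ≤ M := by
    intro i
    have hc : ContinuousOn (iteratedFDerivWithin ℝ i Φ U) K :=
      (hΦ.continuousOn_iteratedFDerivWithin (nn i le_rfl) hU.uniqueDiffOn).mono hKU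
    exact (hK.exists_bound_of_continuousOn hc)
  choose M hM using hb
  set Cm : ℝ := 1 + ∑ i ∈ Finset.range (k + 1), C i with hCm
  set Mm : ℝ := ∑ i ∈ Finset.range (k + 1), |M i| with hMm
  have hCm1 : 1 ≤ Cm := by
    have : 0 ≤ ∑ i ∈ Finset.range (k + 1), C i := Finset.sum_nonneg fun i _ => hC i
    linarith
  have hMm0 : 0 ≤ Mm := Finset.sum_nonneg fun i _ => abs_nonneg _
  refine ⟨k.factorial * Mm * Cm ^ k, by positivity, ?_⟩
  have e1 : ∀ᶠ p in l, ∀ i ∈ Finset.range (k + 1), ∀ x, ‖iteratedFDeriv ℝ i (f p) x‖ ≤ C i * Q p ^ (0 + i * β) :=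
    (Finset.range (k + 1)).eventually_all.2 fun i _ => h2 i
  filter_upwards [e1, hf.1, hfK, ev_one hQ] with p h1 h3 h4 hq x
  have hq0 : 0 < Q p := by linarith
  have := norm_iteratedFDerivWithin_comp_le (𝕜 := ℝ) (g := Φ) (f := f p) (n := k) (N := ∞) (s := Set.univ) (t := U)
    (x := x) hΦ h3.contDiffOn (nn k le_rfl) hU.uniqueDiffOn uniqueDiffOn_univ
    (fun y _ => hKU (h4 y)) (Set.mem_univ x) (C := Mm) (D := Cm * Q p ^ β) ?_ ?_
  · rw [iteratedFDerivWithin_univ] at this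
    refine this.trans (le_of_eq ?_)
    rw [mul_pow, ← Real.rpow_natCast (Q p ^ β), ← Real.rpow_mul hq0.le]
    ring_nf
  · intro i hi
    refine (hM i _ (h4 x)).trans ((le_abs_self _).trans ?_)
    exact Finset.single_le_sum (f := fun i => |M i|) (fun i _ => abs_nonneg _) (Finset.mem_range.2 (by omega))
  · intro i hi1 hi
    rw [iteratedFDerivWithin_univ]
    refine (h1 i (Finset.mem_range.2 (by omega)) x).trans ?_
    rw [mul_pow, ← Real.rpow_natCast (Q p ^ β), ← Real.rpow_mul hq0.le, zero_add, mul_comm β]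
    gcongr
    have h5 : C i ≤ Cm := by
      have := Finset.single_le_sum (f := C) (fun i _ => hC i) (Finset.mem_range.2 (show i < k + 1 by omega))
      linarith
    exact h5.trans (le_self_pow₀ hCm1 (by omega))

end A
end NK

namespace NK
open Filter Topology
open scoped ContDiff
section B

variable {P : Type} {n : ℕ} {G : Type} [NormedAddCommGroup G] [NormedSpace ℝ G]
  {F : Type} [NormedAddCommGroup F] [InnerProductSpace ℝ F]

variable {l : Filter P} {Q : P → ℝ} {α α' β β' : ℝ}

theorem Sy.pder {f : P → (Fin n → ℝ) → G} (hf : Sy l Q α β f) (i : Fin n) :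
    Sy l Q (α + β) β (fun p => pder i (f p)) :=
  hf.fderiv.clm (ContinuousLinearMap.apply ℝ G (Pi.single i 1))

/-- The linear phase `x ↦ θ · x`. -/
def ph (θ : Fin n → ℝ) : (Fin n → ℝ) →L[ℝ] ℝ :=
  ∑ i, θ i • ContinuousLinearMap.proj (R := ℝ) (φ := fun _ : Fin n => ℝ) i

theorem ph_apply (θ x : Fin n → ℝ) : ph θ x = ∑ i, θ i * x i := by
  simp [ph]

theorem ph_single (θ : Fin n → ℝ) (i : Fin n) : ph θ (Pi.single i 1) = θ i := by
  simp [ph_apply, Pi.single_apply]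

theorem ph_add (θ θ' : Fin n → ℝ) (x : Fin n → ℝ) : ph (θ + θ') x = ph θ x + ph θ' x := by
  simp [ph_apply, add_mul, Finset.sum_add_distrib]

theorem ph_sub (θ θ' : Fin n → ℝ) (x : Fin n → ℝ) : ph (θ - θ') x = ph θ x - ph θ' x := by
  simp [ph_apply, sub_mul, Finset.sum_sub_distrib]

theorem ph_smul (c : ℝ) (θ : Fin n → ℝ) (x : Fin n → ℝ) : ph (c • θ) x = c * ph θ x := by
  simp [ph_apply, Finset.mul_sum, mul_assoc]

theorem Sy.osc_aux (hQ : Tendsto Q l atTop) (Φ : ℝ → ℝ) (hΦ : ContDiff ℝ ∞ Φ)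
    (hb : ∀ k t, ‖iteratedFDeriv ℝ k Φ t‖ ≤ 1) (θ : Fin n → ℝ) (L : ℝ) :
    Sy l Q 0 L (fun p x => Φ (Q p ^ L * ph θ x)) := by
  refine ⟨Eventually.of_forall fun p => hΦ.comp ((ph θ).contDiff.const_smul (Q p ^ L)), fun k => ?_⟩
  refine ⟨k.factorial * 1 * (1 + ‖ph θ‖) ^ k, by positivity, ?_⟩
  filter_upwards [ev_one hQ] with p hq x
  have hq0 : 0 < Q p := by linarith
  have := norm_iteratedFDeriv_comp_le (𝕜 := ℝ) (g := Φ) (f := fun x => ((Q p ^ L) • ph θ) x) (n := k) (N := ∞)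
    hΦ (ContinuousLinearMap.contDiff _) (nn k le_rfl) x (C := 1) (D := (1 + ‖ph θ‖) * Q p ^ L) ?_ ?_
  · refine (le_of_eq ?_).trans (this.trans (le_of_eq ?_))
    · rfl
    rw [mul_pow, ← Real.rpow_natCast (Q p ^ L), ← Real.rpow_mul hq0.le]
    ring_nf
  · intro i hi
    exact hb i _
  · intro i hi1 hi
    rcases Nat.lt_or_ge 1 i with h | h
    · have : ‖iteratedFDeriv ℝ i (fun x => ((Q p ^ L) • ph θ) x) x‖ = 0 := by
        obtain ⟨j, rfl⟩ : ∃ j, i = j + 2 := ⟨i - 2, by omega⟩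
        rw [show j + 2 = (j + 1) + 1 by ring, ← norm_iteratedFDeriv_fderiv]
        have h2 : _root_.fderiv ℝ (fun x => ((Q p ^ L) • ph θ) x) = fun _ => (Q p ^ L) • ph θ := by
          ext1 y
          exact ((Q p ^ L) • ph θ).fderiv
        rw [h2, iteratedFDeriv_const_of_ne (by omega)]
        simp
      rw [this]
      positivity
    · obtain rfl : i = 1 := by omega
      rw [show (1 : ℕ) = 0 + 1 by rfl, ← norm_iteratedFDeriv_fderiv, norm_iteratedFDeriv_zero]
      have h2 : _root_.fderiv ℝ (fun x => ((Q p ^ L) • ph θ) x) x = (Q p ^ L) • ph θ :=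
        ((Q p ^ L) • ph θ).fderiv
      rw [h2, norm_smul, Real.norm_of_nonneg (by positivity)]
      have : 0 < Q p ^ L := by positivity
      simp
      nlinarith

theorem trig_bd (k : ℕ) : (∀ t, ‖iteratedFDeriv ℝ k Real.cos t‖ ≤ 1) ∧ (∀ t, ‖iteratedFDeriv ℝ k Real.sin t‖ ≤ 1) := by
  constructor
  · intro t
    rw [norm_iteratedFDeriv_eq_norm_iteratedDeriv]
    exact Real.abs_iteratedDeriv_cos_le_one k t
  · intro t
    rw [norm_iteratedFDeriv_eq_norm_iteratedDeriv]
    exact Real.abs_iteratedDeriv_sin_le_one k t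

theorem Sy.cos (hQ : Tendsto Q l atTop) (θ : Fin n → ℝ) (L : ℝ) :
    Sy l Q 0 L (fun p x => Real.cos (Q p ^ L * ph θ x)) :=
  Sy.osc_aux hQ Real.cos Real.contDiff_cos (fun k => (trig_bd k).1) θ L

theorem Sy.sin (hQ : Tendsto Q l atTop) (θ : Fin n → ℝ) (L : ℝ) :
    Sy l Q 0 L (fun p x => Real.sin (Q p ^ L * ph θ x)) :=
  Sy.osc_aux hQ Real.sin Real.contDiff_sin (fun k => (trig_bd k).2) θ L

/-! pointwise rules -/

theorem pder_add' {f g : (Fin n → ℝ) → G} {x} (i : Fin n) (hf : DifferentiableAt ℝ f x)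
    (hg : DifferentiableAt ℝ g x) : pder i (fun x => f x + g x) x = pder i f x + pder i g x := by
  simp only [pder]
  rw [fderiv_fun_add hf hg]; rfl

theorem pder_sub' {f g : (Fin n → ℝ) → G} {x} (i : Fin n) (hf : DifferentiableAt ℝ f x)
    (hg : DifferentiableAt ℝ g x) : pder i (fun x => f x - g x) x = pder i f x - pder i g x := by
  simp only [pder]
  rw [fderiv_fun_sub hf hg]; rfl

theorem pder_neg' {f : (Fin n → ℝ) → G} {x} (i : Fin n) :
    pder i (fun x => - f x) x = - pder i f x := by
  simp only [pder]
  rw [fderiv_fun_neg]; rfl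

theorem pder_const' (c : G) (x : Fin n → ℝ) (i : Fin n) :
    pder i (fun _ => c) x = 0 := by
  simp [pder]

theorem pder_sum' {ι : Type} (s : Finset ι) {f : ι → (Fin n → ℝ) → G} {x} (i : Fin n)
    (hf : ∀ k ∈ s, DifferentiableAt ℝ (f k) x) :
    pder i (fun x => ∑ k ∈ s, f k x) x = ∑ k ∈ s, pder i (f k) x := by
  simp only [pder]
  rw [fderiv_fun_sum hf]; simp

theorem pder_mul' {f g : (Fin n → ℝ) → ℝ} {x} (i : Fin n) (hf : DifferentiableAt ℝ f x)
    (hg : DifferentiableAt ℝ g x) :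
    pder i (fun x => f x * g x) x = f x * pder i g x + pder i f x * g x := by
  simp only [pder]
  rw [fderiv_fun_mul hf hg]; simp [mul_comm]

theorem pder_const_mul' {f : (Fin n → ℝ) → ℝ} {x} (c : ℝ) (i : Fin n) (hf : DifferentiableAt ℝ f x) :
    pder i (fun x => c * f x) x = c * pder i f x := by
  simp only [pder]
  rw [fderiv_const_mul hf]; simp

theorem pder_smul' {f : (Fin n → ℝ) → ℝ} {g : (Fin n → ℝ) → G} {x} (i : Fin n) (hf : DifferentiableAt ℝ f x)
    (hg : DifferentiableAt ℝ g x) :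
    pder i (fun x => f x • g x) x = f x • pder i g x + pder i f x • g x := by
  simp only [pder]
  rw [fderiv_fun_smul hf hg]; simp

theorem pder_inner' {f g : (Fin n → ℝ) → F} {x} (i : Fin n) (hf : DifferentiableAt ℝ f x)
    (hg : DifferentiableAt ℝ g x) :
    pder i (fun x => inner ℝ (f x) (g x)) x = inner ℝ (f x) (pder i g x) + inner ℝ (pder i f x) (g x) := by
  simp only [pder]
  rw [fderiv_inner_apply ℝ hf hg]

theorem diff_phase (c : ℝ) (θ x : Fin n → ℝ) : DifferentiableAt ℝ (fun x => c * ph θ x) x :=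
  ((ph θ).differentiableAt).const_mul c

theorem pder_phase (c : ℝ) (θ x : Fin n → ℝ) (i : Fin n) : pder i (fun x => c * ph θ x) x = c * θ i := by
  rw [pder_const_mul' c i (ph θ).differentiableAt]
  simp [pder, ph_single]

theorem pder_cos' (c : ℝ) (θ x : Fin n → ℝ) (i : Fin n) :
    pder i (fun x => Real.cos (c * ph θ x)) x = - (c * θ i * Real.sin (c * ph θ x)) := by
  have h := pder_phase c θ x i
  simp only [pder] at h ⊢
  rw [fderiv_cos (diff_phase c θ x)]
  simp [h]
  ring

theorem pder_sin' (c : ℝ) (θ x : Fin n → ℝ) (i : Fin n) :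
    pder i (fun x => Real.sin (c * ph θ x)) x = c * θ i * Real.cos (c * ph θ x) := by
  have h := pder_phase c θ x i
  simp only [pder] at h ⊢
  rw [fderiv_sin (diff_phase c θ x)]
  simp [h]
  ring

theorem diff_cos (c : ℝ) (θ x : Fin n → ℝ) : DifferentiableAt ℝ (fun x => Real.cos (c * ph θ x)) x :=
  (diff_phase c θ x).cos

theorem diff_sin (c : ℝ) (θ x : Fin n → ℝ) : DifferentiableAt ℝ (fun x => Real.sin (c * ph θ x)) x :=
  (diff_phase c θ x).sin

theorem sm_diff {f : (Fin n → ℝ) → G} (hf : ContDiff ℝ ∞ f) (x) : DifferentiableAt ℝ f x :=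
  (hf.differentiable (by simp)).differentiableAt

theorem sm_pder {f : (Fin n → ℝ) → G} (hf : ContDiff ℝ ∞ f) (i : Fin n) : ContDiff ℝ ∞ (pder i f) :=
  (hf.fderiv_right (m := ∞) (by simp)).clm_apply contDiff_const

theorem pder_comm' {f : (Fin n → ℝ) → G} (hf : ContDiff ℝ ∞ f) (i j : Fin n) (x) :
    pder i (pder j f) x = pder j (pder i f) x := by
  have hd : DifferentiableAt ℝ (fderiv ℝ f) x :=
    ((hf.fderiv_right (m := ∞) (by simp)).differentiable (by simp)).differentiableAt
  have key : ∀ i j : Fin n, pder i (pder j f) x = fderiv ℝ (fderiv ℝ f) x (Pi.single i 1) (Pi.single j 1) := by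
    intro i j
    show fderiv ℝ (fun y => fderiv ℝ f y (Pi.single j 1)) x (Pi.single i 1) = _
    rw [fderiv_clm_apply hd (by fun_prop)]
    simp
  rw [key, key]
  have h2 : IsSymmSndFDerivAt ℝ f x := hf.contDiffAt.isSymmSndFDerivAt (by simp; exact nn 2 le_rfl)
  exact h2 _ _

end B
end NK

namespace NK
open Filter Topology
open scoped ContDiff
section C

variable {P : Type} {n : ℕ}
variable {l : Filter P} {Q : P → ℝ}

/-- Oscillation with shift. -/
noncomputable def os (Q : P → ℝ) (L : ℝ) (θ : Fin n → ℝ) (s : ℝ) : P → (Fin n → ℝ) → ℝ :=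
  fun p x => Real.cos (Q p ^ L * ph θ x + s)

theorem os_eq (L : ℝ) (θ : Fin n → ℝ) (s : ℝ) (p x) : os Q L θ s p x =
    Real.cos s * Real.cos (Q p ^ L * ph θ x) - Real.sin s * Real.sin (Q p ^ L * ph θ x) := by
  rw [os, Real.cos_add]; ring

theorem os_Sy (hQ : Tendsto Q l atTop) (L : ℝ) (θ : Fin n → ℝ) (s : ℝ) :
    Sy l Q 0 L (os Q L θ s) :=
  Sy.congr (((Sy.cos hQ θ L).const_mul (Real.cos s)).sub ((Sy.sin hQ θ L).const_mul (Real.sin s)))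
    (Eventually.of_forall fun p x => os_eq L θ s p x)

theorem os_diff (L : ℝ) (θ : Fin n → ℝ) (s : ℝ) (p x) : DifferentiableAt ℝ (os Q L θ s p) x := by
  unfold os
  exact ((diff_phase _ θ x).add_const s).cos

theorem os_pder (L : ℝ) (θ : Fin n → ℝ) (s : ℝ) (p x) (i : Fin n) :
    pder i (os Q L θ s p) x = Q p ^ L * θ i * os Q L θ (s + Real.pi / 2) p x := by
  have : os Q L θ s p = fun x => Real.cos s * Real.cos (Q p ^ L * ph θ x)
      - Real.sin s * Real.sin (Q p ^ L * ph θ x) := by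
    ext x; exact os_eq L θ s p x
  rw [this, pder_sub' i ((diff_cos _ _ _).const_mul _) ((diff_sin _ _ _).const_mul _),
    pder_const_mul' _ i (diff_cos _ _ _), pder_const_mul' _ i (diff_sin _ _ _), pder_cos', pder_sin',
    os_eq, Real.cos_add_pi_div_two, Real.sin_add_pi_div_two]
  ring

/-- A family of symmetric tensors which is a symmetric gradient up to
a tensor with vanishing `o`-row and a small error. -/
def Res (l : Filter P) (Q : P → ℝ) (o : Fin n) (α L ρ : ℝ)
    (X : Fin n → Fin n → P → (Fin n → ℝ) → ℝ) : Prop :=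
  ∃ (y : Fin n → P → (Fin n → ℝ) → ℝ) (C R : Fin n → Fin n → P → (Fin n → ℝ) → ℝ),
    (∀ i, Sy l Q (α - L) L (y i)) ∧ (∀ i j, Sy l Q α L (C i j)) ∧ (∀ i j, Sy l Q ρ L (R i j)) ∧
    (∀ᶠ p in l, ∀ x i j, C i j p x = C j i p x ∧ C o i p x = 0) ∧
    ∀ᶠ p in l, ∀ x i j, X i j p x
      = pder j (y i p) x + pder i (y j p) x + C i j p x + R i j p x

theorem Res.congr {o : Fin n} {α L ρ : ℝ} {X Y : Fin n → Fin n → P → (Fin n → ℝ) → ℝ}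
    (h : Res l Q o α L ρ X) (he : ∀ᶠ p in l, ∀ x i j, Y i j p x = X i j p x) :
    Res l Q o α L ρ Y := by
  obtain ⟨y, C, R, h1, h2, h3, h4, h5⟩ := h
  refine ⟨y, C, R, h1, h2, h3, h4, ?_⟩
  filter_upwards [h5, he] with p a b x i j
  rw [b, a]

theorem Res.add {o : Fin n} {α L ρ : ℝ} {X Y : Fin n → Fin n → P → (Fin n → ℝ) → ℝ}
    (h : Res l Q o α L ρ X) (h' : Res l Q o α L ρ Y) :
    Res l Q o α L ρ (fun i j p x => X i j p x + Y i j p x) := by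
  obtain ⟨y, C, R, h1, h2, h3, h4, h5⟩ := h
  obtain ⟨y', C', R', h1', h2', h3', h4', h5'⟩ := h'
  refine ⟨fun i p x => y i p x + y' i p x, fun i j p x => C i j p x + C' i j p x,
    fun i j p x => R i j p x + R' i j p x, fun i => (h1 i).add (h1' i),
    fun i j => (h2 i j).add (h2' i j), fun i j => (h3 i j).add (h3' i j), ?_, ?_⟩
  · filter_upwards [h4, h4'] with p a b x i j
    rw [(a x i j).1, (b x i j).1, (a x i j).2, (b x i j).2]; simp
  · have e1 : ∀ᶠ p in l, ∀ i, ContDiff ℝ ∞ (y i p) := eventually_all.2 fun i => (h1 i).1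
    have e2 : ∀ᶠ p in l, ∀ i, ContDiff ℝ ∞ (y' i p) := eventually_all.2 fun i => (h1' i).1
    filter_upwards [h5, h5', e1, e2] with p a b s1 s2 x i j
    rw [a, b, pder_add' _ (sm_diff (s1 _) x) (sm_diff (s2 _) x),
      pder_add' _ (sm_diff (s1 _) x) (sm_diff (s2 _) x)]
    ring

theorem Res.zero {o : Fin n} {α L ρ : ℝ} :
    Res l Q o α L ρ (fun _ _ _ _ => 0) := by
  refine ⟨fun _ _ _ => 0, fun _ _ _ _ => 0, fun _ _ _ _ => 0, fun _ => Sy.zero, fun _ _ => Sy.zero,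
    fun _ _ => Sy.zero, by simp, by simp [pder_const']⟩

theorem Res.sum {o : Fin n} {α L ρ : ℝ} {ι : Type} (s : Finset ι)
    {X : ι → Fin n → Fin n → P → (Fin n → ℝ) → ℝ}
    (h : ∀ k ∈ s, Res l Q o α L ρ (X k)) :
    Res l Q o α L ρ (fun i j p x => ∑ k ∈ s, X k i j p x) := by
  classical
  induction s using Finset.induction_on with
  | empty => simpa using Res.zero
  | insert a s ha ih =>
    refine ((h a (by simp)).add (ih fun k hk => h k (by simp [hk]))).congr
      (Eventually.of_forall fun p x i j => ?_)
    rw [Finset.sum_insert ha]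

theorem Res.mono (hQ : Tendsto Q l atTop) {o : Fin n} {α α' L ρ ρ' : ℝ}
    {X : Fin n → Fin n → P → (Fin n → ℝ) → ℝ}
    (h : Res l Q o α L ρ X) (ha : α ≤ α') (hr : ρ ≤ ρ') : Res l Q o α' L ρ' X := by
  obtain ⟨y, C, R, h1, h2, h3, h4, h5⟩ := h
  exact ⟨y, C, R, fun i => (h1 i).mono hQ (by linarith) le_rfl, fun i j => (h2 i j).mono hQ ha le_rfl,
    fun i j => (h3 i j).mono hQ hr le_rfl, h4, h5⟩

theorem Res.osc_aux (hQ : Tendsto Q l atTop) {L m : ℝ} (hm : m ≤ L) (o : Fin n)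
    (θ : Fin n → ℝ) (hθ : θ o ≠ 0) (N : ℕ) : ∀ (α : ℝ) (A : Fin n → Fin n → P → (Fin n → ℝ) → ℝ) (s : ℝ),
    (∀ i j, Sy l Q α m (A i j)) → (∀ᶠ p in l, ∀ x i j, A i j p x = A j i p x) →
    Res l Q o α L (α + N * (m - L)) (fun i j p x => A i j p x * os Q L θ s p x) := by
  induction N with
  | zero =>
    intro α A s hA hs
    refine ⟨fun _ _ _ => 0, fun _ _ _ _ => 0, fun i j p x => A i j p x * os Q L θ s p x,
      fun _ => Sy.zero, fun _ _ => Sy.zero, ?_, by simp, by simp [pder_const']⟩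
    intro i j
    have := Sy.mul hQ ((hA i j).mono hQ le_rfl hm) (os_Sy hQ L θ s)
    simpa using this
  | succ N ih =>
    intro α A s hA hs
    set z : Fin n → P → (Fin n → ℝ) → ℝ := fun i p x =>
      (1 / θ o) * A o i p x + (- (θ i / (2 * θ o ^ 2))) * A o o p x with hz
    have zS : ∀ i, Sy l Q α m (z i) := fun i =>
      ((hA o i).const_mul _).add ((hA o o).const_mul _)
    have lamS : Sy l Q (-L) L (fun p (_ : Fin n → ℝ) => Q p ^ (-L)) := Sy.pow hQ
    have oS := os_Sy (l := l) hQ L θ (s - Real.pi / 2)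
    have lamSm : Sy l Q (-L) m (fun p (_ : Fin n → ℝ) => Q p ^ (-L)) := Sy.pow hQ
    -- new amplitude
    have key := ih (α + (m - L)) (fun i j p x => - (Q p ^ (-L) * (pder j (z i p) x + pder i (z j p) x)))
      (s - Real.pi / 2) ?_ ?_
    · have hfirst : Res l Q o α L (α + (N + 1 : ℕ) * (m - L)) (fun i j p x => A i j p x * os Q L θ s p x
          - (- (Q p ^ (-L) * (pder j (z i p) x + pder i (z j p) x))) * os Q L θ (s - Real.pi / 2) p x) := by
        refine ⟨fun i p x => Q p ^ (-L) * (z i p x * os Q L θ (s - Real.pi / 2) p x),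
          fun i j p x => (A i j p x - θ j * z i p x - θ i * z j p x) * os Q L θ s p x,
          fun _ _ _ _ => 0, ?_, ?_, fun _ _ => Sy.zero, ?_, ?_⟩
        · intro i
          have := Sy.mul hQ lamS (Sy.mul hQ ((zS i).mono hQ le_rfl hm) oS)
          exact this.mono hQ (by linarith) le_rfl
        · intro i j
          have := Sy.mul hQ ((((hA i j).sub ((zS i).const_mul (θ j))).sub
            ((zS j).const_mul (θ i))).mono hQ le_rfl hm) (os_Sy hQ L θ s)
          exact this.mono hQ (by linarith) le_rfl
        · filter_upwards [hs] with p h x i j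
          constructor
          · rw [h x i j]; ring
          · simp only [hz]
            field_simp
            ring
        · have e1 : ∀ᶠ p in l, ∀ i, ContDiff ℝ ∞ (z i p) := eventually_all.2 fun i => (zS i).1
          filter_upwards [ev_one hQ, e1] with p hq hsm x i j
          have hy : ∀ i j, pder j (fun x => Q p ^ (-L) * (z i p x * os Q L θ (s - Real.pi / 2) p x)) x
              = θ j * z i p x * os Q L θ s p x
                + Q p ^ (-L) * pder j (z i p) x * os Q L θ (s - Real.pi / 2) p x := by
            intro i j
            rw [pder_const_mul' _ _ ((sm_diff (hsm i) x).fun_mul (os_diff _ _ _ _ _)),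
              pder_mul' _ (sm_diff (hsm i) x) (os_diff _ _ _ _ _), os_pder]
            have : Q p ^ (-L) * Q p ^ L = 1 := by
              rw [← Real.rpow_add (by linarith)]; simp
            rw [show s - Real.pi / 2 + Real.pi / 2 = s by ring]
            linear_combination (θ j * z i p x * os Q L θ s p x) * this
          rw [hy, hy]
          ring
      have hk : Res l Q o α L (α + (N + 1 : ℕ) * (m - L)) _ :=
        key.mono hQ (by linarith) (by push_cast; linarith)
      refine (hfirst.add hk).congr (Eventually.of_forall fun p x i j => ?_)
      ring
    · intro i j
      refine (Sy.mul hQ lamSm (((zS i).pder j).add ((zS j).pder i))).neg.mono hQ (by linarith) le_rfl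
    · exact Eventually.of_forall fun p x i j => by ring

theorem Res.osc (hQ : Tendsto Q l atTop) {L m : ℝ} (hm : m < L) (o : Fin n) (ρ α : ℝ)
    (θ : Fin n → ℝ) (hθ : θ o ≠ 0) (A : Fin n → Fin n → P → (Fin n → ℝ) → ℝ) (s : ℝ)
    (hA : ∀ i j, Sy l Q α m (A i j)) (hs : ∀ᶠ p in l, ∀ x i j, A i j p x = A j i p x) :
    Res l Q o α L ρ (fun i j p x => A i j p x * os Q L θ s p x) := by
  obtain ⟨N, hN⟩ := exists_nat_ge ((ρ - α) / (m - L))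
  refine (Res.osc_aux hQ hm.le o θ hθ N α A s hA hs).mono hQ le_rfl ?_
  have : m - L < 0 := by linarith
  rw [div_le_iff_of_neg this] at hN
  linarith

end C
end NK

namespace NK
open Filter Topology
open scoped ContDiff
section D

variable {P : Type} {n : ℕ} {F : Type} [NormedAddCommGroup F] [InnerProductSpace ℝ F]
variable {l : Filter P} {Q : P → ℝ}


/-- A family of immersions with adapted frames at frequency `Q ^ m`. -/
structure Fr (l : Filter P) (Q : P → ℝ) (m β : ℝ) (u : P → (Fin n → ℝ) → F)
    (ζ T : Fin n → P → (Fin n → ℝ) → F) : Prop where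
  sm : ∀ᶠ p in l, ContDiff ℝ ∞ (u p)
  du : ∀ i, Sy l Q 0 m (fun p => pder i (u p))
  ddu : ∀ i j, Sy l Q (-β + m) m (fun p => pder j (pder i (u p)))
  ze : ∀ k, Sy l Q 0 m (ζ k)
  te : ∀ k, Sy l Q 0 m (T k)
  r1 : ∀ᶠ p in l, ∀ x i k, (inner ℝ (pder i (u p) x) (ζ k p x)) = 0
  r2 : ∀ᶠ p in l, ∀ x k r, (inner ℝ (ζ k p x) (ζ r p x)) = if k = r then 1 else 0
  r3 : ∀ᶠ p in l, ∀ x i r, (inner ℝ (pder i (u p) x) (T r p x)) = if i = r then 1 else 0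

theorem ip_ibp {v W : (Fin n → ℝ) → F} {y : (Fin n → ℝ) → ℝ} {x : Fin n → ℝ}
    (hv : DifferentiableAt ℝ v x) (hW : DifferentiableAt ℝ W x) (h : ∀ x, (inner ℝ (v x) (W x)) = y x) (j : Fin n) :
    (inner ℝ (v x) (pder j W x)) = pder j y x - (inner ℝ (pder j v x) (W x)) := by
  have : y = fun x => (inner ℝ (v x) (W x)) := by ext x; rw [h]
  rw [this, pder_inner' j hv hW]
  ring

/-- frequency vector -/
noncomputable def fq (ξ : Fin n → Fin n → ℝ) (k : Fin n) : Fin n → ℝ := ((k : ℝ) + 1) • ξ k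

noncomputable def co (Q : P → ℝ) (L : ℝ) (ξ : Fin n → Fin n → ℝ) (k : Fin n) := os Q L (fq ξ k) 0
noncomputable def si (Q : P → ℝ) (L : ℝ) (ξ : Fin n → Fin n → ℝ) (k : Fin n) := os Q L (fq ξ k) (-(Real.pi / 2))
noncomputable def si2 (Q : P → ℝ) (L : ℝ) (ξ : Fin n → Fin n → ℝ) (k : Fin n) :=
  os Q L ((2 : ℝ) • fq ξ k) (-(Real.pi / 2))
noncomputable def co2 (Q : P → ℝ) (L : ℝ) (ξ : Fin n → Fin n → ℝ) (k : Fin n) :=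
  os Q L ((2 : ℝ) • fq ξ k) 0

theorem co_sq (L : ℝ) (ξ : Fin n → Fin n → ℝ) (k : Fin n) (p x) :
    2 * co Q L ξ k p x ^ 2 = 1 + co2 Q L ξ k p x := by
  simp only [co, co2, os, ph_smul, add_zero]
  rw [show Q p ^ L * (2 * ph (fq ξ k) x) = 2 * (Q p ^ L * ph (fq ξ k) x) by ring, Real.cos_two_mul]
  ring

noncomputable def ka (k : Fin n) : ℝ := ((k : ℝ) + 1)⁻¹

theorem ka_mul (k : Fin n) : ka k * ((k : ℝ) + 1) = 1 := by
  unfold ka; have : (k : ℝ) + 1 ≠ 0 := by positivity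
  field_simp

/-- the main corrugation -/
noncomputable def Wf (Q : P → ℝ) (L : ℝ) (ξ : Fin n → Fin n → ℝ) (a : Fin n → P → (Fin n → ℝ) → ℝ)
    (ζ : Fin n → P → (Fin n → ℝ) → F) : P → (Fin n → ℝ) → F :=
  fun p x => ∑ k, (√2 * ka k * Q p ^ (-L) * si Q L ξ k p x) • (a k p x • ζ k p x)

noncomputable def Zf (Q : P → ℝ) (L : ℝ) (ξ : Fin n → Fin n → ℝ) (a : Fin n → P → (Fin n → ℝ) → ℝ)
    (ζ : Fin n → P → (Fin n → ℝ) → F) (i : Fin n) : P → (Fin n → ℝ) → F :=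
  fun p x => ∑ k, (√2 * ka k * Q p ^ (-L) * si Q L ξ k p x) • pder i (fun x => a k p x • ζ k p x) x

noncomputable def y1f (Q : P → ℝ) (L : ℝ) (ξ : Fin n → Fin n → ℝ) (a : Fin n → P → (Fin n → ℝ) → ℝ)
    (i : Fin n) : P → (Fin n → ℝ) → ℝ :=
  fun p x => ∑ k, (-(ka k / 4 * ξ k i) * Q p ^ (-L)) * (a k p x ^ 2 * si2 Q L ξ k p x)

noncomputable def wf (y : Fin n → P → (Fin n → ℝ) → ℝ)
    (T : Fin n → P → (Fin n → ℝ) → F) : P → (Fin n → ℝ) → F :=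
  fun p x => ∑ r, y r p x • T r p x

/-- The error tensor of leading order. -/
noncomputable def Xf (Q : P → ℝ) (L : ℝ) (ξ : Fin n → Fin n → ℝ) (u : P → (Fin n → ℝ) → F)
    (ζ : Fin n → P → (Fin n → ℝ) → F)
    (a : Fin n → P → (Fin n → ℝ) → ℝ) (i j : Fin n) : P → (Fin n → ℝ) → ℝ :=
  fun p x => - ((inner ℝ (pder j (pder i (u p)) x) (Wf Q L ξ a ζ p x)) + (inner ℝ (pder i (pder j (u p)) x) (Wf Q L ξ a ζ p x)))
    + ∑ k, (√2 * (a k p x * co Q L ξ k p x)) * (ξ k i * (inner ℝ (ζ k p x) (Zf Q L ξ a ζ j p x)) +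
        ξ k j * (inner ℝ (ζ k p x) (Zf Q L ξ a ζ i p x)))
    + (inner ℝ (Zf Q L ξ a ζ i p x) (Zf Q L ξ a ζ j p x))
    - ∑ k, (ka k / 4 * Q p ^ (-L)) * ((ξ k i * pder j (fun x => a k p x ^ 2) x +
        ξ k j * pder i (fun x => a k p x ^ 2) x) * si2 Q L ξ k p x)

variable {m L β : ℝ} {u : P → (Fin n → ℝ) → F} {ζ T : Fin n → P → (Fin n → ℝ) → F}
  {ξ : Fin n → Fin n → ℝ} {a : Fin n → P → (Fin n → ℝ) → ℝ}

theorem qq (p : P) (hq : 1 ≤ Q p) : Q p ^ (-L) * Q p ^ L = 1 := by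
  rw [← Real.rpow_add (by linarith)]; simp

theorem W_pder (p : P) (hq : 1 ≤ Q p) (ha : ∀ k, ContDiff ℝ ∞ (a k p)) (hz : ∀ k, ContDiff ℝ ∞ (ζ k p))
    (i : Fin n) (x) : pder i (Wf Q L ξ a ζ p) x
      = ∑ k, (√2 * (a k p x * co Q L ξ k p x) * ξ k i) • ζ k p x + Zf Q L ξ a ζ i p x := by
  unfold Wf Zf
  have d1 : ∀ k, DifferentiableAt ℝ (fun x => a k p x • ζ k p x) x := fun k =>
    sm_diff ((ha k).smul (hz k)) x
  have d2 : ∀ k, DifferentiableAt ℝ (fun x => √2 * ka k * Q p ^ (-L) * si Q L ξ k p x) x := fun k =>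
    (os_diff _ _ _ _ _).const_mul _
  rw [pder_sum' _ _ (fun k _ => (d2 k).fun_smul (d1 k)), ← Finset.sum_add_distrib]
  refine Finset.sum_congr rfl fun k _ => ?_
  rw [pder_smul' _ (d2 k) (d1 k), add_comm,
    pder_const_mul' _ _ (show DifferentiableAt ℝ (si Q L ξ k p) x from os_diff _ _ _ _ _), si, os_pder, smul_smul]
  congr 2
  rw [show -(Real.pi / 2) + Real.pi / 2 = 0 by ring, co]
  simp only [fq, Pi.smul_apply, smul_eq_mul]
  have h1 := qq (L := L) p hq
  have h2 := ka_mul k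
  calc _ = (√2 * (a k p x * os Q L (((k : ℝ) + 1) • ξ k) 0 p x) * ξ k i) * (Q p ^ (-L) * Q p ^ L) * (ka k * ((k : ℝ) + 1)) := by ring
    _ = _ := by rw [h1, h2]; simp [fq]

theorem y1_pder (p : P) (hq : 1 ≤ Q p) (ha : ∀ k, ContDiff ℝ ∞ (a k p)) 
    (i j : Fin n) (x) : pder j (y1f Q L ξ a i p) x
      = - ∑ k, a k p x ^ 2 * ξ k i * ξ k j * co2 Q L ξ k p x / 2
       - ∑ k, (ka k / 4 * Q p ^ (-L)) * (ξ k i * pder j (fun x => a k p x ^ 2) x * si2 Q L ξ k p x) := by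
  unfold y1f
  have d1 : ∀ k, DifferentiableAt ℝ (fun x => a k p x ^ 2) x := fun k =>
    sm_diff ((ha k).pow 2) x
  have d2 : ∀ k, DifferentiableAt ℝ (si2 Q L ξ k p) x := fun k => os_diff _ _ _ _ _
  rw [pder_sum' _ _ (fun k _ => ((d1 k).fun_mul (d2 k)).const_mul _), ← Finset.sum_neg_distrib, ← Finset.sum_sub_distrib]
  refine Finset.sum_congr rfl fun k _ => ?_
  rw [pder_const_mul' _ _ ((d1 k).fun_mul (d2 k)), pder_mul' _ (d1 k) (d2 k), si2, os_pder,
    show -(Real.pi / 2) + Real.pi / 2 = 0 by ring, co2]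
  simp only [fq, Pi.smul_apply, smul_eq_mul]
  have h1 := qq (L := L) p hq
  have h2 := ka_mul k
  have h3 : ka k * ((k : ℝ) + 1) * (Q p ^ (-L) * Q p ^ L) = 1 := by rw [h1, h2]; simp
  linear_combination (- a k p x ^ 2 * ξ k i * ξ k j * os Q L ((2 : ℝ) • ((k:ℝ) + 1) • ξ k) 0 p x / 2) * h3

theorem WW (p : P) (hq : 1 ≤ Q p) (ha : ∀ k, ContDiff ℝ ∞ (a k p)) (hz : ∀ k, ContDiff ℝ ∞ (ζ k p))
    (x) (hon : ∀ k r, (inner ℝ (ζ k p x) (ζ r p x)) = if k = r then 1 else 0)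
    (i j : Fin n) : (inner ℝ (pder i (Wf Q L ξ a ζ p) x) (pder j (Wf Q L ξ a ζ p) x))
      = ∑ k, a k p x ^ 2 * ξ k i * ξ k j + ∑ k, a k p x ^ 2 * ξ k i * ξ k j * co2 Q L ξ k p x
       + ∑ k, (√2 * (a k p x * co Q L ξ k p x)) * (ξ k i * (inner ℝ (ζ k p x) (Zf Q L ξ a ζ j p x)) +
        ξ k j * (inner ℝ (ζ k p x) (Zf Q L ξ a ζ i p x)))
    + (inner ℝ (Zf Q L ξ a ζ i p x) (Zf Q L ξ a ζ j p x)) := by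
  rw [W_pder p hq ha hz, W_pder p hq ha hz, inner_add_left, inner_add_right, inner_add_right]
  have e1 : (inner ℝ (∑ k, (√2 * (a k p x * co Q L ξ k p x) * ξ k i) • ζ k p x) (∑ k, (√2 * (a k p x * co Q L ξ k p x) * ξ k j) • ζ k p x)) =
      ∑ k, a k p x ^ 2 * ξ k i * ξ k j + ∑ k, a k p x ^ 2 * ξ k i * ξ k j * co2 Q L ξ k p x := by
    rw [sum_inner, ← Finset.sum_add_distrib]
    refine Finset.sum_congr rfl fun k _ => ?_
    simp only [inner_sum, inner_smul_left, inner_smul_right, hon]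
    simp
    have h := co_sq (Q := Q) L ξ k p x
    have h2 : √2 * √2 = 2 := Real.mul_self_sqrt (by norm_num)
    linear_combination (a k p x ^ 2 * ξ k i * ξ k j) * h +  (a k p x ^ 2 * ξ k i * ξ k j * co Q L ξ k p x ^ 2) * h2
  have e2 : ∀ V : F, ∀ i : Fin n, (inner ℝ (∑ k, (√2 * (a k p x * co Q L ξ k p x) * ξ k i) • ζ k p x) V)
      = ∑ k, (√2 * (a k p x * co Q L ξ k p x)) * (ξ k i * (inner ℝ (ζ k p x) V)) := by
    intro V i
    rw [sum_inner]
    refine Finset.sum_congr rfl fun k _ => ?_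
    rw [inner_smul_left]; simp; ring
  rw [e1, e2, real_inner_comm, e2]
  simp only [mul_add, Finset.sum_add_distrib]
  ring

theorem qS (hQ : Tendsto Q l atTop) (L b : ℝ) :
    Sy l Q (-L) b (fun p (_ : Fin n → ℝ) => Q p ^ (-L)) := Sy.pow hQ

theorem W_Sy (hQ : Tendsto Q l atTop) (hm : m ≤ L) (hz : ∀ k, Sy l Q 0 m (ζ k))
    (ha : ∀ k, Sy l Q (-β) m (a k)) : Sy l Q (-β - L) L (Wf Q L ξ a ζ) := by
  unfold Wf
  refine Sy.sum _ fun k _ => ?_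
  have h1 := ((qS (n := n) hQ L L).const_mul (√2 * ka k)).mul hQ (os_Sy hQ L (fq ξ k) (-(Real.pi / 2)))
  have h2 := ((ha k).smul hQ (hz k)).mono hQ le_rfl hm
  exact (h1.smul hQ h2).mono hQ (by linarith) le_rfl

theorem Z_Sy (hQ : Tendsto Q l atTop) (hm : m ≤ L) (hz : ∀ k, Sy l Q 0 m (ζ k))
    (ha : ∀ k, Sy l Q (-β) m (a k)) (i : Fin n) : Sy l Q (-β + m - L) L (Zf Q L ξ a ζ i) := by
  unfold Zf
  refine Sy.sum _ fun k _ => ?_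
  have h1 := ((qS (n := n) hQ L L).const_mul (√2 * ka k)).mul hQ (os_Sy hQ L (fq ξ k) (-(Real.pi / 2)))
  have h2 := (((ha k).smul hQ (hz k)).pder i).mono hQ le_rfl hm
  exact (h1.smul hQ h2).mono hQ (by linarith) le_rfl

theorem sq_Sy (hQ : Tendsto Q l atTop) {f : P → (Fin n → ℝ) → ℝ} {α b : ℝ} (ha : Sy l Q α b f) :
    Sy l Q (α + α) b (fun p x => f p x ^ 2) :=
  (ha.mul hQ ha).congr (Eventually.of_forall fun p x => by ring)

theorem y1_Sy (hQ : Tendsto Q l atTop) (hm : m ≤ L) 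
    (ha : ∀ k, Sy l Q (-β) m (a k)) (i : Fin n) : Sy l Q (-2 * β - L) L (y1f Q L ξ a i) := by
  unfold y1f
  refine Sy.sum _ fun k _ => ?_
  have h1 := ((qS (n := n) hQ L L).const_mul (-(ka k / 4 * ξ k i)))
  have h2 := ((sq_Sy hQ (ha k)).mono hQ le_rfl hm).mul hQ (os_Sy hQ L ((2 : ℝ) • fq ξ k) (-(Real.pi / 2)))
  exact (h1.mul hQ h2).mono hQ (by linarith) le_rfl

theorem w_Sy (hQ : Tendsto Q l atTop) (hm : m ≤ L) (ht : ∀ k, Sy l Q 0 m (T k)) {y : Fin n → P → (Fin n → ℝ) → ℝ}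
    {α : ℝ} (hy : ∀ i, Sy l Q α L (y i)) : Sy l Q α L (wf y T) := by
  unfold wf
  refine Sy.sum _ fun k _ => ?_
  exact ((hy k).smul hQ ((ht k).mono hQ le_rfl hm)).mono hQ (by linarith) le_rfl

theorem X_Sy (hQ : Tendsto Q l atTop) (hm : m ≤ L) (hF : Fr l Q m β u ζ T)
    (ha : ∀ k, Sy l Q (-β) m (a k)) (i j : Fin n) :
    Sy l Q (-2 * β + m - L) L (Xf Q L ξ u ζ a i j) := by
  have hW := W_Sy (ξ := ξ) hQ hm hF.ze ha
  have hZ := Z_Sy (ξ := ξ) hQ hm hF.ze ha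
  unfold Xf
  refine Sy.sub (Sy.add (Sy.add (Sy.neg (Sy.add ?_ ?_)) (Sy.sum _ fun k _ => ?_)) ?_) (Sy.sum _ fun k _ => ?_)
  · exact (((hF.ddu i j).mono hQ le_rfl hm).inner hQ hW).mono hQ (by linarith) le_rfl
  · exact (((hF.ddu j i).mono hQ le_rfl hm).inner hQ hW).mono hQ (by linarith) le_rfl
  · have h1 := (((ha k).mono hQ le_rfl hm).mul hQ (os_Sy hQ L (fq ξ k) 0)).const_mul √2
    have h2 := fun j => (((hF.ze k).mono hQ le_rfl hm).inner hQ (hZ j))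
    exact (h1.mul hQ (((h2 j).const_mul (ξ k i)).add ((h2 i).const_mul (ξ k j)))).mono hQ (by linarith) le_rfl
  · exact ((hZ i).inner hQ (hZ j)).mono hQ (by linarith) le_rfl
  · have h1 := ((qS (n := n) hQ L L).const_mul (ka k / 4))
    have h2 := fun j => ((sq_Sy hQ (ha k)).pder j).mono hQ le_rfl hm
    have h3 := (((h2 j).const_mul (ξ k i)).add ((h2 i).const_mul (ξ k j))).mul hQ
      (os_Sy hQ L ((2 : ℝ) • fq ξ k) (-(Real.pi / 2)))
    exact (h1.mul hQ h3).mono hQ (by linarith) le_rfl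

/-- The new map. -/
noncomputable def vf (Q : P → ℝ) (L : ℝ) (ξ : Fin n → Fin n → ℝ) (u : P → (Fin n → ℝ) → F)
    (ζ T : Fin n → P → (Fin n → ℝ) → F) (a : Fin n → P → (Fin n → ℝ) → ℝ)
    (y2 : Fin n → P → (Fin n → ℝ) → ℝ) : P → (Fin n → ℝ) → F :=
  fun p x => u p x + (Wf Q L ξ a ζ p x + wf (fun i p x => y1f Q L ξ a i p x + y2 i p x) T p x)

theorem step (hQ : Tendsto Q l atTop) (hm : m ≤ L) (hβ : 0 ≤ β) (hF : Fr l Q m β u ζ T)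
    (ha : ∀ k, Sy l Q (-β) m (a k)) {y2 : Fin n → P → (Fin n → ℝ) → ℝ}
    (hy : ∀ i, Sy l Q (-2 * β - L) L (y2 i)) :
    (∃ R : Fin n → Fin n → P → (Fin n → ℝ) → ℝ, (∀ i j, Sy l Q (-3 * β) L (R i j)) ∧
      ∀ᶠ p in l, ∀ x i j, (inner ℝ (pder i (vf Q L ξ u ζ T a y2 p) x) (pder j (vf Q L ξ u ζ T a y2 p) x))
        = (inner ℝ (pder i (u p) x) (pder j (u p) x)) + ∑ k, a k p x ^ 2 * ξ k i * ξ k j + Xf Q L ξ u ζ a i j p x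
          + (pder j (y2 i p) x + pder i (y2 j p) x) + R i j p x) ∧
    Sy l Q (-β - L) L (fun p x => vf Q L ξ u ζ T a y2 p x - u p x) := by
  set w := wf (fun i p x => y1f Q L ξ a i p x + y2 i p x) T with hw
  set W := Wf Q L ξ a ζ with hWd
  have hW : Sy l Q (-β - L) L W := W_Sy (ξ := ξ) hQ hm hF.ze ha
  have hw' : Sy l Q (-2 * β - L) L w := w_Sy hQ hm hF.te fun i => (y1_Sy hQ hm ha i).add (hy i)
  refine ⟨⟨fun i j p x => -((inner ℝ (pder j (pder i (u p)) x) (w p x)) + (inner ℝ (pder i (pder j (u p)) x) (w p x)))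
    + ((inner ℝ (pder i (W p) x) (pder j (w p) x)) + (inner ℝ (pder i (w p) x) (pder j (W p) x)))
      + (inner ℝ (pder i (w p) x) (pder j (w p) x)), ?_, ?_⟩, ?_⟩
  · intro i j
    refine Sy.add (Sy.add (Sy.neg (Sy.add ?_ ?_)) (Sy.add ?_ ?_)) ?_
    · exact (((hF.ddu i j).mono hQ le_rfl hm).inner hQ hw').mono hQ (by linarith) le_rfl
    · exact (((hF.ddu j i).mono hQ le_rfl hm).inner hQ hw').mono hQ (by linarith) le_rfl
    · exact ((hW.pder i).inner hQ (hw'.pder j)).mono hQ (by linarith) le_rfl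
    · exact ((hw'.pder i).inner hQ (hW.pder j)).mono hQ (by linarith) le_rfl
    · exact ((hw'.pder i).inner hQ (hw'.pder j)).mono hQ (by linarith) le_rfl
  · have ea : ∀ᶠ p in l, ∀ k, ContDiff ℝ ∞ (a k p) := eventually_all.2 fun k => (ha k).1
    have ez : ∀ᶠ p in l, ∀ k, ContDiff ℝ ∞ (ζ k p) := eventually_all.2 fun k => (hF.ze k).1
    have ey : ∀ᶠ p in l, ∀ k, ContDiff ℝ ∞ (y2 k p) := eventually_all.2 fun k => (hy k).1
    have ey1 : ∀ᶠ p in l, ∀ k, ContDiff ℝ ∞ (y1f Q L ξ a k p) :=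
      eventually_all.2 fun k => (y1_Sy hQ hm ha k).1
    filter_upwards [ea, ez, ey, ey1, hW.1, hw'.1, hF.sm, hF.r1, hF.r2, hF.r3, ev_one hQ] with p
      sa sz sy sy1 sW sw su r1 r2 r3 hq x i j
    have dv : ∀ i, pder i (vf Q L ξ u ζ T a y2 p) x = pder i (u p) x + (pder i (W p) x + pder i (w p) x) := by
      intro i
      unfold vf
      rw [pder_add' _ (sm_diff su x) (sm_diff (sW.add sw) x), pder_add' _ (sm_diff sW x) (sm_diff sw x)]
    have i1 : ∀ i j, (inner ℝ (pder i (u p) x) (pder j (W p) x)) = - (inner ℝ (pder j (pder i (u p)) x) (W p x)) := by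
      intro i j
      rw [ip_ibp (y := fun _ => 0) (sm_diff (sm_pder su i) x) (sm_diff sW x) ?_ j, pder_const']
      · ring
      · intro x
        simp only [hWd, Wf, inner_sum, inner_smul_right, r1]
        simp
    have i2 : ∀ i j, (inner ℝ (pder i (u p) x) (pder j (w p) x)) = pder j (y1f Q L ξ a i p) x + pder j (y2 i p) x
        - (inner ℝ (pder j (pder i (u p)) x) (w p x)) := by
      intro i j
      rw [ip_ibp (y := fun x => y1f Q L ξ a i p x + y2 i p x) (sm_diff (sm_pder su i) x) (sm_diff sw x) ?_ j,
        pder_add' _ (sm_diff (sy1 i) x) (sm_diff (sy i) x)]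
      intro x
      simp only [hw, wf, inner_sum, inner_smul_right, r3]
      simp
    rw [dv, dv]
    simp only [inner_add_left, inner_add_right]
    rw [real_inner_comm _ (pder i (W p) x), real_inner_comm _ (pder i (w p) x), i1, i2, i1, i2,
      y1_pder p hq sa, y1_pder p hq sa, WW p hq sa sz x (r2 x)]
    simp only [Xf]
    have e1 : ∑ k, (ka k / 4 * Q p ^ (-L)) * ((ξ k i * pder j (fun x => a k p x ^ 2) x +
        ξ k j * pder i (fun x => a k p x ^ 2) x) * si2 Q L ξ k p x)
      = ∑ k, (ka k / 4 * Q p ^ (-L)) * (ξ k i * pder j (fun x => a k p x ^ 2) x * si2 Q L ξ k p x)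
      + ∑ k, (ka k / 4 * Q p ^ (-L)) * (ξ k j * pder i (fun x => a k p x ^ 2) x * si2 Q L ξ k p x) := by
      rw [← Finset.sum_add_distrib]
      exact Finset.sum_congr rfl fun k _ => by ring
    have e2 : ∑ k, a k p x ^ 2 * ξ k i * ξ k j * co2 Q L ξ k p x / 2
        + ∑ k, a k p x ^ 2 * ξ k j * ξ k i * co2 Q L ξ k p x / 2 =
        ∑ k, a k p x ^ 2 * ξ k i * ξ k j * co2 Q L ξ k p x := by
      rw [← Finset.sum_add_distrib]
      exact Finset.sum_congr rfl fun k _ => by ring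
    rw [e1]
    linear_combination -e2
  · have : Sy l Q (-β - L) L (fun p x => W p x + w p x) := hW.add (hw'.mono hQ (by linarith) le_rfl)
    exact this.congr (Eventually.of_forall fun p x => by simp [vf, hw, hWd])

end D
end NK

namespace NK
open Filter Topology
open scoped ContDiff
section D2

variable {P : Type} {n : ℕ} {F : Type} [NormedAddCommGroup F] [InnerProductSpace ℝ F]
variable {l : Filter P} {Q : P → ℝ}


theorem os_mul (L : ℝ) (θ θ' : Fin n → ℝ) (s s' : ℝ) (p x) :
    os Q L θ s p x * os Q L θ' s' p x =
      (1 / 2) * (os Q L (θ + θ') (s + s') p x + os Q L (θ - θ') (s - s') p x) := by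
  simp only [os, ph_add, ph_sub]
  rw [show Q p ^ L * (ph θ x + ph θ' x) + (s + s') = (Q p ^ L * ph θ x + s) + (Q p ^ L * ph θ' x + s') by ring,
    show Q p ^ L * (ph θ x - ph θ' x) + (s - s') = (Q p ^ L * ph θ x + s) - (Q p ^ L * ph θ' x + s') by ring,
    Real.cos_add (Q p ^ L * ph θ x + s), Real.cos_sub (Q p ^ L * ph θ x + s)]
  ring

theorem Res.osc2 (hQ : Tendsto Q l atTop) {L m : ℝ} (hm : m < L) (o : Fin n) (ρ α : ℝ)
    (θ θ' : Fin n → ℝ) (h1 : θ o + θ' o ≠ 0) (h2 : θ o - θ' o ≠ 0)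
    (A : Fin n → Fin n → P → (Fin n → ℝ) → ℝ) (s s' : ℝ)
    (hA : ∀ i j, Sy l Q α m (A i j)) (hs : ∀ᶠ p in l, ∀ x i j, A i j p x = A j i p x) :
    Res l Q o α L ρ (fun i j p x => A i j p x * (os Q L θ s p x * os Q L θ' s' p x)) := by
  have hA' : ∀ i j, Sy l Q α m (fun p x => (1 / 2) * A i j p x) := fun i j => (hA i j).const_mul _
  have hs' : ∀ᶠ p in l, ∀ x i j, (1 / 2) * A i j p x = (1 / 2) * A j i p x := by
    filter_upwards [hs] with p h x i j
    rw [h]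
  refine ((Res.osc hQ hm o ρ α (θ + θ') h1 _ (s + s') hA' hs').add
    (Res.osc hQ hm o ρ α (θ - θ') h2 _ (s - s') hA' hs')).congr
    (Eventually.of_forall fun p x i j => ?_)
  rw [os_mul]; ring

noncomputable def slowf (Q : P → ℝ) (L : ℝ) (ζ : Fin n → P → (Fin n → ℝ) → F)
    (a : Fin n → P → (Fin n → ℝ) → ℝ) (i j : Fin n) : P → (Fin n → ℝ) → ℝ :=
  fun p x => ∑ k, (ka k ^ 2 * (Q p ^ (-L) * Q p ^ (-L))) *
    (inner ℝ (pder i (fun x => a k p x • ζ k p x) x) (pder j (fun x => a k p x • ζ k p x) x))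

variable {m L β : ℝ} {u : P → (Fin n → ℝ) → F} {ζ T : Fin n → P → (Fin n → ℝ) → F}
  {ξ : Fin n → Fin n → ℝ} {a : Fin n → P → (Fin n → ℝ) → ℝ}

theorem fq_add (o : Fin n) (hξ : ∀ k, ξ k o = 1) (k r : Fin n) : fq ξ k o + fq ξ r o ≠ 0 := by
  simp only [fq, Pi.smul_apply, hξ, smul_eq_mul]; positivity

theorem fq_sub (o : Fin n) (hξ : ∀ k, ξ k o = 1) (k r : Fin n) (h : k ≠ r) : fq ξ k o - fq ξ r o ≠ 0 := by
  simp only [fq, Pi.smul_apply, hξ, smul_eq_mul]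
  intro h'
  apply h
  have : (k : ℝ) = (r : ℝ) := by linarith
  exact Fin.ext (by exact_mod_cast this)

theorem slow_Sy (hQ : Tendsto Q l atTop) (hz : ∀ k, Sy l Q 0 m (ζ k))
    (ha : ∀ k, Sy l Q (-β) m (a k)) (i j : Fin n) : Sy l Q (-2 * β + 2 * (m - L)) m (slowf Q L ζ a i j) := by
  unfold slowf
  refine Sy.sum _ fun k _ => ?_
  have h1 := ((qS (n := n) hQ L m).mul hQ (qS hQ L m)).const_mul (ka k ^ 2)
  have h2 := fun i => (((ha k).smul hQ (hz k)).pder i)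
  exact (h1.mul hQ ((h2 i).inner hQ (h2 j))).mono hQ (by linarith) le_rfl

theorem X_Res (hQ : Tendsto Q l atTop) (hm : m < L) (hF : Fr l Q m β u ζ T)
    (ha : ∀ k, Sy l Q (-β) m (a k)) (o : Fin n) (hξ : ∀ k, ξ k o = 1) (ρ : ℝ) :
    Res l Q o (-2 * β + m - L) L ρ (fun i j p x => Xf Q L ξ u ζ a i j p x - slowf Q L ζ a i j p x) := by
  have hB : ∀ k i, Sy l Q (-β + m) m (fun p => pder i (fun x => a k p x • ζ k p x)) := fun k i =>
    (((ha k).smul hQ (hF.ze k)).pder i).mono hQ (by linarith) le_rfl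
  have q1 := qS (n := n) hQ L m
  -- term 1
  have t1 : Res l Q o (-2 * β + m - L) L ρ (fun i j p x => ∑ k,
      (-(√2 * ka k)) * (Q p ^ (-L) * (a k p x * ((inner ℝ (pder j (pder i (u p)) x) (ζ k p x)) +
        (inner ℝ (pder i (pder j (u p)) x) (ζ k p x))))) * si Q L ξ k p x) := by
    refine Res.sum _ fun k _ => Res.osc hQ hm o ρ _ (fq ξ k) (by simpa using fq_add o hξ k k) _ _ ?_ ?_
    · intro i j
      exact ((q1.mul hQ ((ha k).mul hQ (((hF.ddu i j).inner hQ (hF.ze k)).add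
        ((hF.ddu j i).inner hQ (hF.ze k))))).const_mul _).mono hQ (by linarith) le_rfl
    · exact Eventually.of_forall fun p x i j => by ring
  have t2 : Res l Q o (-2 * β + m - L) L ρ (fun i j p x => ∑ k, ∑ r,
      (2 * ka r) * (Q p ^ (-L) * (a k p x * (ξ k i * (inner ℝ (ζ k p x) (pder j (fun x => a r p x • ζ r p x) x)) +
        ξ k j * (inner ℝ (ζ k p x) (pder i (fun x => a r p x • ζ r p x) x))))) * (co Q L ξ k p x * si Q L ξ r p x)) := by
    refine Res.sum _ fun k _ => Res.sum _ fun r _ => ?_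
    have hA : ∀ i j, Sy l Q (-2 * β + m - L) m (fun p x => (2 * ka r) * (Q p ^ (-L) * (a k p x * (ξ k i * (inner ℝ (ζ k p x) (pder j (fun x => a r p x • ζ r p x) x)) +
        ξ k j * (inner ℝ (ζ k p x) (pder i (fun x => a r p x • ζ r p x) x)))))) := by
      intro i j
      exact ((q1.mul hQ ((ha k).mul hQ ((((hF.ze k).inner hQ (hB r j)).const_mul (ξ k i)).add
        (((hF.ze k).inner hQ (hB r i)).const_mul (ξ k j))))).const_mul _).mono hQ (by linarith) le_rfl
    by_cases hkr : k = r
    · subst hkr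
      refine (Res.osc hQ hm o ρ _ (fq ξ k + fq ξ k) (fq_add o hξ k k) _ (0 + -(Real.pi / 2))
        (fun i j => (hA i j).const_mul (1 / 2)) ?_).congr ?_
      · exact Eventually.of_forall fun p x i j => by ring
      · refine Eventually.of_forall fun p x i j => ?_
        rw [co, si, os_mul]
        have : os Q L (fq ξ k - fq ξ k) (0 - -(Real.pi / 2)) p x = 0 := by rw [sub_self]; simp [os, ph]
        rw [this]; ring
    · exact Res.osc2 hQ hm o ρ _ (fq ξ k) (fq ξ r) (fq_add o hξ k r) (fq_sub o hξ k r hkr) _ _ _ hA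
        (Eventually.of_forall fun p x i j => by ring)
  have t3 : Res l Q o (-2 * β + m - L) L ρ (fun i j p x => (∑ k, ∑ r,
      (ka k * ka r) * ((Q p ^ (-L) * Q p ^ (-L)) * ((inner ℝ (pder i (fun x => a k p x • ζ k p x) x) (pder j (fun x => a r p x • ζ r p x) x)) +
        (inner ℝ (pder j (fun x => a k p x • ζ k p x) x) (pder i (fun x => a r p x • ζ r p x) x)))) * (si Q L ξ k p x * si Q L ξ r p x))
        - slowf Q L ζ a i j p x) := by
    have : Res l Q o (-2 * β + m - L) L ρ (fun i j p x => ∑ k, ∑ r, 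
      ((ka k * ka r) * ((Q p ^ (-L) * Q p ^ (-L)) * ((inner ℝ (pder i (fun x => a k p x • ζ k p x) x) (pder j (fun x => a r p x • ζ r p x) x)) +
        (inner ℝ (pder j (fun x => a k p x • ζ k p x) x) (pder i (fun x => a r p x • ζ r p x) x)))) * (si Q L ξ k p x * si Q L ξ r p x)
        - if k = r then (ka k ^ 2 * (Q p ^ (-L) * Q p ^ (-L))) *
    (inner ℝ (pder i (fun x => a k p x • ζ k p x) x) (pder j (fun x => a k p x • ζ k p x) x)) else 0)) := by
      refine Res.sum _ fun k _ => Res.sum _ fun r _ => ?_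
      have hA : ∀ i j, Sy l Q (-2 * β + m - L) m (fun p x => (ka k * ka r) * ((Q p ^ (-L) * Q p ^ (-L)) * ((inner ℝ (pder i (fun x => a k p x • ζ k p x) x) (pder j (fun x => a r p x • ζ r p x) x)) +
        (inner ℝ (pder j (fun x => a k p x • ζ k p x) x) (pder i (fun x => a r p x • ζ r p x) x))))) := by
        intro i j
        exact (((q1.mul hQ q1).mul hQ (((hB k i).inner hQ (hB r j)).add
          ((hB k j).inner hQ (hB r i)))).const_mul _).mono hQ (by linarith) le_rfl
      by_cases hkr : k = r
      · subst hkr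
        refine (Res.osc hQ hm o ρ _ (fq ξ k + fq ξ k) (fq_add o hξ k k) _ (-(Real.pi / 2) + -(Real.pi / 2))
          (fun i j => (hA i j).const_mul (1 / 2)) ?_).congr ?_
        · exact Eventually.of_forall fun p x i j => by ring
        · refine Eventually.of_forall fun p x i j => ?_
          rw [si, os_mul]
          have : os Q L (fq ξ k - fq ξ k) (-(Real.pi / 2) - -(Real.pi / 2)) p x = 1 := by rw [sub_self]; simp [os, ph]
          rw [this, real_inner_comm (pder j (fun x => a k p x • ζ k p x) x)]
          simp
          ring
      · refine (Res.osc2 hQ hm o ρ _ (fq ξ k) (fq ξ r) (fq_add o hξ k r) (fq_sub o hξ k r hkr) _ (-(Real.pi / 2)) (-(Real.pi / 2)) hA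
          (Eventually.of_forall fun p x i j => by ring)).congr (Eventually.of_forall fun p x i j => ?_)
        simp [hkr, si]
    refine this.congr (Eventually.of_forall fun p x i j => ?_)
    simp only [Finset.sum_sub_distrib, slowf]
    simp
  have t4 : Res l Q o (-2 * β + m - L) L ρ (fun i j p x => ∑ k, (-(ka k / 4)) * (Q p ^ (-L) * (ξ k i * pder j (fun x => a k p x ^ 2) x +
        ξ k j * pder i (fun x => a k p x ^ 2) x)) * si2 Q L ξ k p x) := by
    refine Res.sum _ fun k _ => Res.osc hQ hm o ρ _ ((2 : ℝ) • fq ξ k) ?_ _ _ ?_ ?_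
    · have := fq_add o hξ k k
      simp only [Pi.smul_apply, smul_eq_mul]
      intro h
      apply this; linarith
    · intro i j
      have h2 := fun j => ((sq_Sy hQ (ha k)).pder j)
      exact ((q1.mul hQ (((h2 j).const_mul (ξ k i)).add ((h2 i).const_mul (ξ k j)))).const_mul _).mono
        hQ (by linarith) le_rfl
    · exact Eventually.of_forall fun p x i j => by ring
  refine (((t1.add t2).add t3).add t4).congr (Eventually.of_forall fun p x i j => ?_)
  have h2 : √2 * √2 = 2 := Real.mul_self_sqrt (by norm_num)
  have a1 : -((inner ℝ (pder j (pder i (u p)) x) (Wf Q L ξ a ζ p x)) + (inner ℝ (pder i (pder j (u p)) x) (Wf Q L ξ a ζ p x)))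
      = ∑ k,
      (-(√2 * ka k)) * (Q p ^ (-L) * (a k p x * ((inner ℝ (pder j (pder i (u p)) x) (ζ k p x)) +
        (inner ℝ (pder i (pder j (u p)) x) (ζ k p x))))) * si Q L ξ k p x := by
    simp only [Wf, inner_sum, inner_smul_right]
    rw [← Finset.sum_add_distrib, ← Finset.sum_neg_distrib]
    exact Finset.sum_congr rfl fun k _ => by ring
  have a2 : ∑ k, (√2 * (a k p x * co Q L ξ k p x)) * (ξ k i * (inner ℝ (ζ k p x) (Zf Q L ξ a ζ j p x)) +
        ξ k j * (inner ℝ (ζ k p x) (Zf Q L ξ a ζ i p x))) = ∑ k, ∑ r,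
      (2 * ka r) * (Q p ^ (-L) * (a k p x * (ξ k i * (inner ℝ (ζ k p x) (pder j (fun x => a r p x • ζ r p x) x)) +
        ξ k j * (inner ℝ (ζ k p x) (pder i (fun x => a r p x • ζ r p x) x))))) * (co Q L ξ k p x * si Q L ξ r p x) := by
    refine Finset.sum_congr rfl fun k _ => ?_
    simp only [Zf, inner_sum, inner_smul_right]
    rw [Finset.mul_sum, Finset.mul_sum, ← Finset.sum_add_distrib, Finset.mul_sum]
    refine Finset.sum_congr rfl fun r _ => ?_
    linear_combination (ka r * (Q p ^ (-L) * (a k p x * (ξ k i * (inner ℝ (ζ k p x) (pder j (fun x => a r p x • ζ r p x) x)) +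
        ξ k j * (inner ℝ (ζ k p x) (pder i (fun x => a r p x • ζ r p x) x))))) * (co Q L ξ k p x * si Q L ξ r p x)) * h2
  have a3 : (inner ℝ (Zf Q L ξ a ζ i p x) (Zf Q L ξ a ζ j p x)) = ∑ k, ∑ r,
      (ka k * ka r) * ((Q p ^ (-L) * Q p ^ (-L)) * ((inner ℝ (pder i (fun x => a k p x • ζ k p x) x) (pder j (fun x => a r p x • ζ r p x) x)) +
        (inner ℝ (pder j (fun x => a k p x • ζ k p x) x) (pder i (fun x => a r p x • ζ r p x) x)))) * (si Q L ξ k p x * si Q L ξ r p x) := by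
    have b : ∀ i j, (inner ℝ (Zf Q L ξ a ζ i p x) (Zf Q L ξ a ζ j p x)) = ∑ k, ∑ r,
      (2 * (ka k * ka r)) * ((Q p ^ (-L) * Q p ^ (-L)) * ((inner ℝ (pder i (fun x => a k p x • ζ k p x) x) (pder j (fun x => a r p x • ζ r p x) x)))) * (si Q L ξ k p x * si Q L ξ r p x) := by
      intro i j
      simp only [Zf, sum_inner, inner_sum, inner_smul_left, inner_smul_right]
      simp only [Finset.mul_sum]
      rw [Finset.sum_comm]
      refine Finset.sum_congr rfl fun k _ => Finset.sum_congr rfl fun r _ => ?_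
      simp only [conj_trivial]
      linear_combination ((ka k * ka r) * ((Q p ^ (-L) * Q p ^ (-L)) * ((inner ℝ (pder i (fun x => a k p x • ζ k p x) x) (pder j (fun x => a r p x • ζ r p x) x)))) * (si Q L ξ k p x * si Q L ξ r p x)) * h2
    have c : (inner ℝ (Zf Q L ξ a ζ i p x) (Zf Q L ξ a ζ j p x)) = 
      ((inner ℝ (Zf Q L ξ a ζ i p x) (Zf Q L ξ a ζ j p x)) + (inner ℝ (Zf Q L ξ a ζ j p x) (Zf Q L ξ a ζ i p x))) / 2 := by
      rw [real_inner_comm (Zf Q L ξ a ζ i p x)]; ring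
    rw [c, b, b, ← Finset.sum_add_distrib, Finset.sum_div]
    refine Finset.sum_congr rfl fun k _ => ?_
    rw [← Finset.sum_add_distrib, Finset.sum_div]
    refine Finset.sum_congr rfl fun r _ => ?_
    ring
  have a4 : - ∑ k, (ka k / 4 * Q p ^ (-L)) * ((ξ k i * pder j (fun x => a k p x ^ 2) x +
        ξ k j * pder i (fun x => a k p x ^ 2) x) * si2 Q L ξ k p x) = ∑ k, (-(ka k / 4)) * (Q p ^ (-L) * (ξ k i * pder j (fun x => a k p x ^ 2) x +
        ξ k j * pder i (fun x => a k p x ^ 2) x)) * si2 Q L ξ k p x := by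
    rw [← Finset.sum_neg_distrib]
    exact Finset.sum_congr rfl fun k _ => by ring
  rw [← a1, ← a2, ← a3, ← a4]
  simp only [Xf]
  ring

end D2
end NK

namespace NK
open Filter Topology MeasureTheory Metric
open scoped ContDiff Convolution
section E

variable {n : ℕ}

theorem conv_bd {G : Type} [NormedAddCommGroup G] [NormedSpace ℝ G] (k : ℕ) :
    ∀ {G' G'' : Type} [NormedAddCommGroup G'] [NormedSpace ℝ G'] [NormedAddCommGroup G''] [NormedSpace ℝ G'']
    (φ : (Fin n → ℝ) → G') (_ : ContDiff ℝ ∞ φ)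
    (_ : tsupport φ ⊆ closedBall 0 1) (L : G' →L[ℝ] G →L[ℝ] G''),
    ∃ C : ℝ, 0 ≤ C ∧ ∀ h : (Fin n → ℝ) → G, Continuous h → ∀ x M, (∀ y ∈ closedBall x 1, ‖h y‖ ≤ M) →
      ‖iteratedFDeriv ℝ k (φ ⋆[L, volume] h) x‖ ≤ C * M := by
  induction k with
  | zero =>
    intro G' G'' _ _ _ _ φ hφ hs L
    have hc : HasCompactSupport φ := HasCompactSupport.of_support_subset_isCompact (isCompact_closedBall 0 1)
      ((subset_tsupport _).trans hs)
    refine ⟨‖L‖ * ∫ t, ‖φ t‖, by positivity, fun h hh x M hM => ?_⟩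
    rw [norm_iteratedFDeriv_zero, convolution_def]
    have hi : Integrable (fun t => ‖φ t‖) := (hφ.continuous.norm).integrable_of_hasCompactSupport hc.norm
    calc _ ≤ ∫ t, ‖L‖ * M * ‖φ t‖ := by
          refine norm_integral_le_of_norm_le (hi.const_mul _) (Eventually.of_forall fun t => ?_)
          by_cases ht : t ∈ tsupport φ
          · have h1 : ‖h (x - t)‖ ≤ M := hM _ (by
              have := hs ht
              simpa [mem_closedBall, dist_eq_norm] using this)
            calc _ ≤ ‖L‖ * ‖φ t‖ * ‖h (x - t)‖ := L.le_opNorm₂ _ _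
              _ ≤ ‖L‖ * ‖φ t‖ * M := by gcongr
              _ = _ := by ring
          · rw [image_eq_zero_of_notMem_tsupport ht]; simp
      _ = _ := by rw [integral_const_mul]; ring
  | succ k ih =>
    intro G' G'' _ _ _ _ φ hφ hs L
    have hc : HasCompactSupport φ := HasCompactSupport.of_support_subset_isCompact (isCompact_closedBall 0 1)
      ((subset_tsupport _).trans hs)
    obtain ⟨C, hC, H⟩ := ih (fderiv ℝ φ) (hφ.fderiv_right (m := ∞) (by simp))
      ((tsupport_fderiv_subset ℝ).trans hs) (L.precompL (Fin n → ℝ))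
    refine ⟨C, hC, fun h hh x M hM => ?_⟩
    rw [← norm_iteratedFDeriv_fderiv]
    have : fderiv ℝ (φ ⋆[L, volume] h) = (fderiv ℝ φ ⋆[L.precompL (Fin n → ℝ), volume] h) := by
      ext1 y
      exact (hc.hasFDerivAt_convolution_left L (hφ.of_le (nn 1 le_rfl)) hh.locallyIntegrable y).fderiv
    rw [this]
    exact H h hh x M hM

/-- The standard mollifier. -/
noncomputable def bmp (n : ℕ) : ContDiffBump (0 : Fin n → ℝ) := ⟨1 / 2, 1, by norm_num, by norm_num⟩

noncomputable def mo (n : ℕ) : (Fin n → ℝ) → ℝ := (bmp n).normed volume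

theorem mo_smooth : ContDiff ℝ ∞ (mo n) := (bmp n).contDiff_normed
theorem mo_tsupp : tsupport (mo n) ⊆ closedBall 0 1 := by
  rw [mo, (bmp n).tsupport_normed_eq]; rfl
theorem mo_cpt : HasCompactSupport (mo n) := (bmp n).hasCompactSupport_normed
theorem mo_int : ∫ t, mo n t = 1 := (bmp n).integral_normed
theorem mo_nn (x) : 0 ≤ mo n x := (bmp n).nonneg_normed x

variable {G : Type} [NormedAddCommGroup G] [NormedSpace ℝ G]

/-- Mollification at scale `r`. -/
noncomputable def mol (r : ℝ) (h : (Fin n → ℝ) → G) (x : Fin n → ℝ) : G := ∫ t, mo n t • h (x - r • t)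

theorem mol_eq {r : ℝ} (hr : 0 < r) (h : (Fin n → ℝ) → G) :
    mol r h = fun x => (mo n ⋆[ContinuousLinearMap.lsmul ℝ ℝ, volume] (fun y => h (r • y))) (r⁻¹ • x) := by
  ext x
  rw [convolution_def, mol]
  congr 1; ext t
  simp [smul_sub, smul_smul, hr.ne']

theorem mol_smooth {r : ℝ} (hr : 0 < r) {h : (Fin n → ℝ) → G} (hh : Continuous h) : ContDiff ℝ ∞ (mol r h) := by
  rw [mol_eq hr]
  have : ContDiff ℝ ∞ (mo n ⋆[ContinuousLinearMap.lsmul ℝ ℝ, volume] (fun y => h (r • y))) :=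
    mo_cpt.contDiff_convolution_left (n := (⊤ : ℕ∞)) _ mo_smooth (Continuous.locallyIntegrable (by fun_prop))
  exact this.comp (contDiff_const_smul _)

theorem mol_bd (k : ℕ) : ∃ C : ℝ, 0 ≤ C ∧ ∀ r : ℝ, 0 < r → ∀ h : (Fin n → ℝ) → G, Continuous h → ∀ x M,
    (∀ y ∈ closedBall x r, ‖h y‖ ≤ M) → ‖iteratedFDeriv ℝ k (mol r h) x‖ ≤ C * M * r⁻¹ ^ k := by
  obtain ⟨C, hC, H⟩ := conv_bd (G := G) k (mo n) mo_smooth mo_tsupp (ContinuousLinearMap.lsmul ℝ ℝ)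
  refine ⟨C, hC, fun r hr h hh x M hM => ?_⟩
  have sm : ContDiff ℝ ∞ (mo n ⋆[ContinuousLinearMap.lsmul ℝ ℝ, volume] (fun y => h (r • y))) :=
    mo_cpt.contDiff_convolution_left (n := (⊤ : ℕ∞)) _ mo_smooth (Continuous.locallyIntegrable (by fun_prop))
  rw [mol_eq hr, iteratedFDeriv_comp_const_smul _ (sm.of_le (nn k le_rfl)), norm_smul, norm_pow,
    Real.norm_of_nonneg (by positivity), mul_comm]
  gcongr
  refine H _ (by fun_prop) _ M fun y hy => hM _ ?_
  rw [mem_closedBall, dist_eq_norm] at hy ⊢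
  have : r • y - x = r • (y - r⁻¹ • x) := by simp [smul_sub, smul_smul, hr.ne']
  rw [this, norm_smul, Real.norm_of_nonneg hr.le]
  nlinarith

theorem mol_int {r : ℝ} {h : (Fin n → ℝ) → G} (hh : Continuous h) (x) :
    Integrable (fun t => mo n t • h (x - r • t)) :=
  Continuous.integrable_of_hasCompactSupport
    (mo_smooth.continuous.smul (by fun_prop)) mo_cpt.smul_right

theorem mol_add {r : ℝ} {h g : (Fin n → ℝ) → G} (hh : Continuous h) (hg : Continuous g) (x) :
    mol r (fun x => h x + g x) x = mol r h x + mol r g x := by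
  simp only [mol, smul_add]
  rw [integral_add (mol_int hh x) (mol_int hg x)]

theorem mol_sub {r : ℝ} {h g : (Fin n → ℝ) → G} (hh : Continuous h) (hg : Continuous g) (x) :
    mol r (fun x => h x - g x) x = mol r h x - mol r g x := by
  simp only [mol, smul_sub]
  rw [integral_sub (mol_int hh x) (mol_int hg x)]

theorem mol_const [CompleteSpace G] {r : ℝ} (c : G) (x : Fin n → ℝ) : mol r (fun _ => c) x = c := by
  simp only [mol]
  rw [integral_smul_const, mo_int, one_smul]

theorem mol_clm [CompleteSpace G] {G' : Type} [NormedAddCommGroup G'] [NormedSpace ℝ G'] [CompleteSpace G']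
    (L : G →L[ℝ] G') {r : ℝ} {h : (Fin n → ℝ) → G} (hh : Continuous h) (x) :
    mol r (fun x => L (h x)) x = L (mol r h x) := by
  simp only [mol]
  rw [← L.integral_comp_comm (mol_int hh x)]
  simp

theorem mol_near [CompleteSpace G] {r : ℝ} (hr : 0 < r) {h : (Fin n → ℝ) → G} (hh : Continuous h) (x) (M : ℝ)
    (hM : ∀ y, ‖y - x‖ ≤ r → ‖h y - h x‖ ≤ M) : ‖mol r h x - h x‖ ≤ M := by
  have : mol r h x - h x = ∫ t, mo n t • (h (x - r • t) - h x) := by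
    rw [← mol_const (r := r) (h x) x, ← mol_sub hh continuous_const]
    rw [mol_const]
    rfl
  rw [this]
  calc _ ≤ ∫ t, mo n t * M := by
        refine norm_integral_le_of_norm_le ((mo_smooth.continuous.integrable_of_hasCompactSupport mo_cpt).mul_const _)
          (Eventually.of_forall fun t => ?_)
        rw [norm_smul, Real.norm_of_nonneg (mo_nn t)]
        by_cases ht : t ∈ tsupport (mo n)
        · have h1 := mo_tsupp ht
          rw [mem_closedBall, dist_zero_right] at h1
          refine mul_le_mul_of_nonneg_left (hM _ ?_) (mo_nn t)
          rw [sub_sub_cancel_left, norm_neg, norm_smul, Real.norm_of_nonneg hr.le]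
          nlinarith
        · rw [image_eq_zero_of_notMem_tsupport ht]; simp
    _ = M := by rw [integral_mul_const, mo_int, one_mul]

theorem mol_fderiv [CompleteSpace G] {r : ℝ} {h : (Fin n → ℝ) → G} (hh : ContDiff ℝ 1 h) {M : ℝ}
    (hM : ∀ x, ‖fderiv ℝ h x‖ ≤ M) (x) :
    HasFDerivAt (mol r h) (mol r (fderiv ℝ h) x) x := by
  have hc := hh.continuous_fderiv one_ne_zero
  refine hasFDerivAt_integral_of_dominated_of_fderiv_le (F := fun x t => mo n t • h (x - r • t))
    (F' := fun x t => mo n t • fderiv ℝ h (x - r • t)) (bound := fun t => mo n t * M) (s := Set.univ) univ_mem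
    (Eventually.of_forall fun y => (mol_int hh.continuous y).aestronglyMeasurable) (mol_int hh.continuous x)
    (mol_int hc x).aestronglyMeasurable ?_
    ((mo_smooth.continuous.integrable_of_hasCompactSupport mo_cpt).mul_const _) ?_
  · refine Eventually.of_forall fun t y _ => ?_
    rw [norm_smul, Real.norm_of_nonneg (mo_nn t)]
    exact mul_le_mul_of_nonneg_left (hM _) (mo_nn t)
  · refine Eventually.of_forall fun t y _ => ?_
    have h1 := ((hh.differentiable one_ne_zero) (y - r • t)).hasFDerivAt
    have h2 := (hasFDerivAt_id (𝕜 := ℝ) y).sub_const (r • t)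
    exact (h1.comp y h2).const_smul (mo n t)

theorem mol_pder [CompleteSpace G] {r : ℝ} {h : (Fin n → ℝ) → G} (hh : ContDiff ℝ 1 h) {M : ℝ}
    (hM : ∀ x, ‖fderiv ℝ h x‖ ≤ M) (i : Fin n) (x) :
    pder i (mol r h) x = mol r (pder i h) x := by
  rw [pder, (mol_fderiv hh hM x).fderiv]
  have := mol_clm (ContinuousLinearMap.apply ℝ G (Pi.single i 1 : Fin n → ℝ)) (r := r) (hh.continuous_fderiv one_ne_zero) x
  exact this.symm

end E
end NK

namespace NK
open Filter Topology MeasureTheory Metric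
open scoped ContDiff Convolution
section E2

variable {n : ℕ} {P : Type} {l : Filter P} {Q : P → ℝ} {α μ : ℝ}
variable {G : Type} [NormedAddCommGroup G] [NormedSpace ℝ G]
variable {F : Type} [NormedAddCommGroup F] [InnerProductSpace ℝ F] [CompleteSpace F]

theorem rp_inv {q : ℝ} (hq : 0 < q) (μ : ℝ) (k : ℕ) : (q ^ (-μ))⁻¹ ^ k = q ^ (k * μ) := by
  rw [← Real.rpow_neg hq.le, neg_neg, ← Real.rpow_natCast, ← Real.rpow_mul hq.le, mul_comm]

theorem Sy.mol (hQ : Tendsto Q l atTop) {f : P → (Fin n → ℝ) → G} (hc : ∀ᶠ p in l, Continuous (f p))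
    {C : ℝ} (hC : 0 ≤ C) (hf : ∀ᶠ p in l, ∀ x, ‖f p x‖ ≤ C * Q p ^ α) :
    Sy l Q α μ (fun p x => NK.mol (Q p ^ (-μ)) (f p) x) := by
  refine ⟨?_, fun k => ?_⟩
  · filter_upwards [hc, ev_one hQ] with p h1 h2
    exact mol_smooth (by positivity) h1
  · obtain ⟨K, hK, H⟩ := mol_bd (n := n) (G := G) k
    refine ⟨K * C, by positivity, ?_⟩
    filter_upwards [hc, ev_one hQ, hf] with p h1 h2 h3 x
    have h0 : 0 < Q p := by linarith
    refine (H _ (by positivity) (f p) h1 x _ fun y _ => h3 y).trans_eq ?_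
    rw [rp_inv h0, Real.rpow_add h0]; ring

theorem mol_comm_bd (k : ℕ) : ∃ C : ℝ, 0 ≤ C ∧ ∀ r : ℝ, 0 < r → ∀ f g : (Fin n → ℝ) → F,
    Continuous f → Continuous g → ∀ L : ℝ, 0 ≤ L → (∀ x y, ‖f x - f y‖ ≤ L * ‖x - y‖) →
    (∀ x y, ‖g x - g y‖ ≤ L * ‖x - y‖) → ∀ x,
    ‖iteratedFDeriv ℝ k (fun x => mol r (fun z => inner ℝ (f z) (g z)) x - inner ℝ (mol r f x) (mol r g x)) x‖
      ≤ C * (L * r) ^ 2 * r⁻¹ ^ k := by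
  obtain ⟨K, hK, H⟩ := mol_bd (n := n) (G := ℝ) k
  choose K' hK' H' using fun k => mol_bd (n := n) (G := F) k
  refine ⟨K + ‖innerSL ℝ (E := F)‖ * ∑ i ∈ Finset.range (k + 1), (k.choose i : ℝ) * K' i * K' (k - i), ?_, ?_⟩
  · refine add_nonneg hK (mul_nonneg (ContinuousLinearMap.opNorm_nonneg _) (Finset.sum_nonneg fun i _ => ?_))
    have := hK' i
    have := hK' (k - i)
    positivity
  intro r hr f g hf hg L hL hLf hLg x
  set f' : (Fin n → ℝ) → F := fun z => f z - f x with hf'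
  set g' : (Fin n → ℝ) → F := fun z => g z - g x with hg'
  have cf' : Continuous f' := by fun_prop
  have cg' : Continuous g' := by fun_prop
  have key : (fun x => mol r (fun z => inner ℝ (f z) (g z)) x - inner ℝ (mol r f x) (mol r g x)) =
      (fun x => mol r (fun z => inner ℝ (f' z) (g' z)) x - inner ℝ (mol r f' x) (mol r g' x)) := by
    ext y
    have e1 : (fun z => inner ℝ (f' z) (g' z)) = fun z => (inner ℝ (f z) (g z) - inner ℝ (f x) (g z)) -
        (inner ℝ (g x) (f z) - inner ℝ (f x) (g x)) := by
      ext z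
      simp only [hf', hg', inner_sub_left, inner_sub_right]
      rw [real_inner_comm (f z) (g x)]; 
    rw [e1, mol_sub (by fun_prop) (by fun_prop), mol_sub (by fun_prop) (by fun_prop),
      mol_sub (by fun_prop) (by fun_prop), mol_const, hf', hg', mol_sub hf continuous_const,
      mol_sub hg continuous_const, mol_const, mol_const]
    have e2 := mol_clm (innerSL ℝ (f x)) (r := r) hg y
    have e3 := mol_clm (innerSL ℝ (g x)) (r := r) hf y
    simp only [innerSL_apply_apply] at e2 e3
    rw [e2, e3]
    simp only [inner_sub_left, inner_sub_right]
    rw [real_inner_comm (mol r f y) (g x)]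
    ring
  rw [key]
  have s1 : ContDiff ℝ ∞ (mol r (fun z => inner ℝ (f' z) (g' z))) := mol_smooth hr (by fun_prop)
  have s2 : ContDiff ℝ ∞ (mol r f') := mol_smooth hr cf'
  have s3 : ContDiff ℝ ∞ (mol r g') := mol_smooth hr cg'
  have bf : ∀ y ∈ closedBall x r, ‖f' y‖ ≤ L * r := fun y hy => by
    rw [mem_closedBall, dist_eq_norm] at hy
    exact (hLf y x).trans (by gcongr)
  have bg : ∀ y ∈ closedBall x r, ‖g' y‖ ≤ L * r := fun y hy => by
    rw [mem_closedBall, dist_eq_norm] at hy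
    exact (hLg y x).trans (by gcongr)
  have b1 := H r hr (fun z => inner ℝ (f' z) (g' z)) (by fun_prop) x ((L * r) ^ 2) fun y hy => by
    refine (norm_inner_le_norm _ _).trans ?_
    rw [pow_two]
    exact mul_le_mul (bf y hy) (bg y hy) (norm_nonneg _) (by positivity)
  have b2 := (innerSL ℝ (E := F)).norm_iteratedFDeriv_le_of_bilinear s2 s3 x (n := k) (nn k le_rfl)
  have s4 : ContDiff ℝ ∞ (fun x => inner ℝ (mol r f' x) (mol r g' x)) := s2.inner ℝ s3
  have : iteratedFDeriv ℝ k (fun x => mol r (fun z => inner ℝ (f' z) (g' z)) x - inner ℝ (mol r f' x) (mol r g' x)) x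
      = iteratedFDeriv ℝ k (mol r (fun z => inner ℝ (f' z) (g' z))) x -
        iteratedFDeriv ℝ k (fun x => inner ℝ (mol r f' x) (mol r g' x)) x :=
      iteratedFDeriv_sub_apply ((s1.of_le (nn k le_rfl)).contDiffAt) ((s4.of_le (nn k le_rfl)).contDiffAt)
  rw [this]
  refine (norm_sub_le _ _).trans ?_
  rw [add_mul, add_mul]
  refine add_le_add b1 (b2.trans ?_)
  rw [mul_assoc, mul_assoc]
  refine mul_le_mul_of_nonneg_left ?_ (ContinuousLinearMap.opNorm_nonneg _)
  rw [Finset.sum_mul]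
  refine Finset.sum_le_sum fun i hi => ?_
  have hik : i ≤ k := by
    have := Finset.mem_range.1 hi
    omega
  have h1 := H' i r hr f' cf' x _ bf
  have h2 := H' (k - i) r hr g' cg' x _ bg
  have := hK' i
  have := hK' (k - i)
  calc _ ≤ (k.choose i : ℝ) * (K' i * (L * r) * r⁻¹ ^ i) * (K' (k - i) * (L * r) * r⁻¹ ^ (k - i)) := by gcongr
    _ = (k.choose i : ℝ) * K' i * K' (k - i) * ((L * r) ^ 2 * (r⁻¹ ^ i * r⁻¹ ^ (k - i))) := by ring
    _ = _ := by rw [← pow_add, Nat.add_sub_cancel' hik]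

theorem Sy.molcomm (hQ : Tendsto Q l atTop) {f g : P → (Fin n → ℝ) → F}
    {C : ℝ} (hC : 0 ≤ C) (hcf : ∀ᶠ p in l, Continuous (f p)) (hcg : ∀ᶠ p in l, Continuous (g p))
    (hf : ∀ᶠ p in l, ∀ x y, ‖f p x - f p y‖ ≤ C * Q p ^ α * ‖x - y‖)
    (hg : ∀ᶠ p in l, ∀ x y, ‖g p x - g p y‖ ≤ C * Q p ^ α * ‖x - y‖) :
    Sy l Q (2 * α - 2 * μ) μ (fun p x => NK.mol (Q p ^ (-μ)) (fun z => Inner.inner ℝ (f p z) (g p z)) x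
      - Inner.inner ℝ (NK.mol (Q p ^ (-μ)) (f p) x) (NK.mol (Q p ^ (-μ)) (g p) x)) := by
  refine ⟨?_, fun k => ?_⟩
  · filter_upwards [hcf, hcg, ev_one hQ] with p h1 h1' h2
    have h0 : (0:ℝ) < Q p ^ (-μ) := by positivity
    exact (mol_smooth h0 (by fun_prop)).sub ((mol_smooth h0 h1).inner ℝ (mol_smooth h0 h1'))
  · obtain ⟨K, hK, H⟩ := mol_comm_bd (n := n) (F := F) k
    refine ⟨K * C ^ 2, by positivity, ?_⟩
    filter_upwards [hcf, hcg, ev_one hQ, hf, hg] with p h1 h1' h2 h3 h4 x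
    have h0 : 0 < Q p := by linarith
    refine (H _ (by positivity) (f p) (g p) h1 h1' _ (by positivity) h3 h4 x).trans_eq ?_
    rw [rp_inv h0, mul_assoc C, ← Real.rpow_add h0, mul_pow, ← Real.rpow_natCast (Q p ^ (α + -μ)), ← Real.rpow_mul h0.le]
    rw [show 2 * α - 2 * μ + (k:ℝ) * μ = (α + -μ) * (2:ℕ) + k * μ by push_cast; ring, Real.rpow_add h0]
    ring

theorem mol_near_lip [CompleteSpace G] {r : ℝ} (hr : 0 < r) {h : (Fin n → ℝ) → G} (hh : Continuous h) {L : ℝ} (hL : 0 ≤ L)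
    (hLh : ∀ x y, ‖h x - h y‖ ≤ L * ‖x - y‖) (x) : ‖NK.mol r h x - h x‖ ≤ L * r :=
  mol_near hr hh x _ fun y hy => (hLh y x).trans (by gcongr)

end E2
end NK

namespace NK
open Filter Topology InnerProductSpace
open scoped ContDiff
section Fm

variable {P : Type} {n : ℕ} {F : Type} [NormedAddCommGroup F] [InnerProductSpace ℝ F]
variable {l : Filter P} {Q : P → ℝ}

/-- linearly independent tuples -/
def LI (N : ℕ) (F : Type) [NormedAddCommGroup F] [InnerProductSpace ℝ F] : Set (Fin N → F) :=
  {w | LinearIndependent ℝ w}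

theorem LI_open {N : ℕ} : IsOpen (LI N F) := isOpen_setOfPred_linearIndependent

theorem gs_smooth {N : ℕ} (k : Fin N) : ContDiffOn ℝ ∞ (fun w : Fin N → F => gramSchmidt ℝ w k) (LI N F) := by
  induction k using WellFoundedLT.induction with
  | ind k ih =>
    have : (fun w : Fin N → F => gramSchmidt ℝ w k) = fun w => w k - ∑ i ∈ Finset.Iio k,
        (inner ℝ (gramSchmidt ℝ w i) (w k) / (‖gramSchmidt ℝ w i‖ ^ 2)) • gramSchmidt ℝ w i := by
      ext w
      have := gramSchmidt_def'' ℝ w k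
      exact eq_sub_of_add_eq this.symm
    rw [this]
    have hk : ContDiffOn ℝ ∞ (fun w : Fin N → F => w k) (LI N F) := by fun_prop
    refine hk.sub (ContDiffOn.sum fun i hi => ?_)
    have hi' := ih i (Finset.mem_Iio.1 hi)
    refine ContDiffOn.smul (ContDiffOn.div (hi'.inner ℝ hk) (hi'.norm_sq ℝ) fun w hw => ?_) hi'
    have := gramSchmidt_ne_zero (𝕜 := ℝ) i (show LinearIndependent ℝ w from hw)
    positivity

theorem gsn_smooth {N : ℕ} (k : Fin N) :
    ContDiffOn ℝ ∞ (fun w : Fin N → F => gramSchmidtNormed ℝ w k) (LI N F) := by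
  have h := gs_smooth (F := F) k
  have h0 : ∀ w ∈ LI N F, gramSchmidt ℝ w k ≠ 0 := fun w hw =>
    gramSchmidt_ne_zero (𝕜 := ℝ) k (show LinearIndependent ℝ w from hw)
  exact ((h.norm ℝ h0).inv fun w hw => norm_ne_zero_iff.2 (h0 w hw)).smul h

theorem gs_self {N : ℕ} (w : Fin N → F) (k : Fin N) :
    inner ℝ (w k) (gramSchmidt ℝ w k) = ‖gramSchmidt ℝ w k‖ ^ 2 := by
  conv_lhs => rw [gramSchmidt_def'' ℝ w k]
  rw [inner_add_left, real_inner_self_eq_norm_sq, sum_inner, Finset.sum_eq_zero, add_zero]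
  intro i hi
  rw [real_inner_smul_left, gramSchmidt_orthogonal ℝ w (Finset.mem_Iio.1 hi).ne, mul_zero]

/-- the dual vector: pairs to `1` with `w r` and to `0` with the others. -/
theorem dual_exists {N : ℕ} (r : Fin N) : ∃ Φ : (Fin N → F) → F, ContDiffOn ℝ ∞ Φ (LI N F) ∧
    ∀ w ∈ LI N F, ∀ i, inner ℝ (w i) (Φ w) = if i = r then 1 else 0 := by
  have hN : N - 1 < N := by have := r.2; omega
  set la : Fin N := ⟨N - 1, hN⟩
  let σ := Equiv.swap r la
  have hσ : ∀ w ∈ LI N F, (fun i => w (σ i)) ∈ LI N F := fun w hw =>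
    LinearIndependent.comp (show LinearIndependent ℝ w from hw) σ σ.injective
  have h1 : ContDiffOn ℝ ∞ (fun w : Fin N → F => gramSchmidt ℝ (fun i => w (σ i)) la) (LI N F) :=
    (gs_smooth (F := F) la).comp (f := fun (w : Fin N → F) i => w (σ i)) (by fun_prop) hσ
  have h0 : ∀ w ∈ LI N F, gramSchmidt ℝ (fun i => w (σ i)) la ≠ 0 := fun w hw =>
    gramSchmidt_ne_zero (𝕜 := ℝ) la (show LinearIndependent ℝ _ from hσ w hw)
  refine ⟨fun w => (‖gramSchmidt ℝ (fun i => w (σ i)) la‖ ^ 2)⁻¹ • gramSchmidt ℝ (fun i => w (σ i)) la,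
    ((h1.norm_sq ℝ).inv fun w hw => pow_ne_zero _ (norm_ne_zero_iff.2 (h0 w hw))).smul h1, fun w hw i => ?_⟩
  have h0' := h0 w hw
  rw [real_inner_smul_right]
  have hi : w i = (fun i => w (σ i)) (σ i) := by simp [σ]
  rw [hi]
  split_ifs with h
  · subst h
    have : σ i = la := by simp [σ]
    have h4 := gs_self (fun i => w (σ i)) la
    rw [this, h4]
    field_simp
  · have h2 : σ i ≠ la := fun h3 => h (by simpa [σ] using congrArg σ h3)
    have h3 : σ i < la := lt_of_le_of_ne (by
      rw [Fin.le_def]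
      have := (σ i).2
      simp only [la]
      omega) h2
    rw [real_inner_comm, gramSchmidt_inv_triangular ℝ _ h3, mul_zero]

theorem Sy.pi {E : Type} [NormedAddCommGroup E] [NormedSpace ℝ E] {α β : ℝ} {N : ℕ} {f : Fin N → P → E → F} (h : ∀ i, Sy l Q α β (f i)) :
    Sy l Q α β (fun p x i => f i p x) := by
  classical
  have := Sy.sum Finset.univ (f := fun i p x => ContinuousLinearMap.single ℝ (fun _ : Fin N => F) i (f i p x))
    fun i _ => (h i).clm _
  refine this.congr (Eventually.of_forall fun p x => ?_)
  ext i
  simp [Finset.sum_apply, Pi.single_apply]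

/-- the tuple (∂u, η) -/
noncomputable def tup (u : (Fin n → ℝ) → F) (η : Fin n → (Fin n → ℝ) → F) (x : Fin n → ℝ) : Fin (n + n) → F :=
  Fin.append (fun i => pder i u x) (fun k => η k x)

theorem mkFr [FiniteDimensional ℝ F] (hQ : Tendsto Q l atTop) {m β : ℝ} {u : P → (Fin n → ℝ) → F}
    {η : Fin n → P → (Fin n → ℝ) → F}
    {K : Set (Fin (n + n) → F)} (hK : IsCompact K) (hKL : K ⊆ LI (n + n) F)
    (sm : ∀ᶠ p in l, ContDiff ℝ ∞ (u p))
    (du : ∀ i, Sy l Q 0 m (fun p => pder i (u p)))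
    (ddu : ∀ i j, Sy l Q (-β + m) m (fun p => pder j (pder i (u p))))
    (he : ∀ k, Sy l Q 0 m (η k))
    (hfK : ∀ᶠ p in l, ∀ x, tup (u p) (fun k => η k p) x ∈ K) : ∃ ζ T, Fr l Q m β u ζ T := by
  have ht : Sy l Q 0 m (fun p x => tup (u p) (fun k => η k p) x) := by
    refine Sy.pi (f := fun i p x => tup (u p) (fun k => η k p) x i) fun i => ?_
    refine Fin.addCases (fun i => ?_) (fun i => ?_) i
    · simpa [tup] using du i
    · exact (he i).congr (Eventually.of_forall fun p x => Fin.append_right _ _ i)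
  choose Φ hΦ1 hΦ2 using fun r : Fin (n + n) => dual_exists (F := F) r
  refine ⟨fun k p x => gramSchmidtNormed ℝ (tup (u p) (fun k => η k p) x) (Fin.natAdd n k),
    fun k p x => Φ (Fin.castAdd n k) (tup (u p) (fun k => η k p) x), sm, du, ddu, ?_, ?_, ?_, ?_, ?_⟩
  · intro k
    exact ht.comp hQ LI_open hK hKL (gsn_smooth _) hfK
  · intro k
    exact ht.comp hQ LI_open hK hKL (hΦ1 _) hfK
  · filter_upwards [hfK] with p hp x i k
    have : pder i (u p) x = tup (u p) (fun k => η k p) x (Fin.castAdd n i) := by simp [tup]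
    rw [this, gramSchmidtNormed, inner_smul_right, real_inner_comm, gramSchmidt_inv_triangular, mul_zero]
    rw [Fin.lt_def]; simp; omega
  · filter_upwards [hfK] with p hp x k r
    have := orthonormal_iff_ite.1 (gramSchmidtNormed_orthonormal (show LinearIndependent ℝ _ from hKL (hp x)))
      (Fin.natAdd n k) (Fin.natAdd n r)
    simpa using this
  · filter_upwards [hfK] with p hp x i r
    have : pder i (u p) x = tup (u p) (fun k => η k p) x (Fin.castAdd n i) := by simp [tup]
    rw [this, hΦ2 _ _ (hKL (hp x))]
    simp

end Fm
end NK

namespace NK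
section Gp
variable {n : ℕ}

def lin (c P : Fin n → Fin n → ℝ) : ℝ := ∑ i, ∑ j, c i j * P i j

def Hm (n : ℕ) (i j : Fin n) : ℝ := if i = j then n else 1

/-- Decomposition of symmetric matrices into primitive ones, with `n` of them free. -/
structure Prim (n J : ℕ) where
  o : Fin n
  ξ0 : Fin n → Fin n → ℝ
  ξ1 : Fin J → Fin n → Fin n → ℝ
  L0 : Fin n → Fin n → Fin n → ℝ
  L1 : Fin J → Fin n → Fin n → Fin n → ℝ
  ho : ∀ k, ξ0 k o = 1
  dec : ∀ P : Fin n → Fin n → ℝ, (∀ i j, P i j = P j i) → ∀ i j, P i j =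
    ∑ k, lin (L0 k) P * ξ0 k i * ξ0 k j + ∑ r, ∑ k, lin (L1 r k) P * ξ1 r k i * ξ1 r k j
  pos0 : ∀ k, 0 < lin (L0 k) (Hm n)
  pos1 : ∀ r k, 0 < lin (L1 r k) (Hm n)
  zer : ∀ C : Fin n → Fin n → ℝ, (∀ i, C o i = 0) → ∀ k, lin (L0 k) C = 0

/-- coefficient functional -/
def cf (i j : Fin n) : Fin n → Fin n → ℝ := fun a b =>
  if i = j then (if a = i then (if b = i then 1 else -1) else 0) else if a = i ∧ b = j then 1 else 0

def vv (i j : Fin n) : Fin n → ℝ := fun a => if a = i ∨ a = j then 1 else 0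

theorem lin_cf (P : Fin n → Fin n → ℝ) (i j : Fin n) :
    lin (cf i j) P = if i = j then P i i - ∑ b, (if b = i then 0 else P i b) else P i j := by
  unfold lin cf
  split_ifs with h
  · rw [Finset.sum_eq_single i]
    · simp only [if_true]
      have : ∀ b, (if b = i then (1:ℝ) else -1) * P i b = (if b = i then P i b else 0) - (if b = i then 0 else P i b) := by
        intro b; split_ifs <;> simp
      simp only [this, Finset.sum_sub_distrib, Finset.sum_ite_eq', Finset.mem_univ, if_true]
    · intro b _ hb; simp [hb]
    · simp
  · rw [Finset.sum_eq_single i, Finset.sum_eq_single j]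
    · simp
    · intro b _ hb; simp [hb]
    · simp
    · intro b _ hb; simp [hb]
    · simp

theorem lin_cf_H (i j : Fin n) : lin (cf i j) (Hm n) = 1 := by
  rw [lin_cf]
  split_ifs with h
  · have : ∀ b, (if b = i then (0:ℝ) else Hm n i b) = 1 - if b = i then 1 else 0 := by
      intro b
      simp only [Hm]
      by_cases hb : b = i
      · simp [hb]
      · simp [hb, Ne.symm hb]
    simp only [this]; simp [Hm]
  · simp [Hm, h]

theorem base_dec (P : Fin n → Fin n → ℝ) (hP : ∀ i j, P i j = P j i) (a b : Fin n) :
    P a b = ∑ i, ∑ j, if i ≤ j then lin (cf i j) P * vv i j a * vv i j b else 0 := by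
  have h1 : ∀ i j : Fin n, (if i ≤ j then lin (cf i j) P * vv i j a * vv i j b else 0) =
      (if i = j then (P i i - ∑ c, (if c = i then 0 else P i c)) * ((if a = i then 1 else 0) * (if b = i then 1 else 0)) else 0)
      + ((if i < j then P i j * ((if a = i then 1 else 0) * (if b = i then 1 else 0) + (if a = i then 1 else 0) * (if b = j then 1 else 0)) else 0)
      + (if i < j then P j i * ((if a = j then 1 else 0) * (if b = j then 1 else 0) + (if a = j then 1 else 0) * (if b = i then 1 else 0)) else 0)) := by
    intro i j
    rcases lt_trichotomy i j with h | h | h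
    · rw [lin_cf, if_pos h.le, if_neg h.ne, if_neg h.ne, if_pos h, if_pos h, hP j i]
      have hv : ∀ a, vv i j a = (if a = i then 1 else 0) + (if a = j then 1 else 0) := by
        intro a
        simp only [vv]
        by_cases h1 : a = i
        · have : a ≠ j := h1 ▸ h.ne
          simp [h1, h.ne]
        · simp [h1]
      rw [hv, hv]; ring
    · subst h
      rw [lin_cf]
      simp only [le_refl, if_true, lt_irrefl, if_false, add_zero, vv, or_self]
      ring
    · rw [if_neg (not_le.2 h), if_neg h.ne', if_neg (not_lt.2 h.le), if_neg (not_lt.2 h.le)]; simp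
  simp only [h1, Finset.sum_add_distrib]
  have h2 : (∑ i, ∑ j, (if i < j then P j i * ((if a = j then 1 else 0) * (if b = j then 1 else 0) + (if a = j then 1 else 0) * (if b = i then 1 else 0)) else 0))
    = ∑ i, ∑ j, (if j < i then P i j * ((if a = i then 1 else 0) * (if b = i then 1 else 0) + (if a = i then 1 else 0) * (if b = j then 1 else 0)) else 0) := Finset.sum_comm
  rw [h2, ← Finset.sum_add_distrib, ← Finset.sum_add_distrib]
  rw [Finset.sum_eq_single a]
  · rw [← Finset.sum_add_distrib, ← Finset.sum_add_distrib]
    simp only [if_true, one_mul]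
    by_cases hab : b = a
    · subst hab
      have h3 : ∀ j, (if b = j then (P b b - ∑ c, (if c = b then 0 else P b c)) * 1 else 0) +
          ((if b < j then P b j * (1 + if b = j then 1 else 0) else 0) +
          (if j < b then P b j * (1 + if b = j then 1 else 0) else 0)) =
          (if b = j then (P b b - ∑ c, (if c = b then 0 else P b c)) else 0) + (if j = b then 0 else P b j) := by
        intro j
        rcases lt_trichotomy b j with h | h | h
        · simp [h, h.ne, h.ne', not_lt.2 h.le]
        · simp [h]
        · simp [h, h.ne, h.ne', not_lt.2 h.le]
      simp only [if_true]
      simp only [h3, Finset.sum_add_distrib, Finset.sum_ite_eq, Finset.mem_univ, if_true]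
      ring
    · simp only [if_neg hab, mul_zero, zero_add]
      have h3 : ∀ j, ((if a = j then 0 else 0) + ((if a < j then P a j * (if b = j then 1 else 0) else 0) +
          (if j < a then P a j * (if b = j then 1 else 0) else 0))) = if b = j then P a j else 0 := by
        intro j
        rcases lt_trichotomy a j with h | h | h
        · simp [h, not_lt.2 h.le]
        · have : b ≠ j := h ▸ hab
          simp [h, this]
        · simp [h, not_lt.2 h.le]
      simp only [h3]
      simp
  · intro i _ hi
    simp [Ne.symm hi]
  · simp

theorem lin_div (c P : Fin n → Fin n → ℝ) (t : ℝ) : lin (fun i j => c i j / t) P = lin c P / t := by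
  unfold lin
  simp only [Finset.sum_div]
  refine Finset.sum_congr rfl fun i _ => Finset.sum_congr rfl fun j _ => ?_
  ring

theorem prim_exists (hn : 2 ≤ n) (J : ℕ) (hJ : n.choose 2 ≤ J * n) : Nonempty (Prim n J) := by
  classical
  let o : Fin n := ⟨0, by omega⟩
  let R := {q : Fin n × Fin n // q.1 ≤ q.2 ∧ q.1 ≠ o}
  have ho2 : ∀ q : R, q.1.2 ≠ o := fun q h => q.2.2 (by
    have := q.2.1
    rw [h, Fin.le_def] at this
    exact Fin.ext (by simpa [o] using this))
  have : Nonempty R := ⟨⟨(⟨1, by omega⟩, ⟨1, by omega⟩), le_rfl, by simp [o]⟩⟩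
  have hcard : Fintype.card R ≤ Fintype.card (Fin J × Fin n) := by
    have h1 : Fintype.card R ≤ Fintype.card (Sym2 {i : Fin n // i ≠ o}) := by
      refine Fintype.card_le_of_injective (fun q : R => s(⟨q.1.1, q.2.2⟩, ⟨q.1.2, ho2 q⟩)) fun q q' h => ?_
      rw [Sym2.eq_iff] at h
      simp only [Subtype.mk.injEq] at h
      rcases h with ⟨h1, h2⟩ | ⟨h1, h2⟩
      · exact Subtype.ext (Prod.ext h1 h2)
      · have e1 := q.2.1
        have e2 := q'.2.1
        have e3 : q'.1.1 = q'.1.2 := le_antisymm e2 (by rw [← h1, ← h2]; exact e1)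
        exact Subtype.ext (Prod.ext (h1.trans e3.symm) (h2.trans e3))
    rw [Sym2.card] at h1
    simp only [ne_eq, Fintype.card_subtype_compl, Fintype.card_fin, Fintype.card_unique] at h1
    rw [show n - 1 + 1 = n by omega] at h1
    simpa using h1.trans hJ
  obtain ⟨e⟩ := Function.Embedding.nonempty_of_card_le hcard
  let s : Fin J × Fin n → R := Function.invFun e
  have hs : Function.Surjective s := Function.invFun_surjective e.injective
  let N : R → ℕ := fun q => (Finset.univ.filter fun t => s t = q).card
  have hN : ∀ q, 0 < N q := fun q => by
    obtain ⟨t, ht⟩ := hs q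
    exact Finset.card_pos.2 ⟨t, by simp [ht]⟩
  refine ⟨⟨o, fun k => vv o k, fun r k => vv (s (r, k)).1.1 (s (r, k)).1.2, fun k => cf o k,
    fun r k => fun i j => cf (s (r, k)).1.1 (s (r, k)).1.2 i j / N (s (r, k)), ?_, ?_, ?_, ?_, ?_⟩⟩
  · intro k; simp [vv]
  · intro P hP a b
    rw [base_dec P hP a b, ← Finset.add_sum_erase _ _ (Finset.mem_univ o)]
    refine congrArg₂ (· + ·) ?_ ?_
    · refine Finset.sum_congr rfl fun k _ => ?_
      rw [if_pos (by rw [Fin.le_def]; simp [o])]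
    · refine Eq.trans ?_ (Fintype.sum_prod_type (fun t : Fin J × Fin n => lin (fun i j => cf (s t).1.1 (s t).1.2 i j / N (s t)) P *
        vv (s t).1.1 (s t).1.2 a * vv (s t).1.1 (s t).1.2 b))
      have h2 := Finset.sum_comp (s := (Finset.univ : Finset (Fin J × Fin n))) (fun q : R =>
        lin (fun i j => cf q.1.1 q.1.2 i j / N q) P * vv q.1.1 q.1.2 a * vv q.1.1 q.1.2 b) s
      refine Eq.trans ?_ h2.symm
      rw [Finset.image_univ_of_surjective hs]
      have h3 : ∀ q : R, (Finset.univ.filter fun t => s t = q).card • (lin (fun i j => cf q.1.1 q.1.2 i j / N q) P * vv q.1.1 q.1.2 a * vv q.1.1 q.1.2 b)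
          = lin (cf q.1.1 q.1.2) P * vv q.1.1 q.1.2 a * vv q.1.1 q.1.2 b := by
        intro q
        rw [lin_div, nsmul_eq_mul]
        have : (N q : ℝ) ≠ 0 := by have := hN q; positivity
        change (N q : ℝ) * _ = _
        field_simp
      rw [Finset.sum_congr rfl fun q _ => h3 q]
      rw [← Finset.sum_subtype (Finset.univ.filter fun q : Fin n × Fin n => q.1 ≤ q.2 ∧ q.1 ≠ o) (by simp)
        (fun q => lin (cf q.1 q.2) P * vv q.1 q.2 a * vv q.1 q.2 b), Finset.sum_filter, Fintype.sum_prod_type,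
        ← Finset.add_sum_erase _ _ (Finset.mem_univ o)]
      simp only [ne_eq, not_true, and_false, if_false, Finset.sum_const_zero, zero_add]
      refine Finset.sum_congr rfl fun i hi => Finset.sum_congr rfl fun j _ => ?_
      have := Finset.ne_of_mem_erase hi
      simp [this]
  · intro k; rw [lin_cf_H]; norm_num
  · intro r k
    rw [lin_div, lin_cf_H]
    have := hN (s (r, k))
    positivity
  · intro C hC k
    rw [lin_cf]
    split_ifs <;> simp [hC]

end Gp
end NK

namespace NK
open Filter Topology
open scoped ContDiff
section H1

variable {P : Type} {n : ℕ} {F : Type} [NormedAddCommGroup F] [InnerProductSpace ℝ F]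
variable {l : Filter P} {Q : P → ℝ} {m L β t : ℝ}

theorem Sy.rinv (hQ : Tendsto Q l atTop) {α : ℝ} {f : P → (Fin n → ℝ) → ℝ} (hf : Sy l Q α m f) {c : ℝ} (hc : 0 < c)
    (h : ∀ᶠ p in l, ∀ x, c * Q p ^ α ≤ f p x) : Sy l Q (-α) m (fun p x => (f p x)⁻¹) := by
  obtain ⟨C, hC, hb⟩ := hf.bound
  have h1 : Sy l Q 0 m (fun p x => Q p ^ (-α) * f p x) :=
    ((Sy.pow hQ).mul hQ hf).mono hQ (by linarith) le_rfl
  have h2 : Sy l Q 0 m (fun p x => (Q p ^ (-α) * f p x)⁻¹) := by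
    refine h1.comp hQ (Φ := fun y : ℝ => y⁻¹) (U := Set.Ioi 0) (K := Set.Icc c C) isOpen_Ioi isCompact_Icc
      (fun y hy => lt_of_lt_of_le hc hy.1) (contDiffOn_id.inv fun y hy => (ne_of_gt hy)) ?_
    filter_upwards [h, hb, ev_one hQ] with p h3 h4 hq x
    have hq0 : 0 < Q p := by linarith
    have e : Q p ^ (-α) * Q p ^ α = 1 := by rw [← Real.rpow_add hq0]; simp
    have e0 : 0 < Q p ^ (-α) := by positivity
    constructor
    · have := mul_le_mul_of_nonneg_left (h3 x) e0.le
      nlinarith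
    · have := mul_le_mul_of_nonneg_left ((le_abs_self _).trans (h4 x)) e0.le
      nlinarith
  refine (((Sy.pow hQ).mul hQ h2).mono hQ (show -α + 0 ≤ -α by linarith) le_rfl).congr ?_
  filter_upwards [ev_one hQ] with p hq x
  have hq0 : 0 < Q p := by linarith
  have : Q p ^ (-α) ≠ 0 := by positivity
  rw [mul_inv, ← mul_assoc, mul_inv_cancel₀ this, one_mul]

theorem Sy.sqrt (hQ : Tendsto Q l atTop) {f : P → (Fin n → ℝ) → ℝ} (hf : Sy l Q (-2 * β) m f) {c : ℝ} (hc : 0 < c)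
    (h : ∀ᶠ p in l, ∀ x, c * Q p ^ (-2 * β) ≤ f p x) : Sy l Q (-β) m (fun p x => √(f p x)) := by
  obtain ⟨C, hC, hb⟩ := hf.bound
  have h1 : Sy l Q 0 m (fun p x => Q p ^ (2 * β) * f p x) :=
    ((Sy.pow hQ).mul hQ hf).mono hQ (by linarith) le_rfl
  have h2 : Sy l Q 0 m (fun p x => √(Q p ^ (2 * β) * f p x)) := by
    refine h1.comp hQ (Φ := fun y : ℝ => √y) (U := Set.Ioi 0) (K := Set.Icc c C) isOpen_Ioi isCompact_Icc
      (fun y hy => lt_of_lt_of_le hc hy.1) (contDiffOn_id.sqrt fun y hy => (ne_of_gt hy)) ?_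
    filter_upwards [h, hb, ev_one hQ] with p h3 h4 hq x
    have hq0 : 0 < Q p := by linarith
    have e : Q p ^ (2 * β) * Q p ^ (-2 * β) = 1 := by rw [← Real.rpow_add hq0]; simp
    have e0 : 0 < Q p ^ (2 * β) := by positivity
    constructor
    · have := mul_le_mul_of_nonneg_left (h3 x) e0.le
      nlinarith
    · have := mul_le_mul_of_nonneg_left ((le_abs_self _).trans (h4 x)) e0.le
      nlinarith
  refine (((Sy.pow hQ).mul hQ h2).mono hQ (show -β + 0 ≤ -β by linarith) le_rfl).congr ?_
  filter_upwards [ev_one hQ] with p hq x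
  have hq0 : 0 < Q p := by linarith
  have e0 : 0 < Q p ^ β := by positivity
  rw [Real.sqrt_mul (by positivity), mul_comm 2 β, Real.rpow_mul hq0.le, show ((Q p ^ β) ^ (2:ℝ)) = (Q p ^ β) ^ 2 by norm_cast,
    Real.sqrt_sq e0.le, Real.rpow_neg hq0.le, ← mul_assoc, inv_mul_cancel₀ e0.ne', one_mul]

theorem sqrt_lower (hQ : Tendsto Q l atTop) {f : P → (Fin n → ℝ) → ℝ} {c : ℝ} (hc : 0 < c)
    (h : ∀ᶠ p in l, ∀ x, c * Q p ^ (-2 * β) ≤ f p x) : ∀ᶠ p in l, ∀ x, √c * Q p ^ (-β) ≤ √(f p x) := by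
  filter_upwards [h, ev_one hQ] with p hp hq x
  have hq0 : 0 < Q p := by linarith
  refine Real.le_sqrt_of_sq_le ?_
  rw [mul_pow, Real.sq_sqrt hc.le, ← Real.rpow_natCast, ← Real.rpow_mul hq0.le]
  convert hp x using 3
  push_cast; ring

theorem Sy.sqrt_sub (hQ : Tendsto Q l atTop) {f g : P → (Fin n → ℝ) → ℝ} (hf : Sy l Q (-2 * β) m f)
    (hg : Sy l Q (-2 * β) m g) {c : ℝ} (hc : 0 < c)
    (h : ∀ᶠ p in l, ∀ x, c * Q p ^ (-2 * β) ≤ f p x) (h' : ∀ᶠ p in l, ∀ x, c * Q p ^ (-2 * β) ≤ g p x)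
    (hd : Sy l Q (-2 * β - t) m (fun p x => f p x - g p x)) :
    Sy l Q (-β - t) m (fun p x => √(f p x) - √(g p x)) := by
  have h1 : Sy l Q (-β) m (fun p x => √(f p x) + √(g p x)) := (hf.sqrt hQ hc h).add (hg.sqrt hQ hc h')
  have hsc : 0 < √c := Real.sqrt_pos.2 hc
  have l1 := sqrt_lower hQ hc h
  have l2 := sqrt_lower hQ hc h'
  have h2 := h1.rinv hQ hsc (by
    filter_upwards [l1, ev_one hQ] with p hp hq x
    have := hp x
    have := Real.sqrt_nonneg (g p x)
    linarith)
  refine ((hd.mul hQ h2).mono hQ (by linarith) le_rfl).congr ?_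
  filter_upwards [h, h', l1, l2, ev_one hQ] with p a1 a2 a3 a4 hq x
  have hq0 : 0 < Q p := by linarith
  have e0 : 0 < √c * Q p ^ (-β) := by positivity
  have e1 : 0 < c * Q p ^ (-2 * β) := by positivity
  have b1 := a1 x; have b2 := a2 x; have b3 := a3 x; have b4 := a4 x
  rw [eq_mul_inv_iff_mul_eq₀ (by linarith)]
  have s1 := Real.mul_self_sqrt (show 0 ≤ f p x by linarith)
  have s2 := Real.mul_self_sqrt (show 0 ≤ g p x by linarith)
  nlinarith

theorem Sy.lin {α : ℝ} (c : Fin n → Fin n → ℝ) {D : Fin n → Fin n → P → (Fin n → ℝ) → ℝ}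
    (hD : ∀ i j, Sy l Q α m (D i j)) : Sy l Q α m (fun p x => NK.lin c (fun i j => D i j p x)) := by
  unfold NK.lin
  exact Sy.sum _ fun i _ => Sy.sum _ fun j _ => (hD i j).const_mul _

theorem lin_sub (c P P' : Fin n → Fin n → ℝ) : lin c (fun i j => P i j - P' i j) = lin c P - lin c P' := by
  simp [lin, mul_sub, Finset.sum_sub_distrib]
theorem lin_add (c P P' : Fin n → Fin n → ℝ) : lin c (fun i j => P i j + P' i j) = lin c P + lin c P' := by
  simp [lin, mul_add, Finset.sum_add_distrib]
theorem lin_smul (c P : Fin n → Fin n → ℝ) (t : ℝ) : lin c (fun i j => t * P i j) = t * lin c P := by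
  simp only [lin, Finset.mul_sum]
  refine Finset.sum_congr rfl fun i _ => Finset.sum_congr rfl fun j _ => ?_
  ring

variable {ζ : Fin n → P → (Fin n → ℝ) → F} {a a' : Fin n → P → (Fin n → ℝ) → ℝ}

theorem slow_diff (hQ : Tendsto Q l atTop) (hz : ∀ k, Sy l Q 0 m (ζ k))
    (ha : ∀ k, Sy l Q (-β) m (a k)) (ha' : ∀ k, Sy l Q (-β) m (a' k))
    (hd : ∀ k, Sy l Q (-β - t) m (fun p x => a k p x - a' k p x)) (i j : Fin n) :
    Sy l Q (-2 * β + 2 * (m - L) - t) m (fun p x => slowf Q L ζ a i j p x - slowf Q L ζ a' i j p x) := by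
  have key : Sy l Q (-2 * β + 2 * (m - L) - t) m (fun p x => ∑ k, (ka k ^ 2 * (Q p ^ (-L) * Q p ^ (-L))) *
    (inner ℝ (pder i (fun x => (a k p x - a' k p x) • ζ k p x) x) (pder j (fun x => a k p x • ζ k p x) x)
      + inner ℝ (pder i (fun x => a' k p x • ζ k p x) x) (pder j (fun x => (a k p x - a' k p x) • ζ k p x) x))) := by
    refine Sy.sum _ fun k _ => ?_
    have h1 := ((qS (n := n) hQ L m).mul hQ (qS hQ L m)).const_mul (ka k ^ 2)
    have h2 := fun i => (((ha k).smul hQ (hz k)).pder i)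
    have h2' := fun i => (((ha' k).smul hQ (hz k)).pder i)
    have h3 := fun i => (((hd k).smul hQ (hz k)).pder i)
    have h4 := ((h3 i).inner hQ (h2 j)).mono hQ (show _ ≤ -2 * β + 2 * m - t by linarith) le_rfl
    have h5 := ((h2' i).inner hQ (h3 j)).mono hQ (show _ ≤ -2 * β + 2 * m - t by linarith) le_rfl
    exact (h1.mul hQ (h4.add h5)).mono hQ (by linarith) le_rfl
  refine key.congr ?_
  have e1 : ∀ᶠ p in l, ∀ k, ContDiff ℝ ∞ (a k p) := eventually_all.2 fun k => (ha k).1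
  have e2 : ∀ᶠ p in l, ∀ k, ContDiff ℝ ∞ (a' k p) := eventually_all.2 fun k => (ha' k).1
  have e3 : ∀ᶠ p in l, ∀ k, ContDiff ℝ ∞ (ζ k p) := eventually_all.2 fun k => (hz k).1
  filter_upwards [e1, e2, e3] with p h1 h2 h3 x
  simp only [slowf]
  rw [← Finset.sum_sub_distrib]
  refine Finset.sum_congr rfl fun k _ => ?_
  have : ∀ i, pder i (fun x => (a k p x - a' k p x) • ζ k p x) x =
      pder i (fun x => a k p x • ζ k p x) x - pder i (fun x => a' k p x • ζ k p x) x := by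
    intro i
    simp only [sub_smul]
    exact pder_sub' i (sm_diff ((h1 k).smul (h3 k)) x) (sm_diff ((h2 k).smul (h3 k)) x)
  rw [this, this, inner_sub_left, inner_sub_right]
  ring

theorem fixpt (hQ : Tendsto Q l atTop) (hm : m < L) (hz : ∀ k, Sy l Q 0 m (ζ k))
    {D : Fin n → Fin n → P → (Fin n → ℝ) → ℝ} (hD : ∀ i j, Sy l Q (-2 * β) m (D i j))
    (L0 : Fin n → Fin n → Fin n → ℝ) {c : ℝ} (hc : 0 < c)
    (hlow : ∀ k, ∀ᶠ p in l, ∀ x, c * Q p ^ (-2 * β) ≤ lin (L0 k) (fun i j => D i j p x)) (N : ℕ) :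
    ∃ f : Fin n → P → (Fin n → ℝ) → ℝ, (∀ k, Sy l Q (-2 * β) m (f k)) ∧
      (∀ k, ∀ᶠ p in l, ∀ x, c / 2 * Q p ^ (-2 * β) ≤ f k p x) ∧
      ∀ k, Sy l Q (-2 * β - 2 * (L - m) * (N + 1)) m (fun p x => f k p x - (lin (L0 k) (fun i j => D i j p x)
        - lin (L0 k) (fun i j => slowf Q L ζ (fun k p x => √(f k p x)) i j p x))) := by
  induction N with
  | zero =>
    have h2 : ∀ k, ∀ᶠ p in l, ∀ x, c / 2 * Q p ^ (-2 * β) ≤ lin (L0 k) (fun i j => D i j p x) := by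
      intro k
      filter_upwards [hlow k, ev_one hQ] with p hp hq x
      refine le_trans ?_ (hp x)
      gcongr
      linarith
    refine ⟨fun k p x => lin (L0 k) (fun i j => D i j p x), fun k => Sy.lin _ hD, h2, fun k => ?_⟩
    have hs : ∀ k, Sy l Q (-β) m (fun p x => √(lin (L0 k) (fun i j => D i j p x))) := fun k =>
      (Sy.lin _ hD).sqrt hQ (half_pos hc) (h2 k)
    refine ((Sy.lin (L0 k) (slow_Sy (L := L) hQ hz hs)).mono hQ ?_ le_rfl).congr (Eventually.of_forall fun p x => ?_)
    · push_cast; linarith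
    · ring
  | succ N ih =>
    obtain ⟨f, f1, f2, f3⟩ := ih
    have hs : ∀ k, Sy l Q (-β) m (fun p x => √(f k p x)) := fun k => (f1 k).sqrt hQ (half_pos hc) (f2 k)
    have hsl : ∀ k, Sy l Q (-2 * β + 2 * (m - L)) m (fun p x => lin (L0 k) (fun i j => slowf Q L ζ (fun k p x => √(f k p x)) i j p x)) :=
      fun k => Sy.lin (L0 k) (slow_Sy (L := L) hQ hz hs)
    have g1 : ∀ k, Sy l Q (-2 * β) m (fun p x => lin (L0 k) (fun i j => D i j p x)
        - lin (L0 k) (fun i j => slowf Q L ζ (fun k p x => √(f k p x)) i j p x)) := fun k =>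
      (Sy.lin _ hD).sub ((hsl k).mono hQ (by linarith) le_rfl)
    have g2 : ∀ k, ∀ᶠ p in l, ∀ x, c / 2 * Q p ^ (-2 * β) ≤ lin (L0 k) (fun i j => D i j p x)
        - lin (L0 k) (fun i j => slowf Q L ζ (fun k p x => √(f k p x)) i j p x) := by
      intro k
      filter_upwards [hlow k, (hsl k).small hQ (show _ < -2 * β by linarith) (half_pos hc)] with p hp hq x
      have := hp x
      have := (le_abs_self _).trans (hq x)
      linarith
    refine ⟨_, g1, g2, fun k => ?_⟩
    have gs : ∀ k, Sy l Q (-β) m (fun p x => √(lin (L0 k) (fun i j => D i j p x)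
        - lin (L0 k) (fun i j => slowf Q L ζ (fun k p x => √(f k p x)) i j p x))) := fun k =>
      (g1 k).sqrt hQ (half_pos hc) (g2 k)
    have hd : ∀ k, Sy l Q (-β - 2 * (L - m) * (N + 1)) m (fun p x => √(f k p x) - √(lin (L0 k) (fun i j => D i j p x)
        - lin (L0 k) (fun i j => slowf Q L ζ (fun k p x => √(f k p x)) i j p x))) := fun k =>
      (f1 k).sqrt_sub hQ (g1 k) (half_pos hc) (f2 k) (g2 k) (f3 k)
    refine ((Sy.lin (L0 k) fun i j => slow_diff (L := L) hQ hz hs gs hd i j).neg.mono hQ ?_ le_rfl).congr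
      (Eventually.of_forall fun p x => ?_)
    · push_cast; linarith
    · simp only [lin_sub]; ring

end H1
end NK

namespace NK
open Filter Topology
open scoped ContDiff
section H2

variable {P : Type} {n J : ℕ} {F : Type} [NormedAddCommGroup F] [InnerProductSpace ℝ F]
variable {l : Filter P} {Q : P → ℝ} {m L β t : ℝ}
variable {u : P → (Fin n → ℝ) → F} {ζ T : Fin n → P → (Fin n → ℝ) → F}


theorem freeStep (hQ : Tendsto Q l atTop) (pr : Prim n J) (hm : m < L) (hβ : 0 ≤ β) (hF : Fr l Q m β u ζ T)
    {D : Fin n → Fin n → P → (Fin n → ℝ) → ℝ} (hD : ∀ i j, Sy l Q (-2 * β) m (D i j))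
    (hDs : ∀ᶠ p in l, ∀ x i j, D i j p x = D j i p x) {c : ℝ} (hc : 0 < c)
    (hlow : ∀ k, ∀ᶠ p in l, ∀ x, c * Q p ^ (-2 * β) ≤ lin (pr.L0 k) (fun i j => D i j p x))
    (hlow1 : ∀ r k, ∀ᶠ p in l, ∀ x, c * Q p ^ (-2 * β) ≤ lin (pr.L1 r k) (fun i j => D i j p x)) :
    ∃ (v : P → (Fin n → ℝ) → F) (d : Fin J → Fin n → P → (Fin n → ℝ) → ℝ),
      Sy l Q (-β - L) L (fun p x => v p x - u p x) ∧ (∀ r k, Sy l Q (-2 * β) L (d r k)) ∧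
      (∀ r k, ∀ᶠ p in l, ∀ x, c / 2 * Q p ^ (-2 * β) ≤ d r k p x) ∧
      ∃ R : Fin n → Fin n → P → (Fin n → ℝ) → ℝ, (∀ i j, Sy l Q (-3 * β) L (R i j)) ∧
      ∀ᶠ p in l, ∀ x i j, (inner ℝ (pder i (u p) x) (pder j (u p) x)) + D i j p x = (inner ℝ (pder i (v p) x) (pder j (v p) x))
        + ∑ r, ∑ k, d r k p x * pr.ξ1 r k i * pr.ξ1 r k j + R i j p x := by
  obtain ⟨N, hN⟩ := exists_nat_ge (β / (2 * (L - m)))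
  have hLm : 0 < 2 * (L - m) := by linarith
  rw [div_le_iff₀ hLm] at hN
  obtain ⟨f, f1, f2, f3⟩ := fixpt (L := L) hQ hm hF.ze hD pr.L0 hc hlow N
  set a : Fin n → P → (Fin n → ℝ) → ℝ := fun k p x => √(f k p x) with had
  have ha : ∀ k, Sy l Q (-β) m (a k) := fun k => (f1 k).sqrt hQ (half_pos hc) (f2 k)
  have hsl : ∀ i j, Sy l Q (-2 * β + 2 * (m - L)) m (slowf Q L ζ a i j) := slow_Sy (L := L) hQ hF.ze ha
  obtain ⟨y, C, R1, hy, hC, hR1, hCs, hX⟩ := X_Res (ξ := pr.ξ0) hQ hm hF ha pr.o pr.ho (-3 * β)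
  obtain ⟨⟨R2, hR2, hv⟩, hvu⟩ := step (ξ := pr.ξ0) (y2 := fun i p x => - y i p x) hQ hm.le hβ hF ha
    fun i => ((hy i).mono hQ (by linarith) le_rfl).neg
  set v := vf Q L pr.ξ0 u ζ T a (fun i p x => - y i p x) with hvd
  have hG : ∀ i j, Sy l Q (-2 * β) L (fun p x => D i j p x - (slowf Q L ζ a i j p x + C i j p x)) := fun i j =>
    ((hD i j).mono hQ le_rfl hm.le).sub (((hsl i j).mono hQ (by linarith) hm.le).add ((hC i j).mono hQ (by linarith) le_rfl))
  have hE : ∀ i j, Sy l Q (-2 * β - (L - m)) L (fun p x => (slowf Q L ζ a i j p x + C i j p x)) := fun i j =>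
    ((hsl i j).mono hQ (by linarith) hm.le).add ((hC i j).mono hQ (by linarith) le_rfl)
  refine ⟨v, fun r k p x => lin (pr.L1 r k) (fun i j => D i j p x - (slowf Q L ζ a i j p x + C i j p x)), hvu,
    fun r k => Sy.lin _ hG, fun r k => ?_, ?_⟩
  · filter_upwards [hlow1 r k, (Sy.lin (pr.L1 r k) hE).small hQ (show _ < -2 * β by linarith) (half_pos hc)] with p h1 h2 x
    have := h1 x
    have := (le_abs_self _).trans (h2 x)
    rw [lin_sub]
    linarith
  · -- error
    refine ⟨fun i j p x => ∑ k, (-(f k p x - (lin (pr.L0 k) (fun i j => D i j p x)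
        - lin (pr.L0 k) (fun i j => slowf Q L ζ a i j p x)))) * pr.ξ0 k i * pr.ξ0 k j - R1 i j p x - R2 i j p x, ?_, ?_⟩
    · intro i j
      refine ((Sy.sum _ fun k _ => ?_).sub (hR1 i j)).sub (hR2 i j)
      exact (((f3 k).neg.mul_const _).mul_const _).mono hQ (by nlinarith) hm.le
    · have ey : ∀ᶠ p in l, ∀ k, ContDiff ℝ ∞ (y k p) := eventually_all.2 fun k => (hy k).1
      have ef : ∀ᶠ p in l, ∀ k x, c / 2 * Q p ^ (-2 * β) ≤ f k p x := eventually_all.2 f2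
      filter_upwards [hv, hX, hCs, hDs, ey, ef, ev_one hQ] with p h1 h2 h3 h4 h5 h6 hq x i j
      have hq0 : 0 < Q p := by linarith
      have hny : ∀ i j, pder j (fun x => - y i p x) x = - pder j (y i p) x := fun i j =>
        pder_neg' j
      have hasq : ∀ k, a k p x ^ 2 = f k p x := fun k => by
        refine Real.sq_sqrt (le_trans ?_ (h6 k x))
        positivity
      have hslow : ∀ i j, slowf Q L ζ a i j p x = slowf Q L ζ a j i p x := fun i j => by
        simp only [slowf]
        refine Finset.sum_congr rfl fun k _ => ?_
        rw [real_inner_comm]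
      have hdec := pr.dec (fun i j => D i j p x - (slowf Q L ζ a i j p x + C i j p x)) (fun i j => by
        rw [h4 x i j, hslow i j, (h3 x i j).1]) i j
      have hz : ∀ k, lin (pr.L0 k) (fun i j => D i j p x - (slowf Q L ζ a i j p x + C i j p x)) =
          lin (pr.L0 k) (fun i j => D i j p x) - lin (pr.L0 k) (fun i j => slowf Q L ζ a i j p x) := fun k => by
        rw [lin_sub, lin_add, pr.zer (fun i j => C i j p x) (fun i => (h3 x i i).2), add_zero]
      have e1 := h1 x i j
      have e2 := h2 x i j
      simp only [hz] at hdec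
      rw [e1, hny, hny]
      simp only [hasq]
      have e3 : ∑ k, (-(f k p x - (lin (pr.L0 k) (fun i j => D i j p x)
        - lin (pr.L0 k) (fun i j => slowf Q L ζ a i j p x)))) * pr.ξ0 k i * pr.ξ0 k j =
        ∑ k, (lin (pr.L0 k) (fun i j => D i j p x)
        - lin (pr.L0 k) (fun i j => slowf Q L ζ a i j p x)) * pr.ξ0 k i * pr.ξ0 k j - ∑ k, f k p x * pr.ξ0 k i * pr.ξ0 k j := by
        rw [← Finset.sum_sub_distrib]
        refine Finset.sum_congr rfl fun k _ => by ring
      rw [e3]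
      linarith

end H2
end NK

namespace NK
open Filter Topology Metric
open scoped ContDiff
section H3

variable {P : Type} {n J : ℕ} {F : Type} [NormedAddCommGroup F] [InnerProductSpace ℝ F] [FiniteDimensional ℝ F]
variable {l : Filter P} {Q : P → ℝ} {m L β κ : ℝ}


/-- data: `v` is close to `U` at frequency `M` -/
structure Cl (l : Filter P) (Q : P → ℝ) (M β : ℝ) (U v : P → (Fin n → ℝ) → F) : Prop where
  sm : ∀ᶠ p in l, ContDiff ℝ ∞ (v p)
  c0 : Sy l Q (-β) M (fun p x => v p x - U p x)
  c1 : ∀ i, Sy l Q (-β) M (fun p x => pder i (v p) x - pder i (U p) x)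
  c2 : ∀ i j, Sy l Q (-β + M) M (fun p x => pder j (pder i (v p)) x - pder j (pder i (U p)) x)

theorem Cl.step (hQ : Tendsto Q l atTop) {M M' : ℝ} (hM' : 0 ≤ M') (hMM : M ≤ M') {U v w : P → (Fin n → ℝ) → F}
    (h : Cl l Q M β U v) (hw : Sy l Q (-β - M') M' (fun p x => w p x - v p x)) : Cl l Q M' β U w := by
  have hsw : ∀ᶠ p in l, ContDiff ℝ ∞ (w p) := by
    filter_upwards [h.sm, hw.1] with p h1 h2
    simpa using h2.add h1
  refine ⟨hsw, ?_, fun i => ?_, fun i j => ?_⟩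
  · refine ((hw.mono hQ (by linarith) le_rfl).add (h.c0.mono hQ le_rfl hMM)).congr (Eventually.of_forall fun p x => ?_)
    abel
  · refine (((hw.pder i).mono hQ (by linarith) le_rfl).add ((h.c1 i).mono hQ le_rfl hMM)).congr ?_
    filter_upwards [h.sm, hsw] with p h1 h2 x
    rw [pder_sub' i (sm_diff h2 x) (sm_diff h1 x)]
    abel
  · refine ((((hw.pder i).pder j).mono hQ (by linarith) le_rfl).add ((h.c2 i j).mono hQ (by linarith) hMM)).congr ?_
    filter_upwards [h.sm, hsw] with p h1 h2 x
    have : pder i (fun x => w p x - v p x) = fun x => pder i (w p) x - pder i (v p) x := by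
      ext1 x
      exact pder_sub' i (sm_diff h2 x) (sm_diff h1 x)
    rw [this, pder_sub' j (sm_diff (sm_pder h2 i) x) (sm_diff (sm_pder h1 i) x)]
    abel

theorem tup_near {u v : (Fin n → ℝ) → F} {η θ : Fin n → (Fin n → ℝ) → F} {K : Set (Fin (n + n) → F)} {ε : ℝ} (hε : 0 ≤ ε)
    {x : Fin n → ℝ} (h : tup u η x ∈ K) (h1 : ∀ i, ‖pder i v x - pder i u x‖ ≤ ε) (h2 : ∀ k, ‖θ k x - η k x‖ ≤ ε) :
    tup v θ x ∈ cthickening ε K := by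
  refine mem_cthickening_of_dist_le _ _ _ _ h ?_
  rw [dist_pi_le_iff hε]
  intro i
  rw [dist_eq_norm]
  refine Fin.addCases (fun i => ?_) (fun i => ?_) i
  · rw [tup, tup, Fin.append_left, Fin.append_left]; exact h1 i
  · rw [tup, tup, Fin.append_right, Fin.append_right]; exact h2 i

variable {U : P → (Fin n → ℝ) → F} {η : Fin n → P → (Fin n → ℝ) → F}

theorem Cl.fr (hQ : Tendsto Q l atTop) (hβ : 0 < β) {M : ℝ} (hM : m ≤ M)
    (du : ∀ i, Sy l Q 0 m (fun p => pder i (U p)))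
    (ddu : ∀ i j, Sy l Q (-β + m) m (fun p => pder j (pder i (U p))))
    (he : ∀ k, Sy l Q 0 m (η k)) {K : Set (Fin (n + n) → F)} (hK : IsCompact K) {ε : ℝ} (hε : 0 < ε)
    (hKL : cthickening ε K ⊆ LI (n + n) F)
    (hfK : ∀ᶠ p in l, ∀ x, tup (U p) (fun k => η k p) x ∈ K) {v : P → (Fin n → ℝ) → F} (h : Cl l Q M β U v) :
    ∃ ζ T, Fr l Q M β v ζ T := by
  refine mkFr (η := η) hQ hK.cthickening hKL h.sm (fun i => ?_) (fun i j => ?_) (fun k => (he k).mono hQ le_rfl hM) ?_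
  · refine (((h.c1 i).mono hQ (by linarith) le_rfl).add ((du i).mono hQ le_rfl hM)).congr (Eventually.of_forall fun p x => ?_)
    abel
  · refine ((h.c2 i j).add ((ddu i j).mono hQ (by linarith) hM)).congr (Eventually.of_forall fun p x => ?_)
    abel
  · have e1 : ∀ᶠ p in l, ∀ i x, ‖pder i (v p) x - pder i (U p) x‖ ≤ ε := by
      refine eventually_all.2 fun i => ?_
      filter_upwards [(h.c1 i).small hQ (show -β < 0 by linarith) hε] with p hp x
      simpa using hp x
    filter_upwards [hfK, e1] with p h1 h2 x
    exact tup_near hε.le (h1 x) (fun i => h2 i x) (by simp [hε.le])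

theorem chain (hQ : Tendsto Q l atTop) (pr : Prim n J) (hβ : 0 < β) (hκ : 0 < κ) (hκβ : κ ≤ β) (hL : m ≤ L) (hL0 : 0 ≤ L)
    (du : ∀ i, Sy l Q 0 m (fun p => pder i (U p)))
    (ddu : ∀ i j, Sy l Q (-β + m) m (fun p => pder j (pder i (U p))))
    (he : ∀ k, Sy l Q 0 m (η k)) {K : Set (Fin (n + n) → F)} (hK : IsCompact K) {ε : ℝ} (hε : 0 < ε)
    (hKL : cthickening ε K ⊆ LI (n + n) F)
    (hfK : ∀ᶠ p in l, ∀ x, tup (U p) (fun k => η k p) x ∈ K)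
    {d : Fin J → Fin n → P → (Fin n → ℝ) → ℝ} (hd : ∀ r k, Sy l Q (-2 * β) L (d r k)) {c : ℝ} (hc : 0 < c)
    (hlow : ∀ r k, ∀ᶠ p in l, ∀ x, c * Q p ^ (-2 * β) ≤ d r k p x)
    {A : Fin n → Fin n → P → (Fin n → ℝ) → ℝ}
    (h0 : ∃ (v : P → (Fin n → ℝ) → F) (R : Fin n → Fin n → P → (Fin n → ℝ) → ℝ), Cl l Q L β U v ∧ (∀ i j, Sy l Q (-2 * β - κ) L (R i j)) ∧
      ∀ᶠ p in l, ∀ x i j, A i j p x = (inner ℝ (pder i (v p) x) (pder j (v p) x))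
        + ∑ r, ∑ k, d r k p x * pr.ξ1 r k i * pr.ξ1 r k j + R i j p x) (r : ℕ) (hr : r ≤ J) :
    ∃ (v : P → (Fin n → ℝ) → F) (R : Fin n → Fin n → P → (Fin n → ℝ) → ℝ), Cl l Q (L + r * κ) β U v ∧ (∀ i j, Sy l Q (-2 * β - κ) (L + r * κ) (R i j)) ∧
      ∀ᶠ p in l, ∀ x i j, A i j p x = (inner ℝ (pder i (v p) x) (pder j (v p) x))
        + ∑ q : Fin J, (if r ≤ q then ∑ k, d q k p x * pr.ξ1 q k i * pr.ξ1 q k j else 0) + R i j p x := by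
  induction r with
  | zero => simpa using h0
  | succ r ih =>
    obtain ⟨v, R, hv, hR, hA⟩ := ih (by omega)
    have hr' : r < J := hr
    have hrn : 0 ≤ (r:ℝ) * κ := by positivity
    obtain ⟨ζ, T, hF⟩ := hv.fr hQ hβ (by linarith) du ddu he hK hε hKL hfK
    set q0 : Fin J := ⟨r, hr'⟩ with hq0
    set a : Fin n → P → (Fin n → ℝ) → ℝ := fun k p x => √(d q0 k p x) with had
    have ha : ∀ k, Sy l Q (-β) (L + r * κ) (a k) := fun k =>
      ((hd q0 k).sqrt hQ hc (hlow q0 k)).mono hQ le_rfl (by linarith)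
    have hM : L + r * κ ≤ L + (r + 1 : ℕ) * κ := by push_cast; linarith
    obtain ⟨⟨R2, hR2, hw⟩, hwv⟩ := step (ξ := pr.ξ1 q0) (y2 := fun i p x => 0) hQ hM hβ.le hF ha fun i => Sy.zero
    have hX := X_Sy (ξ := pr.ξ1 q0) hQ hM hF ha
    set w := vf Q (L + (r + 1 : ℕ) * κ) (pr.ξ1 q0) v ζ T a (fun i p x => 0) with hwd
    refine ⟨w, fun i j p x => R i j p x - Xf Q (L + (r + 1 : ℕ) * κ) (pr.ξ1 q0) v ζ a i j p x - R2 i j p x,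
      hv.step hQ (by push_cast; linarith) hM hwv, fun i j => ?_, ?_⟩
    · refine (((hR i j).mono hQ le_rfl hM).sub ((hX i j).mono hQ ?_ le_rfl)).sub ((hR2 i j).mono hQ (by linarith) le_rfl)
      push_cast; linarith
    · have ef : ∀ᶠ p in l, ∀ k x, c * Q p ^ (-2 * β) ≤ d q0 k p x := eventually_all.2 (hlow q0)
      filter_upwards [hA, hw, ef, ev_one hQ] with p h1 h2 h3 hq x i j
      have hq0' : 0 < Q p := by linarith
      have hasq : ∀ k, a k p x ^ 2 = d q0 k p x := fun k => by
        refine Real.sq_sqrt (le_trans ?_ (h3 k x))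
        positivity
      have e1 := h2 x i j
      rw [h1 x i j, e1]
      have hp0 : ∀ i : Fin n, pder i (fun _ : Fin n → ℝ => (0:ℝ)) x = 0 := fun i => by simp [pder]
      simp only [hasq, hp0]
      have e2 : ∑ q : Fin J, (if r ≤ q then ∑ k, d q k p x * pr.ξ1 q k i * pr.ξ1 q k j else 0) =
          ∑ q : Fin J, (if r + 1 ≤ q then ∑ k, d q k p x * pr.ξ1 q k i * pr.ξ1 q k j else 0)
          + ∑ q : Fin J, (if q = q0 then ∑ k, d q k p x * pr.ξ1 q k i * pr.ξ1 q k j else 0) := by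
        rw [← Finset.sum_add_distrib]
        refine Finset.sum_congr rfl fun q _ => ?_
        rcases lt_trichotomy r q.1 with h | h | h
        · have : q ≠ q0 := fun h' => by simp [h', hq0] at h
          rw [if_pos h.le, if_pos (show r + 1 ≤ q.1 from h), if_neg this, add_zero]
        · have : q = q0 := Fin.ext (by simp [hq0, h])
          rw [if_pos h.le, if_neg (by omega), if_pos this, zero_add]
        · have : q ≠ q0 := fun h' => by simp [h', hq0] at h
          rw [if_neg (by omega), if_neg (by omega), if_neg this, add_zero]
      rw [e2, Finset.sum_ite_eq' Finset.univ q0]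
      simp only [Finset.mem_univ, if_true]
      linarith

end H3
end NK

namespace NK
open Filter Topology Metric MeasureTheory
open scoped ContDiff
section H4

variable {n J : ℕ} {F : Type} [NormedAddCommGroup F] [InnerProductSpace ℝ F]


theorem mol_le {G : Type} [NormedAddCommGroup G] [NormedSpace ℝ G] {r : ℝ} {h : (Fin n → ℝ) → G} (x) (M : ℝ)
    (hM : ∀ y, ‖h y‖ ≤ M) : ‖mol r h x‖ ≤ M := by
  calc _ ≤ ∫ t, mo n t * M := by
        refine norm_integral_le_of_norm_le ((mo_smooth.continuous.integrable_of_hasCompactSupport mo_cpt).mul_const _)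
          (Eventually.of_forall fun t => ?_)
        rw [norm_smul, Real.norm_of_nonneg (mo_nn t)]
        exact mul_le_mul_of_nonneg_left (hM _) (mo_nn t)
    _ = M := by rw [integral_mul_const, mo_int, one_mul]

theorem fd_pder {G : Type} [NormedAddCommGroup G] [NormedSpace ℝ G] {h : (Fin n → ℝ) → G} {x} {M : ℝ}
    (hM : ∀ i, ‖pder i h x‖ ≤ M) : ‖fderiv ℝ h x‖ ≤ n * M := by
  have hM0 : 0 ≤ n * M := by
    rcases Nat.eq_zero_or_pos n with h0 | h0
    · simp [h0]
    · have := (norm_nonneg _).trans (hM ⟨0, h0⟩)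
      positivity
  refine ContinuousLinearMap.opNorm_le_bound _ hM0 fun v => ?_
  have : v = ∑ i, v i • (Pi.single i 1 : Fin n → ℝ) := by
    ext j
    simp [Finset.sum_apply, Pi.single_apply]
  conv_lhs => rw [this, map_sum]
  refine (norm_sum_le _ _).trans ?_
  calc _ ≤ ∑ i : Fin n, M * ‖v‖ := by
        refine Finset.sum_le_sum fun i _ => ?_
        rw [map_smul, norm_smul, mul_comm]
        exact mul_le_mul (hM i) (norm_le_pi_norm v i) (norm_nonneg _) ((norm_nonneg _).trans (hM i))
    _ = _ := by simp; ring

theorem lip_pder {G : Type} [NormedAddCommGroup G] [NormedSpace ℝ G] {h : (Fin n → ℝ) → G} (hd : Differentiable ℝ h) {M : ℝ}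
    (hM : ∀ i x, ‖pder i h x‖ ≤ M) (x y) : ‖h x - h y‖ ≤ n * M * ‖x - y‖ :=
  Convex.norm_image_sub_le_of_norm_fderiv_le (fun x _ => hd x) (fun x _ => fd_pder fun i => hM i x) convex_univ
    (Set.mem_univ y) (Set.mem_univ x)

theorem r0_exists (pr : Prim n J) : ∃ r0 : ℝ, 0 < r0 ∧ ∀ M : Fin n → Fin n → ℝ, (∀ i j, |M i j - Hm n i j| ≤ 2 * r0) →
    (∀ k, r0 ≤ lin (pr.L0 k) M) ∧ ∀ r k, r0 ≤ lin (pr.L1 r k) M := by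
  have key : ∀ c : Fin n → Fin n → ℝ, 0 < lin c (Hm n) → ∀ᶠ r0 in 𝓝[>] (0:ℝ), ∀ M : Fin n → Fin n → ℝ,
      (∀ i j, |M i j - Hm n i j| ≤ 2 * r0) → r0 ≤ lin c M := by
    intro c hc
    have hcont : ContinuousAt (fun r : ℝ => r + (∑ i, ∑ j, |c i j|) * (2 * r)) 0 := by fun_prop
    have h1 := hcont.eventually (gt_mem_nhds (by simpa using hc))
    filter_upwards [nhdsWithin_le_nhds h1] with r hr M hM
    have : lin c (Hm n) - lin c M ≤ (∑ i, ∑ j, |c i j|) * (2 * r) := by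
      rw [lin, lin, ← Finset.sum_sub_distrib, Finset.sum_mul]
      refine Finset.sum_le_sum fun i _ => ?_
      rw [← Finset.sum_sub_distrib, Finset.sum_mul]
      refine Finset.sum_le_sum fun j _ => ?_
      rw [← mul_sub]
      refine (le_abs_self _).trans ?_
      rw [abs_mul, abs_sub_comm]
      exact mul_le_mul_of_nonneg_left (hM i j) (abs_nonneg _)
    linarith
  have e0 := eventually_all.2 fun k => key (pr.L0 k) (pr.pos0 k)
  have e1 := eventually_all.2 fun r => eventually_all.2 fun k => key (pr.L1 r k) (pr.pos1 r k)
  obtain ⟨r, hr, h0, h1⟩ := (eventually_mem_nhdsWithin.and (e0.and e1)).exists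
  exact ⟨r, hr, fun M hM => ⟨fun k => h0 k M hM, fun r k => h1 r k M hM⟩⟩

/-- admissible stage inputs -/
structure Good (m β r0 : ℝ) (K : Set (Fin (n + n) → F)) (q : ℝ) (u : (Fin n → ℝ) → F) (η : Fin n → (Fin n → ℝ) → F)
    (g : Fin n → Fin n → (Fin n → ℝ) → ℝ) : Prop where
  sm : ContDiff ℝ ∞ u
  eL : ∀ k x y, ‖η k x - η k y‖ ≤ ‖x - y‖
  gL : ∀ i j x y, ‖g i j x - g i j y‖ ≤ ‖x - y‖
  gs : ∀ i j x, g i j x = g j i x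
  dd : ∀ i j x, ‖pder j (pder i u) x‖ ≤ q ^ m
  er : ∀ i j x, |g i j x - (inner ℝ (pder i u x) (pder j u x)) - q ^ (-2 * β) * Hm n i j| ≤ r0 * q ^ (-2 * β)
  tK : ∀ x, tup u η x ∈ K

structure Par (J : ℕ) (b β s : ℝ) : Prop where
  hb : 1 < b
  hβ : 0 < β
  hs : 0 < s
  h1 : (3 + J) * s ≤ (b - 1) * (1 - β * (1 + 2 * J))
  h2 : 2 * β * b + s ≤ 3 * β
  h3 : 2 * β * b < 1

theorem lip_cont {G : Type} [NormedAddCommGroup G] {h : (Fin n → ℝ) → G} {C : ℝ} (hC : 0 ≤ C)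
    (hh : ∀ x y, ‖h x - h y‖ ≤ C * ‖x - y‖) : Continuous h := by
  refine (LipschitzWith.of_dist_le_mul (K := ⟨C, hC⟩) fun x y => ?_).continuous
  rw [dist_eq_norm, dist_eq_norm]
  exact hh x y

theorem tup_bd {K : Set (Fin (n + n) → F)} (hK : IsCompact K) : ∃ C : ℝ, 0 ≤ C ∧ ∀ (u : (Fin n → ℝ) → F)
    (η : Fin n → (Fin n → ℝ) → F) (x), tup u η x ∈ K → (∀ i, ‖pder i u x‖ ≤ C) ∧ ∀ k, ‖η k x‖ ≤ C := by
  obtain ⟨C, hC⟩ := hK.isBounded.exists_norm_le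
  refine ⟨max C 0, le_max_right _ _, fun u η x h => ⟨fun i => ?_, fun k => ?_⟩⟩
  · have := (norm_le_pi_norm (tup u η x) (Fin.castAdd n i)).trans (hC _ h)
    rw [tup, Fin.append_left] at this
    exact this.trans (le_max_left _ _)
  · have := (norm_le_pi_norm (tup u η x) (Fin.natAdd n k)).trans (hC _ h)
    rw [tup, Fin.append_right] at this
    exact this.trans (le_max_left _ _)

end H4
end NK

namespace NK
open Filter Topology Metric MeasureTheory
open scoped ContDiff
section H5

variable {P : Type} {n J : ℕ} {F : Type} [NormedAddCommGroup F] [InnerProductSpace ℝ F] [FiniteDimensional ℝ F]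
variable {l : Filter P} {Q : P → ℝ} {m μ β s b r0 : ℝ}
variable {u : P → (Fin n → ℝ) → F} {η : Fin n → P → (Fin n → ℝ) → F} {g : Fin n → Fin n → P → (Fin n → ℝ) → ℝ}


theorem Good.pder_mol {q r : ℝ} {u : (Fin n → ℝ) → F} {η : Fin n → (Fin n → ℝ) → F}
    {g : Fin n → Fin n → (Fin n → ℝ) → ℝ} {K : Set (Fin (n + n) → F)} (hK : IsCompact K) (h : Good m β r0 K q u η g) :
    (∀ i, pder i (mol r u) = mol r (pder i u)) ∧ ∀ i j, pder j (pder i (mol r u)) = mol r (pder j (pder i u)) := by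
  obtain ⟨C, hC, hCK⟩ := tup_bd hK
  have h1 : ∀ i, pder i (mol r u) = mol r (pder i u) := fun i => by
    ext1 x
    exact mol_pder (h.sm.of_le (nn 1 le_rfl)) (fun x => fd_pder (hCK u η x (h.tK x)).1) i x
  refine ⟨h1, fun i j => ?_⟩
  ext1 x
  rw [h1 i]
  exact mol_pder ((sm_pder h.sm i).of_le (nn 1 le_rfl)) (fun x => fd_pder fun j => h.dd i j x) j x

theorem Dstuff (hQ : Tendsto Q l atTop) {K : Set (Fin (n + n) → F)} (hK : IsCompact K) (hβ : 0 < β) (hs : 0 < s) (hr0 : 0 < r0)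
    (hμ : μ = m + β + s) {γ : ℝ} (hγ : β < γ)
    (hG : ∀ᶠ p in l, Good m β r0 K (Q p) (u p) (fun k => η k p) (fun i j => g i j p)) (i j : Fin n) :
    Sy l Q (-2 * β) μ (fun p x => mol (Q p ^ (-μ)) (g i j p) x
      - (inner ℝ (pder i (mol (Q p ^ (-μ)) (u p)) x) (pder j (mol (Q p ^ (-μ)) (u p)) x)) - Q p ^ (-2 * γ) * Hm n i j) ∧
    ∀ᶠ p in l, ∀ x, |mol (Q p ^ (-μ)) (g i j p) x
      - (inner ℝ (pder i (mol (Q p ^ (-μ)) (u p)) x) (pder j (mol (Q p ^ (-μ)) (u p)) x)) - Q p ^ (-2 * γ) * Hm n i j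
        - Q p ^ (-2 * β) * Hm n i j| ≤ 2 * r0 * Q p ^ (-2 * β) := by
  have E1 : Sy l Q (-2 * β) μ (fun p x => mol (Q p ^ (-μ)) (fun x => g i j p x - (inner ℝ (pder i (u p) x) (pder j (u p) x))
      - Q p ^ (-2 * β) * Hm n i j) x) := by
    refine Sy.mol hQ ?_ hr0.le ?_
    · filter_upwards [hG] with p h
      have := lip_cont (h := g i j p) zero_le_one (by simpa using h.gL i j)
      have := (sm_pder h.sm i).continuous
      have := (sm_pder h.sm j).continuous
      fun_prop
    · filter_upwards [hG] with p h x using h.er i j x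
  have hlip : ∀ i, ∀ᶠ p in l, ∀ x y, ‖pder i (u p) x - pder i (u p) y‖ ≤ n * Q p ^ m * ‖x - y‖ := fun i => by
    filter_upwards [hG] with p h
    exact lip_pder (fun x => sm_diff (sm_pder h.sm i) x) fun j x => h.dd i j x
  have hcon : ∀ i, ∀ᶠ p in l, Continuous (pder i (u p)) := fun i => by
    filter_upwards [hG] with p h using (sm_pder h.sm i).continuous
  have E2 := Sy.molcomm (μ := μ) hQ (Nat.cast_nonneg n) (hcon i) (hcon j) (hlip i) (hlip j)
  have E3 : Sy l Q (-2 * γ) μ (fun p (x : Fin n → ℝ) => Q p ^ (-2 * γ) * Hm n i j) := (Sy.pow hQ).mul_const _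
  have E4 : Sy l Q (-2 * β) μ (fun p (x : Fin n → ℝ) => Q p ^ (-2 * β) * Hm n i j) := (Sy.pow hQ).mul_const _
  have eq : ∀ᶠ p in l, ∀ x, mol (Q p ^ (-μ)) (g i j p) x
      - (inner ℝ (pder i (mol (Q p ^ (-μ)) (u p)) x) (pder j (mol (Q p ^ (-μ)) (u p)) x)) - Q p ^ (-2 * γ) * Hm n i j =
      mol (Q p ^ (-μ)) (fun x => g i j p x - (inner ℝ (pder i (u p) x) (pder j (u p) x)) - Q p ^ (-2 * β) * Hm n i j) x
      + (mol (Q p ^ (-μ)) (fun z => (inner ℝ (pder i (u p) z) (pder j (u p) z))) x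
      - (inner ℝ (mol (Q p ^ (-μ)) (pder i (u p)) x) (mol (Q p ^ (-μ)) (pder j (u p)) x)))
      + Q p ^ (-2 * β) * Hm n i j - Q p ^ (-2 * γ) * Hm n i j := by
    filter_upwards [hG] with p h x
    have c1 := lip_cont (h := g i j p) zero_le_one (by simpa using h.gL i j)
    have c2 := (sm_pder h.sm i).continuous
    have c3 := (sm_pder h.sm j).continuous
    rw [mol_sub (h := fun x => g i j p x - (inner ℝ (pder i (u p) x) (pder j (u p) x))) (by fun_prop) continuous_const, mol_const,
      mol_sub c1 (by fun_prop), (h.pder_mol hK).1, (h.pder_mol hK).1]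
    ring
  refine ⟨(((E1.add (E2.mono hQ ?_ le_rfl)).add E4).sub (E3.mono hQ (by linarith) le_rfl)).congr eq, ?_⟩
  · rw [hμ]; linarith
  · filter_upwards [eq, E2.small hQ (show _ < -2 * β by rw [hμ]; linarith) (half_pos hr0),
      E3.small hQ (show _ < -2 * β by linarith) (half_pos hr0), hG] with p h1 h2 h3 h4 x
    rw [h1 x]
    have a1 : |mol (Q p ^ (-μ)) (fun x => g i j p x - (inner ℝ (pder i (u p) x) (pder j (u p) x)) - Q p ^ (-2 * β) * Hm n i j) x|
      ≤ r0 * Q p ^ (-2 * β) := by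
      rw [← Real.norm_eq_abs]
      exact mol_le x _ fun x => h4.er i j x
    have a2 := h2 x
    have a3 := h3 x
    rw [Real.norm_eq_abs, abs_le] at a2 a3
    rw [abs_le] at a1 ⊢
    constructor <;> linarith

theorem stage0 (hQ : Tendsto Q l atTop) (pr : Prim n J) (pa : Par J b β s) (hr0 : 0 < r0)
    (hr : ∀ M : Fin n → Fin n → ℝ, (∀ i j, |M i j - Hm n i j| ≤ 2 * r0) →
      (∀ k, r0 ≤ lin (pr.L0 k) M) ∧ ∀ r k, r0 ≤ lin (pr.L1 r k) M) {K : Set (Fin (n + n) → F)} (hK : IsCompact K)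
    (hKL : K ⊆ LI (n + n) F) (hm : m = 1 - β / b + s)
    (hG : ∀ᶠ p in l, Good m β r0 K (Q p) (u p) (fun k => η k p) (fun i j => g i j p)) :
    ∃ v : P → (Fin n → ℝ) → F, ∀ᶠ p in l, ContDiff ℝ ∞ (v p) ∧
      (∀ i j x, ‖pder j (pder i (v p)) x‖ ≤ Q p ^ (b * m)) ∧
      (∀ i j x, |g i j p x - (inner ℝ (pder i (v p) x) (pder j (v p) x)) - Q p ^ (-2 * (b * β)) * Hm n i j|
        ≤ r0 * Q p ^ (-2 * (b * β))) ∧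
      (∀ i x, ‖pder i (v p) x - pder i (u p) x‖ ≤ Q p ^ (-β + s)) ∧
      ∀ x, ‖v p x - u p x‖ ≤ Q p ^ (-β + s) := by
  obtain ⟨hb, hβ, hs, p1, p2, p3⟩ := pa
  have hb0 : 0 < b := by linarith
  obtain ⟨μ, hμ⟩ : ∃ μ, μ = m + β + s := ⟨_, rfl⟩
  obtain ⟨L, hL⟩ : ∃ L, L = μ + s := ⟨_, rfl⟩
  obtain ⟨κ, hκ⟩ : ∃ κ, κ = 2 * β * (b - 1) + s := ⟨_, rfl⟩
  have hβb : β / b < β := div_lt_self hβ hb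
  have hbm : b * m = b - β + b * s := by rw [hm]; field_simp
  have hbs : 0 < b * s := by positivity
  have hbβ : 0 < (b - 1) * β := mul_pos (by linarith) hβ
  have hdb : β - β / b ≤ (b - 1) * β := by
    have : β - β / b = (b - 1) * (β / b) := by field_simp
    rw [this]
    exact mul_le_mul_of_nonneg_left hβb.le (by linarith)
  have hm0 : 0 < m := by
    have : β < 1 := by nlinarith
    rw [hm]; linarith
  have hlast : L + J * κ ≤ b := by
    rw [hL, hκ, hμ, hm]; linarith
  have hJκ : 0 ≤ J * κ := by
    have : 0 < κ := by rw [hκ]; linarith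
    positivity
  -- compact sets
  obtain ⟨ε, hε, hεK⟩ := hK.exists_cthickening_subset_open LI_open hKL
  set ε' := ε / 2 with hε'
  have hε'0 : 0 < ε' := half_pos hε
  have hK1 : IsCompact (cthickening ε' K) := hK.cthickening
  have hK1L : cthickening ε' (cthickening ε' K) ⊆ LI (n + n) F :=
    (cthickening_cthickening_subset hε'0.le hε'0.le K).trans (by rwa [hε', add_halves])
  obtain ⟨C, hC, hCK⟩ := tup_bd hK
  -- mollification
  set U : P → (Fin n → ℝ) → F := fun p => mol (Q p ^ (-μ)) (u p) with hU
  set ηl : Fin n → P → (Fin n → ℝ) → F := fun k p => mol (Q p ^ (-μ)) (η k p) with hηl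
  have hUsm : ∀ᶠ p in l, ContDiff ℝ ∞ (U p) := by
    filter_upwards [hG, ev_one hQ] with p h hq
    exact mol_smooth (by positivity) h.sm.continuous
  have du : ∀ i, Sy l Q 0 μ (fun p => pder i (U p)) := fun i => by
    refine (Sy.mol (f := fun p => pder i (u p)) (μ := μ) (α := 0) hQ ?_ hC ?_).congr ?_
    · filter_upwards [hG] with p h using (sm_pder h.sm i).continuous
    · filter_upwards [hG] with p h x
      simpa using (hCK _ _ x (h.tK x)).1 i
    · filter_upwards [hG] with p h x
      rw [hU, (h.pder_mol hK).1]
  have ddu0 : ∀ i j, Sy l Q m μ (fun p => pder j (pder i (U p))) := fun i j => by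
    refine (Sy.mol (f := fun p => pder j (pder i (u p))) (μ := μ) (α := m) hQ ?_ zero_le_one ?_).congr ?_
    · filter_upwards [hG] with p h using (sm_pder (sm_pder h.sm i) j).continuous
    · filter_upwards [hG] with p h x
      simpa using h.dd i j x
    · filter_upwards [hG] with p h x
      rw [hU, (h.pder_mol hK).2]
  have ddu : ∀ i j, Sy l Q (-β + μ) μ (fun p => pder j (pder i (U p))) := fun i j =>
    (ddu0 i j).mono hQ (by rw [hμ]; linarith) le_rfl
  have he : ∀ k, Sy l Q 0 μ (ηl k) := fun k => by
    refine (Sy.mol (f := fun p => η k p) (μ := μ) (α := 0) hQ ?_ hC ?_)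
    · filter_upwards [hG] with p h using lip_cont zero_le_one (by simpa using h.eL k)
    · filter_upwards [hG] with p h x
      simpa using (hCK _ _ x (h.tK x)).2 k
  have e1 : ∀ᶠ p in l, ∀ i x, ‖pder i (U p) x - pder i (u p) x‖ ≤ n * Q p ^ (-β - s) := by
    filter_upwards [hG, ev_one hQ] with p h hq i x
    have h0 : 0 < Q p := by linarith
    rw [hU, (h.pder_mol hK).1]
    refine (mol_near_lip (by positivity) (sm_pder h.sm i).continuous (L := n * Q p ^ m) (by positivity)
      (lip_pder (fun x => sm_diff (sm_pder h.sm i) x) fun j x => h.dd i j x) x).trans_eq ?_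
    rw [mul_assoc, ← Real.rpow_add h0, hμ]
    congr 2; ring
  have e0 : ∀ᶠ p in l, ∀ x, ‖U p x - u p x‖ ≤ n * C * Q p ^ (-μ) := by
    filter_upwards [hG, ev_one hQ] with p h hq x
    exact mol_near_lip (by positivity) h.sm.continuous (L := n * C) (by positivity)
      (lip_pder (fun x => sm_diff h.sm x) fun j x => (hCK _ _ x (h.tK x)).1 j) x
  have hμ1 : 1 < μ := by rw [hμ, hm]; linarith
  have hfK : ∀ᶠ p in l, ∀ x, tup (U p) (fun k => ηl k p) x ∈ cthickening ε' K := by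
    filter_upwards [hG, e1, ev_absorb hQ (n:ℝ) hε'0 (show -β - s < 0 by linarith), ev_one hQ,
      ev_absorb hQ 1 hε'0 (show -μ < 0 by linarith)] with p h h1 h2 hq h3 x
    simp only [Real.rpow_zero, mul_one, one_mul] at h2 h3
    refine tup_near hε'0.le (h.tK x) (fun i => (h1 i x).trans h2) fun k => ?_
    have := mol_near_lip (r := Q p ^ (-μ)) (by positivity) (lip_cont (h := η k p) zero_le_one (by simpa using h.eL k)) zero_le_one
      (by simpa using h.eL k) x
    exact this.trans (by linarith)
  -- D
  have hD := fun i j => Dstuff (γ := b * β) hQ hK hβ hs hr0 hμ (by linarith) hG i j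
  set D : Fin n → Fin n → P → (Fin n → ℝ) → ℝ := fun i j p x => mol (Q p ^ (-μ)) (g i j p) x
      - (inner ℝ (pder i (U p) x) (pder j (U p) x)) - Q p ^ (-2 * (b * β)) * Hm n i j with hDd
  have hDs : ∀ᶠ p in l, ∀ x i j, D i j p x = D j i p x := by
    filter_upwards [hG] with p h x i j
    have : g i j p = g j i p := funext fun x => h.gs i j x
    simp only [hDd, this, real_inner_comm, Hm, eq_comm]
  have hDM : ∀ᶠ p in l, ∀ x, (∀ k, r0 * Q p ^ (-2 * β) ≤ lin (pr.L0 k) (fun i j => D i j p x)) ∧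
      ∀ r k, r0 * Q p ^ (-2 * β) ≤ lin (pr.L1 r k) (fun i j => D i j p x) := by
    have := eventually_all.2 fun i => eventually_all.2 fun j => (hD i j).2
    filter_upwards [this, ev_one hQ] with p h hq x
    have hq0 : 0 < Q p ^ (-2 * β) := by positivity
    have h1 := hr (fun i j => D i j p x / Q p ^ (-2 * β)) fun i j => by
      have h2 := h i j x
      have : D i j p x / Q p ^ (-2 * β) - Hm n i j = (D i j p x - Q p ^ (-2 * β) * Hm n i j) / Q p ^ (-2 * β) := by
        field_simp
      rw [this, abs_div, abs_of_pos hq0, div_le_iff₀ hq0]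
      exact h2
    have hl : ∀ c : Fin n → Fin n → ℝ, lin c (fun i j => D i j p x / Q p ^ (-2 * β)) = lin c (fun i j => D i j p x) / Q p ^ (-2 * β) := by
      intro c
      simp only [lin, Finset.sum_div, mul_div_assoc]
    simp only [hl, le_div_iff₀ hq0] at h1
    exact h1
  have hCl0 : Cl l Q μ β U U := ⟨hUsm, by simpa using Sy.zero, fun i => by simpa using Sy.zero, fun i j => by simpa using Sy.zero⟩
  obtain ⟨ζ, T, hF⟩ := hCl0.fr hQ hβ le_rfl du ddu he hK1 hε'0 hK1L hfK
  obtain ⟨w, d, hw, hd, hdlow, R, hR, hwR⟩ := freeStep (L := L) hQ pr (by linarith) hβ.le hF (fun i j => (hD i j).1) hDs hr0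
    (fun k => hDM.mono fun p h x => (h x).1 k) (fun r k => hDM.mono fun p h x => (h x).2 r k)
  have hCl1 : Cl l Q L β U w := hCl0.step hQ (by linarith) (by linarith) hw
  obtain ⟨v, R', hv, hR', hvR⟩ := chain (κ := κ) (L := L) (A := fun i j p x => (inner ℝ (pder i (U p) x) (pder j (U p) x)) + D i j p x)
    hQ pr hβ (by rw [hκ]; linarith) (by rw [hκ]; linarith) (by linarith) (by linarith) du ddu he
    hK1 hε'0 hK1L hfK hd (half_pos hr0) hdlow
    ⟨w, R, hCl1, fun i j => (hR i j).mono hQ (by rw [hκ]; linarith) le_rfl, hwR⟩ J le_rfl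
  refine ⟨v, ?_⟩
  have f2 : ∀ᶠ p in l, ∀ i j x, ‖pder j (pder i (v p)) x‖ ≤ Q p ^ (b * m) := by
    refine eventually_all.2 fun i => eventually_all.2 fun j => ?_
    have : Sy l Q (-β + b) (L + J * κ) (fun p => pder j (pder i (v p))) :=
      (((hv.c2 i j).mono hQ (by linarith) le_rfl).add ((ddu0 i j).mono hQ (by linarith) (by linarith))).congr
        (Eventually.of_forall fun p x => by abel)
    filter_upwards [this.small hQ (show -β + b < b * m by rw [hbm]; linarith) one_pos] with p h x
    simpa using h x
  have f3 : ∀ᶠ p in l, ∀ i j x, |R' i j p x| ≤ r0 / 2 * Q p ^ (-2 * (b * β)) :=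
    eventually_all.2 fun i => eventually_all.2 fun j => (hR' i j).small hQ (by rw [hκ]; linarith) (half_pos hr0)
  have f4 : ∀ᶠ p in l, ∀ i x, ‖pder i (v p) x - pder i (U p) x‖ ≤ 1 / 2 * Q p ^ (-β + s) :=
    eventually_all.2 fun i => (hv.c1 i).small hQ (by linarith) (by norm_num)
  have f5 : ∀ᶠ p in l, ∀ x, ‖v p x - U p x‖ ≤ 1 / 2 * Q p ^ (-β + s) :=
    hv.c0.small hQ (by linarith) (by norm_num)
  filter_upwards [hv.sm, f2, f3, f4, f5, hvR, e0, e1, hG, ev_one hQ, ev_absorb hQ (n:ℝ) (half_pos one_pos) (show -β - s < -β + s by linarith),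
    ev_absorb hQ (n * C) (half_pos one_pos) (show -μ < -β + s by linarith),
    ev_absorb hQ 1 (half_pos hr0) (show -μ < -2 * (b * β) by linarith)] with p a1 a2 a3 a4 a5 a6 a7 a8 hg hq a9 a10 a11
  refine ⟨a1, a2, fun i j x => ?_, fun i x => ?_, fun x => ?_⟩
  · have h1 := a6 x i j
    have h2 : ∑ q : Fin J, (if J ≤ q.1 then ∑ k, d q k p x * pr.ξ1 q k i * pr.ξ1 q k j else 0) = 0 :=
      Finset.sum_eq_zero fun q _ => if_neg (by omega)
    rw [h2] at h1
    have h3 := a3 i j x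
    have h4 := mol_near_lip (r := Q p ^ (-μ)) (by positivity) (lip_cont (h := g i j p) zero_le_one (by simpa using hg.gL i j)) zero_le_one
      (by simpa using hg.gL i j) x
    rw [Real.norm_eq_abs] at h4
    simp only [hDd] at h1
    rw [abs_le] at h3 h4 ⊢
    constructor <;> linarith
  · calc _ = ‖(pder i (v p) x - pder i (U p) x) + (pder i (U p) x - pder i (u p) x)‖ := by congr 1; abel
      _ ≤ _ := (norm_add_le _ _).trans (by have := a4 i x; have := a8 i x; linarith)
  · calc _ = ‖(v p x - U p x) + (U p x - u p x)‖ := by congr 1; abel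
      _ ≤ _ := (norm_add_le _ _).trans (by have := a5 x; have := a7 x; linarith)

end H5
end NK

namespace NK
open Filter Topology Metric MeasureTheory
open scoped ContDiff
section I1

variable {n J : ℕ} {F : Type} [NormedAddCommGroup F] [InnerProductSpace ℝ F] [FiniteDimensional ℝ F]


theorem lim_seq {u : ℕ → (Fin n → ℝ) → F} (sm : ∀ k, ContDiff ℝ ∞ (u k)) {ε : ℝ}
    (h0 : ∀ k x, ‖u (k + 1) x - u k x‖ ≤ ε / 2 / 2 ^ k)
    (h1 : ∀ k i x, ‖pder i (u (k + 1)) x - pder i (u k) x‖ ≤ ε / 2 / 2 ^ k) :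
    ∃ v : (Fin n → ℝ) → F, ContDiff ℝ 1 v ∧
      (∀ i x, Tendsto (fun k => pder i (u k) x) atTop (𝓝 (pder i v x))) ∧ ∀ x, ‖v x - u 0 x‖ ≤ ε := by
  have d0 : ∀ x k, dist (u k x) (u (k + 1) x) ≤ ε / 2 / 2 ^ k := fun x k => by
    rw [dist_comm, dist_eq_norm]; exact h0 k x
  have d1 : ∀ x k, dist (fderiv ℝ (u k) x) (fderiv ℝ (u (k + 1)) x) ≤ (n * ε) / 2 / 2 ^ k := fun x k => by
    rw [dist_comm, dist_eq_norm, ← fderiv_fun_sub (sm_diff (sm _) x) (sm_diff (sm _) x)]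
    refine (fd_pder (M := ε / 2 / 2 ^ k) fun i => ?_).trans_eq (by ring)
    rw [pder_sub' i (sm_diff (sm _) x) (sm_diff (sm _) x)]
    exact h1 k i x
  have c0 := fun x => cauchySeq_tendsto_of_complete (cauchySeq_of_le_geometric_two (d0 x))
  have c1 := fun x => cauchySeq_tendsto_of_complete (cauchySeq_of_le_geometric_two (d1 x))
  choose v hv using c0
  choose v' hv' using c1
  have hu : TendstoUniformly (fun k => fderiv ℝ (u k)) v' atTop := by
    rw [Metric.tendstoUniformly_iff]
    intro r hr
    have : Tendsto (fun k : ℕ => n * ε / 2 ^ k) atTop (𝓝 0) := by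
      have := (tendsto_pow_atTop_nhds_zero_of_lt_one (r := (1/2:ℝ)) (by norm_num) (by norm_num)).const_mul (n * ε)
      simpa [div_eq_mul_inv] using this
    filter_upwards [this.eventually (gt_mem_nhds hr)] with k hk x
    rw [dist_comm]
    exact (dist_le_of_le_geometric_two_of_tendsto (d1 x) (hv' x) k).trans_lt hk
  have hd := hasFDerivAt_of_tendstoUniformly hu (fun k x => (sm_diff (sm k) x).hasFDerivAt) hv
  have hf : fderiv ℝ v = v' := funext fun x => (hd x).fderiv
  refine ⟨v, contDiff_one_iff_fderiv.2 ⟨fun x => (hd x).differentiableAt, ?_⟩, fun i x => ?_, fun x => ?_⟩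
  · rw [hf]
    exact hu.continuous (Eventually.of_forall fun k => (sm k).continuous_fderiv (by simp)).frequently
  · rw [pder, hf]
    have := ((ContinuousLinearMap.apply ℝ F (Pi.single i 1 : Fin n → ℝ)).continuous.tendsto (v' x)).comp (hv' x)
    exact this
  · have := dist_le_of_le_geometric_two_of_tendsto (d0 x) (hv x) 0
    rw [dist_comm, dist_eq_norm] at this
    simpa using this

theorem stage (pr : Prim n J) {b β s r0 m : ℝ} (pa : Par J b β s) (hr0 : 0 < r0)
    (hr : ∀ M : Fin n → Fin n → ℝ, (∀ i j, |M i j - Hm n i j| ≤ 2 * r0) →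
      (∀ k, r0 ≤ lin (pr.L0 k) M) ∧ ∀ r k, r0 ≤ lin (pr.L1 r k) M) {K : Set (Fin (n + n) → F)} (hK : IsCompact K)
    (hKL : K ⊆ LI (n + n) F) (hm : m = 1 - β / b + s) :
    ∃ Q0 : ℝ, ∀ q, Q0 ≤ q → ∀ u η g, Good m β r0 K q u η g → ∃ v : (Fin n → ℝ) → F, ContDiff ℝ ∞ v ∧
      (∀ i j x, ‖pder j (pder i v) x‖ ≤ q ^ (b * m)) ∧
      (∀ i j x, |g i j x - (inner ℝ (pder i v x) (pder j v x)) - q ^ (-2 * (b * β)) * Hm n i j|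
        ≤ r0 * q ^ (-2 * (b * β))) ∧
      (∀ i x, ‖pder i v x - pder i u x‖ ≤ q ^ (-β + s)) ∧
      ∀ x, ‖v x - u x‖ ≤ q ^ (-β + s) := by
  let P : Type := ℝ × ((Fin n → ℝ) → F) × (Fin n → (Fin n → ℝ) → F) × (Fin n → Fin n → (Fin n → ℝ) → ℝ)
  let l : Filter P := comap (fun p => p.1) atTop ⊓ 𝓟 {p | Good m β r0 K p.1 p.2.1 p.2.2.1 p.2.2.2}
  have hQ : Tendsto (fun p : P => p.1) l atTop := tendsto_comap.mono_left inf_le_left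
  obtain ⟨v, hv⟩ := stage0 (l := l) (u := fun p => p.2.1) (η := fun k p => p.2.2.1 k) (g := fun i j p => p.2.2.2 i j)
    hQ pr pa hr0 hr hK hKL hm (mem_inf_of_right (mem_principal_self _))
  rw [eventually_inf_principal, eventually_comap, eventually_atTop] at hv
  obtain ⟨Q0, h⟩ := hv
  exact ⟨Q0, fun q hq u η g hg => ⟨v (q, u, η, g), h q hq (q, u, η, g) rfl hg⟩⟩

theorem interp {A B d θ : ℝ} (hA : 0 ≤ A) (hB : 0 ≤ B) (hd : 0 ≤ d) (h0 : 0 ≤ θ) (h1 : θ ≤ 1) {t : ℝ} (ht : 0 ≤ t) (hta : t ≤ A)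
    (htb : t ≤ B * d) : t ≤ A ^ (1 - θ) * B ^ θ * d ^ θ := by
  calc t = t ^ (1 - θ) * t ^ θ := by
        rcases eq_or_lt_of_le ht with h | h
        · rw [← h]
          rcases eq_or_ne θ 0 with h2 | h2
          · simp [h2]
          · rw [Real.zero_rpow h2, mul_zero]
        · rw [← Real.rpow_add h]; simp
    _ ≤ A ^ (1 - θ) * (B * d) ^ θ := by
        have : 0 ≤ 1 - θ := by linarith
        gcongr
    _ = _ := by rw [Real.mul_rpow hB hd]; ring

end I1
end NK

namespace NK
open Filter Topology Metric MeasureTheory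
open scoped ContDiff
section I2

variable {n J : ℕ} {F : Type} [NormedAddCommGroup F] [InnerProductSpace ℝ F] [FiniteDimensional ℝ F]


theorem iter_small {b γ ε : ℝ} (hb : 1 < b) (hγ : 0 < γ) (hε : 0 < ε) : ∃ Q1 : ℝ, 1 ≤ Q1 ∧ ∀ q, Q1 ≤ q → ∀ k : ℕ,
    (q ^ (b ^ k : ℝ)) ^ (-γ) ≤ ε / 2 / 2 ^ k := by
  have hb1 : 0 < γ * (b - 1) := mul_pos hγ (by linarith)
  have t1 := (tendsto_rpow_neg_atTop hγ).eventually (gt_mem_nhds (half_pos hε))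
  have t2 := (tendsto_rpow_neg_atTop hb1).eventually (gt_mem_nhds (show (0:ℝ) < 1 / 2 by norm_num))
  obtain ⟨Q1, h⟩ := eventually_atTop.1 ((t1.and t2).and (eventually_ge_atTop (1:ℝ)))
  refine ⟨max Q1 1, le_max_right _ _, fun q hq k => ?_⟩
  obtain ⟨⟨h1, h2⟩, h3⟩ := h q ((le_max_left _ _).trans hq)
  have hq0 : 0 < q := by linarith
  have hbern : 1 + k * (b - 1) ≤ b ^ k := by
    have := one_add_mul_le_pow (show (-2:ℝ) ≤ b - 1 by linarith) k
    simpa using this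
  rw [← Real.rpow_mul hq0.le]
  calc q ^ (b ^ k * -γ) ≤ q ^ (-γ + -(γ * (b - 1)) * k) := by
        refine Real.rpow_le_rpow_of_exponent_le h3 ?_
        nlinarith
    _ = q ^ (-γ) * (q ^ (-(γ * (b - 1)))) ^ k := by
        rw [Real.rpow_add hq0, Real.rpow_mul hq0.le, Real.rpow_natCast]
    _ ≤ ε / 2 * (1 / 2) ^ k := by gcongr
    _ = _ := by rw [one_div, inv_pow]; rfl

theorem iterate (pr : Prim n J) {b β s r0 m : ℝ} (pa : Par J b β s) (hr0 : 0 < r0)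
    (hr : ∀ M : Fin n → Fin n → ℝ, (∀ i j, |M i j - Hm n i j| ≤ 2 * r0) →
      (∀ k, r0 ≤ lin (pr.L0 k) M) ∧ ∀ r k, r0 ≤ lin (pr.L1 r k) M) {K : Set (Fin (n + n) → F)} (hK : IsCompact K)
    (hKL : K ⊆ LI (n + n) F) (hm : m = 1 - β / b + s) {θ : ℝ} (hθ0 : 0 < θ) (hθ1 : θ ≤ 1)
    (hθ : θ * (b + (b - 1) * s) < β - s) {e : ℝ} (he : 0 < e) :
    ∃ Q1 : ℝ, ∀ q, Q1 ≤ q → ∀ u η g, Good m β r0 K q u η g → ∃ v : (Fin n → ℝ) → F, ContDiff ℝ 1 v ∧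
      (∀ i j x, (inner ℝ (pder i v x) (pder j v x)) = g i j x) ∧
      (∃ C, ∀ i x y, ‖pder i v x - pder i v y‖ ≤ C * ‖x - y‖ ^ θ) ∧ ∀ x, ‖v x - u x‖ ≤ e := by
  have hb := pa.hb
  have hβ := pa.hβ
  have hs := pa.hs
  obtain ⟨ε0, hε0, hεK⟩ := hK.exists_cthickening_subset_open LI_open hKL
  obtain ⟨ε, hε⟩ : ∃ ε, ε = min ε0 e := ⟨_, rfl⟩
  have hεp : 0 < ε := by rw [hε]; exact lt_min hε0 he
  have hK' : IsCompact (cthickening ε K) := hK.cthickening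
  have hK'L : cthickening ε K ⊆ LI (n + n) F := (cthickening_mono (hε ▸ min_le_left _ _) K).trans hεK
  obtain ⟨Q0, hst⟩ := stage pr pa hr0 hr hK' hK'L hm
  obtain ⟨γ, hγ⟩ : ∃ γ, γ = β - s - θ * (b + (b - 1) * s) := ⟨_, rfl⟩
  have hγ0 : 0 < γ := by rw [hγ]; linarith
  have hγβ : -β + s ≤ -γ := by
    have : 0 ≤ θ * (b + (b - 1) * s) := by
      have : 0 < b - 1 := by linarith
      positivity
    rw [hγ]; linarith
  obtain ⟨Q1, hQ1, hsm⟩ := iter_small hb hγ0 hεp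
  obtain ⟨C, hC, hCK⟩ := tup_bd hK
  have hm0 : 0 ≤ m := by
    have : β / b < β := div_lt_self hβ hb
    have : β < 1 := by nlinarith [pa.h3]
    rw [hm]; linarith
  have hbm : b * m = b - β + b * s := by rw [hm]; field_simp
  refine ⟨max (max Q0 2) Q1, fun q hq u η g hG => ?_⟩
  have hq1 : 1 ≤ q := hQ1.trans ((le_max_right _ _).trans hq)
  have hq0 : Q0 ≤ q := ((le_max_left _ _).trans (le_max_left _ _)).trans hq
  have hqp : 0 < q := by linarith
  have hsm := hsm q ((le_max_right _ _).trans hq)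
  set qk : ℕ → ℝ := fun k => q ^ (b ^ k : ℝ) with hqk
  have hqkq : ∀ k, q ≤ qk k := fun k => by
    have : q ^ (1:ℝ) ≤ q ^ (b ^ k : ℝ) := Real.rpow_le_rpow_of_exponent_le hq1 (one_le_pow₀ hb.le)
    simpa using this
  have hqk1 : ∀ k, 1 ≤ qk k := fun k => hq1.trans (hqkq k)
  have hqkp : ∀ k, 0 < qk k := fun k => by linarith [hqk1 k]
  have hqks : ∀ k, qk (k + 1) = qk k ^ b := fun k => by
    simp only [hqk]
    rw [← Real.rpow_mul hqp.le, pow_succ]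
  have hpw : ∀ k t, qk (k + 1) ^ t = qk k ^ (b * t) := fun k t => by
    rw [hqks, ← Real.rpow_mul (hqkp k).le]
  let Inv : ℕ → ((Fin n → ℝ) → F) → Prop := fun k v => Good m β r0 (cthickening ε K) (qk k) v η g ∧
    ∀ i x, ‖pder i v x - pder i u x‖ ≤ ε * (1 - 1 / 2 ^ k)
  have hbase : Inv 0 u := by
    refine ⟨?_, by simp⟩
    have : qk 0 = q := by simp [hqk]
    rw [this]
    exact ⟨hG.sm, hG.eL, hG.gL, hG.gs, hG.dd, hG.er, fun x => self_subset_cthickening K (hG.tK x)⟩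
  have hstep : ∀ k v, Inv k v → ∃ w, Inv (k + 1) w ∧ (∀ i x, ‖pder i w x - pder i v x‖ ≤ qk k ^ (-β + s)) ∧
      ∀ x, ‖w x - v x‖ ≤ qk k ^ (-β + s) := by
    intro k v ⟨hv, hv2⟩
    obtain ⟨w, w1, w2, w3, w4, w5⟩ := hst (qk k) (hq0.trans (hqkq k)) v η g hv
    have hw : ∀ i x, ‖pder i w x - pder i u x‖ ≤ ε * (1 - 1 / 2 ^ (k + 1)) := fun i x => by
      have h1 : qk k ^ (-β + s) ≤ ε / 2 / 2 ^ k :=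
        (Real.rpow_le_rpow_of_exponent_le (hqk1 k) hγβ).trans (hsm k)
      calc _ = ‖(pder i w x - pder i v x) + (pder i v x - pder i u x)‖ := by congr 1; abel
        _ ≤ ε / 2 / 2 ^ k + ε * (1 - 1 / 2 ^ k) := (norm_add_le _ _).trans (add_le_add ((w4 i x).trans h1) (hv2 i x))
        _ = _ := by rw [pow_succ]; field_simp; ring
    refine ⟨w, ⟨⟨w1, hG.eL, hG.gL, hG.gs, fun i j x => ?_, fun i j x => ?_, fun x => ?_⟩, hw⟩, w4, w5⟩
    · rw [hpw]; exact w2 i j x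
    · rw [hpw, show b * (-2 * β) = -2 * (b * β) by ring]; exact w3 i j x
    · refine tup_near hεp.le (hG.tK x) (fun i => (hw i x).trans ?_) (by simp [hεp.le])
      have : (0:ℝ) ≤ 1 / 2 ^ (k + 1) := by positivity
      nlinarith
  choose f hf1 hf2 hf3 using hstep
  let sq : ∀ k, {v // Inv k v} := fun k => Nat.rec ⟨u, hbase⟩ (fun k v => ⟨f k v.1 v.2, hf1 k v.1 v.2⟩) k
  set us : ℕ → (Fin n → ℝ) → F := fun k => (sq k).1 with hus
  have hI : ∀ k, Inv k (us k) := fun k => (sq k).2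
  have hu0 : us 0 = u := rfl
  have r1 : ∀ k i x, ‖pder i (us (k + 1)) x - pder i (us k) x‖ ≤ qk k ^ (-β + s) := fun k => hf2 k _ (hI k)
  have r0' : ∀ k x, ‖us (k + 1) x - us k x‖ ≤ qk k ^ (-β + s) := fun k => hf3 k _ (hI k)
  have hle : ∀ k, qk k ^ (-β + s) ≤ ε / 2 / 2 ^ k := fun k =>
    (Real.rpow_le_rpow_of_exponent_le (hqk1 k) hγβ).trans (hsm k)
  obtain ⟨v, v1, v2, v3⟩ := lim_seq (fun k => (hI k).1.sm) (fun k x => (r0' k x).trans (hle k))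
    (fun k i x => (r1 k i x).trans (hle k))
  refine ⟨v, v1, fun i j x => ?_, ?_, fun x => (v3 x).trans (hε ▸ min_le_right _ _)⟩
  · -- metric
    have t1 := (v2 i x).inner (𝕜 := ℝ) (v2 j x)
    have t2 : Tendsto (fun k => qk k ^ (-2 * β)) atTop (𝓝 0) := by
      have hqt : Tendsto qk atTop atTop := by
        refine (tendsto_rpow_atTop_of_base_gt_one q ?_).comp (tendsto_pow_atTop_atTop_of_one_lt hb)
        have : 2 ≤ q := ((le_max_right _ _).trans (le_max_left _ _)).trans hq
        linarith
      have := (tendsto_rpow_neg_atTop (show 0 < 2 * β by positivity)).comp hqt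
      simpa [Function.comp_def] using this
    have t3 : Tendsto (fun k => r0 * qk k ^ (-2 * β) + qk k ^ (-2 * β) * |Hm n i j|) atTop (𝓝 0) := by
      simpa using (t2.const_mul r0).add (t2.mul_const |Hm n i j|)
    have t4 : Tendsto (fun k => (inner ℝ (pder i (us k) x) (pder j (us k) x))) atTop (𝓝 (g i j x)) := by
      rw [tendsto_iff_dist_tendsto_zero]
      refine squeeze_zero (fun _ => dist_nonneg) (fun k => ?_) t3
      have h1 := (hI k).1.er i j x
      rw [dist_comm, Real.dist_eq]
      calc _ = |(g i j x - (inner ℝ (pder i (us k) x) (pder j (us k) x)) - qk k ^ (-2 * β) * Hm n i j) + qk k ^ (-2 * β) * Hm n i j| := by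
            congr 1; ring
        _ ≤ _ := (abs_add_le _ _).trans (add_le_add h1 (by
          rw [abs_mul, abs_of_nonneg (Real.rpow_nonneg (hqkp k).le _)]))
    exact tendsto_nhds_unique t1 t4
  · -- Holder
    obtain ⟨C0, hC0⟩ : ∃ C0 : ℝ, C0 = 2 ^ (1 - θ) * (2 * n) ^ θ := ⟨_, rfl⟩
    have hC00 : 0 ≤ C0 := by rw [hC0]; positivity
    obtain ⟨C1, hC1⟩ : ∃ C1 : ℝ, C1 = (2 * C) ^ (1 - θ) * (n * q ^ m) ^ θ := ⟨_, rfl⟩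
    have hind : ∀ k i x y, ‖pder i (us k) x - pder i (us k) y‖ ≤ (C1 + C0 * ε * (1 - 1 / 2 ^ k)) * ‖x - y‖ ^ θ := by
      intro k
      induction k with
      | zero =>
        intro i x y
        rw [hu0]
        simp only [pow_zero, div_one, sub_self, mul_zero, add_zero]
        rw [hC1]
        refine interp (by positivity) (by positivity) (norm_nonneg _) hθ0.le hθ1 (norm_nonneg _) ?_ ?_
        · have h1 := (hCK u η x (hG.tK x)).1 i
          have h2 := (hCK u η y (hG.tK y)).1 i
          exact (norm_sub_le _ _).trans (by linarith)
        · exact lip_pder (fun x => sm_diff (sm_pder hG.sm i) x) (fun j x => hG.dd i j x) x y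
      | succ k ih =>
        intro i x y
        have hw : ‖(pder i (us (k + 1)) x - pder i (us k) x) - (pder i (us (k + 1)) y - pder i (us k) y)‖ ≤
            C0 * (ε / 2 / 2 ^ k) * ‖x - y‖ ^ θ := by
          have h1 := interp (A := 2 * qk k ^ (-β + s)) (B := (2 * n) * qk k ^ (b * m)) (d := ‖x - y‖)
            (by have := hqkp k; positivity) (by have := hqkp k; positivity) (norm_nonneg _) hθ0.le hθ1
            (norm_nonneg ((pder i (us (k + 1)) x - pder i (us k) x) - (pder i (us (k + 1)) y - pder i (us k) y))) ?_ ?_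
          · refine h1.trans ?_
            have hq := hqkp k
            have h2 : (2 * qk k ^ (-β + s)) ^ (1 - θ) * (2 * n * qk k ^ (b * m)) ^ θ = C0 * qk k ^ (-γ) := by
              rw [Real.mul_rpow (by norm_num) (by positivity), Real.mul_rpow (by positivity) (by positivity),
                ← Real.rpow_mul hq.le, ← Real.rpow_mul hq.le, hC0,
                show -γ = (-β + s) * (1 - θ) + b * m * θ by rw [hγ, hbm]; ring, Real.rpow_add hq]
              ring
            rw [h2]
            have := hsm k
            gcongr
          · exact (norm_sub_le _ _).trans (by have := r1 k i x; have := r1 k i y; linarith)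
          · have l1 := lip_pder (fun x => sm_diff (sm_pder (hI (k+1)).1.sm i) x) (fun j x => (hI (k+1)).1.dd i j x) x y
            have l2 := lip_pder (fun x => sm_diff (sm_pder (hI k).1.sm i) x) (fun j x => (hI k).1.dd i j x) x y
            rw [hpw] at l1
            have l3 : qk k ^ m ≤ qk k ^ (b * m) := Real.rpow_le_rpow_of_exponent_le (hqk1 k) (by nlinarith)
            have l4 : n * qk k ^ m * ‖x - y‖ ≤ n * qk k ^ (b * m) * ‖x - y‖ := by gcongr
            calc _ = ‖(pder i (us (k + 1)) x - pder i (us (k + 1)) y) - (pder i (us k) x - pder i (us k) y)‖ := by congr 1; abel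
              _ ≤ _ := (norm_sub_le _ _).trans (by linarith)
        have := ih i x y
        calc _ = ‖((pder i (us (k + 1)) x - pder i (us k) x) - (pder i (us (k + 1)) y - pder i (us k) y))
              + (pder i (us k) x - pder i (us k) y)‖ := by congr 1; abel
          _ ≤ _ := norm_add_le _ _
          _ ≤ C0 * (ε / 2 / 2 ^ k) * ‖x - y‖ ^ θ + (C1 + C0 * ε * (1 - 1 / 2 ^ k)) * ‖x - y‖ ^ θ := add_le_add hw this
          _ = _ := by rw [pow_succ]; field_simp; ring
    refine ⟨C1 + C0 * ε, fun i x y => ?_⟩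
    refine le_of_tendsto ((v2 i x).sub (v2 i y)).norm (Eventually.of_forall fun k => (hind k i x y).trans ?_)
    have : (0:ℝ) ≤ 1 / 2 ^ k := by positivity
    have hce : 0 ≤ C0 * ε := by positivity
    refine mul_le_mul_of_nonneg_right ?_ (by positivity)
    nlinarith

end I2
end NK

namespace NK
open Filter Topology Metric MeasureTheory
open scoped ContDiff
section J1

variable {n J : ℕ} {F : Type} [NormedAddCommGroup F] [InnerProductSpace ℝ F] [FiniteDimensional ℝ F]


theorem par_exists {J : ℕ} (hJ : 1 ≤ J) {θ : ℝ} (h0 : 0 < θ) (h1 : θ * (1 + 2 * J) < 1) :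
    ∃ b β s, Par J b β s ∧ θ * (b + (b - 1) * s) < β - s := by
  have hJ' : (1:ℝ) ≤ J := by exact_mod_cast hJ
  have hJ3 : (0:ℝ) < 1 + 2 * J := by linarith
  have hθ : θ < 1 / (1 + 2 * J) := by rwa [lt_div_iff₀ hJ3]
  obtain ⟨β, hβ1, hβ2⟩ := exists_between hθ
  have hβ0 : 0 < β := h0.trans hβ1
  rw [lt_div_iff₀ hJ3] at hβ2
  have e1 : ∀ᶠ b in 𝓝[>] (1:ℝ), θ * b < β := by
    refine nhdsWithin_le_nhds (Filter.Tendsto.eventually (show ContinuousAt (fun b : ℝ => θ * b) _ by fun_prop) (gt_mem_nhds (by simpa)))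
  have e2 : ∀ᶠ b in 𝓝[>] (1:ℝ), b < 4 / 3 := nhdsWithin_le_nhds (gt_mem_nhds (by norm_num))
  obtain ⟨b, hb, hb1, hb2⟩ := (eventually_mem_nhdsWithin.and (e1.and e2)).exists
  have hb : 1 < b := hb
  have hpos : 0 < (b - 1) * (1 - β * (1 + 2 * J)) := mul_pos (by linarith) (by linarith)
  have f1 : ∀ᶠ s in 𝓝[>] (0:ℝ), (3 + J) * s < (b - 1) * (1 - β * (1 + 2 * J)) :=
    nhdsWithin_le_nhds (Filter.Tendsto.eventually (show ContinuousAt (fun s : ℝ => (3 + J) * s) _ by fun_prop) (gt_mem_nhds (by simpa)))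
  have f2 : ∀ᶠ s in 𝓝[>] (0:ℝ), 2 * β * b + s < 3 * β :=
    nhdsWithin_le_nhds (Filter.Tendsto.eventually (show ContinuousAt (fun s : ℝ => 2 * β * b + s) _ by fun_prop) (gt_mem_nhds (by nlinarith)))
  have f3 : ∀ᶠ s in 𝓝[>] (0:ℝ), θ * (b + (b - 1) * s) + s < β :=
    nhdsWithin_le_nhds (Filter.Tendsto.eventually (show ContinuousAt (fun s : ℝ => θ * (b + (b - 1) * s) + s) _ by fun_prop)
      (gt_mem_nhds (by simpa)))
  obtain ⟨s, hs, hs1, hs2, hs3⟩ := (eventually_mem_nhdsWithin.and (f1.and (f2.and f3))).exists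
  exact ⟨b, β, s, ⟨hb, hβ0, hs, hs1.le, hs2.le, by nlinarith⟩, by linarith⟩

theorem pder_scale {G : Type} [NormedAddCommGroup G] [NormedSpace ℝ G] {f : (Fin n → ℝ) → G} (hf : Differentiable ℝ f) (c d : ℝ)
    (i : Fin n) : pder i (fun x => c • f (d • x)) = fun x => (c * d) • pder i f (d • x) := by
  ext1 x
  have h2 : HasFDerivAt (fun x : Fin n → ℝ => d • x) (d • ContinuousLinearMap.id ℝ (Fin n → ℝ)) x :=
    (hasFDerivAt_id x).const_smul d
  have h1 := (((hf (d • x)).hasFDerivAt).comp x h2).const_smul c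
  have h3 : fderiv ℝ (fun x => c • f (d • x)) x = _ := h1.fderiv
  rw [pder, h3]
  simp [pder, smul_smul, mul_comm]

theorem solve (pr : Prim n J) (hJ : 1 ≤ J) {θ : ℝ} (hθ0 : 0 < θ) (hθ1 : θ * (1 + 2 * J) < 1) :
    ∃ r0 : ℝ, 0 < r0 ∧ ∀ K : Set (Fin (n + n) → F), IsCompact K → K ⊆ LI (n + n) F → ∀ᶠ δ in 𝓝[>] (0:ℝ),
    ∀ (u : (Fin n → ℝ) → F) (η : Fin n → (Fin n → ℝ) → F) (g : Fin n → Fin n → (Fin n → ℝ) → ℝ) (B : ℝ),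
      ContDiff ℝ ∞ u → (∀ i j x, ‖pder j (pder i u) x‖ ≤ B) → (∀ k x y, ‖η k x - η k y‖ ≤ B * ‖x - y‖) →
      (∀ i j x y, ‖g i j x - g i j y‖ ≤ B * ‖x - y‖) → (∀ i j x, g i j x = g j i x) →
      (∀ i j x, |g i j x - (inner ℝ (pder i u x) (pder j u x)) - δ * Hm n i j| ≤ r0 * δ) → (∀ x, tup u η x ∈ K) →
      ∀ e : ℝ, 0 < e → ∃ v : (Fin n → ℝ) → F, ContDiff ℝ 1 v ∧ (∀ i j x, (inner ℝ (pder i v x) (pder j v x)) = g i j x) ∧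
      (∃ C, ∀ i x y, ‖pder i v x - pder i v y‖ ≤ C * ‖x - y‖ ^ θ) ∧ ∀ x, ‖v x - u x‖ ≤ e := by
  obtain ⟨b, β, s, pa, hθ⟩ := par_exists hJ hθ0 hθ1
  obtain ⟨r0, hr0, hr⟩ := r0_exists pr
  have hθ1' : θ ≤ 1 := by
    have : (1:ℝ) ≤ J := by exact_mod_cast hJ
    nlinarith
  refine ⟨r0, hr0, fun K hK hKL => ?_⟩
  have hβ := pa.hβ
  obtain ⟨m, hm⟩ : ∃ m, m = 1 - β / b + s := ⟨_, rfl⟩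
  have hm0 : 0 ≤ m := by
    have : β / b < β := div_lt_self hβ pa.hb
    have : β < 1 := by nlinarith [pa.h3, pa.hb]
    rw [hm]; linarith [pa.hs]
  obtain ⟨Q1, hQ⟩ := iterate pr pa hr0 hr hK hKL hm hθ0 hθ1' hθ one_pos
  have hexp : -(1 / (2 * β)) < 0 := by
    have : 0 < 1 / (2 * β) := by positivity
    linarith
  have ht : Tendsto (fun δ : ℝ => δ ^ (-(1 / (2 * β)))) (𝓝[>] 0) atTop := tendsto_rpow_neg_nhdsGT_zero hexp
  filter_upwards [ht.eventually_ge_atTop (max Q1 1), eventually_mem_nhdsWithin] with δ hδ hδ0 u η g B hu hdd hη hg hgs her hK' e he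
  have hδ0 : 0 < δ := hδ0
  set q := δ ^ (-(1 / (2 * β))) with hq
  have hqδ : q ^ (-2 * β) = δ := by
    rw [hq, ← Real.rpow_mul hδ0.le]
    have : -(1 / (2 * β)) * (-2 * β) = 1 := by field_simp
    rw [this, Real.rpow_one]
  have hq1 : 1 ≤ q := (le_max_right _ _).trans hδ
  obtain ⟨X, hX⟩ : ∃ X, X = max (max B 1) (1 / e) := ⟨_, rfl⟩
  have hX1 : 1 ≤ X := by rw [hX]; exact (le_max_right _ _).trans (le_max_left _ _)
  have hXB : B ≤ X := by rw [hX]; exact (le_max_left _ _).trans (le_max_left _ _)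
  have hXe : 1 / e ≤ X := by rw [hX]; exact le_max_right _ _
  have hX0 : 0 < X := by linarith
  have hXi : X * X⁻¹ = 1 := mul_inv_cancel₀ hX0.ne'
  have hXi' : X⁻¹ * X = 1 := inv_mul_cancel₀ hX0.ne'
  have hdu : Differentiable ℝ u := fun x => sm_diff hu x
  have p1 : ∀ i, pder i (fun x => X • u (X⁻¹ • x)) = fun x => pder i u (X⁻¹ • x) := fun i => by
    rw [pder_scale hdu, hXi]; simp
  have p2 : ∀ i j, pder j (pder i (fun x => X • u (X⁻¹ • x))) = fun x => X⁻¹ • pder j (pder i u) (X⁻¹ • x) := fun i j => by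
    rw [p1]
    have := pder_scale (f := pder i u) (fun x => sm_diff (sm_pder hu i) x) 1 X⁻¹ j
    simpa using this
  have hsc : ∀ x y : Fin n → ℝ, B * ‖X⁻¹ • x - X⁻¹ • y‖ ≤ ‖x - y‖ := fun x y => by
    rw [← smul_sub, norm_smul, Real.norm_of_nonneg (inv_nonneg.2 hX0.le), ← mul_assoc]
    have : B * X⁻¹ ≤ 1 := by rw [← div_eq_mul_inv, div_le_one hX0]; exact hXB
    exact mul_le_of_le_one_left (norm_nonneg _) this
  have hG : Good m β r0 K q (fun x => X • u (X⁻¹ • x)) (fun k x => η k (X⁻¹ • x)) (fun i j x => g i j (X⁻¹ • x)) := by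
    refine ⟨(hu.comp (contDiff_const_smul _)).const_smul X, fun k x y => (hη k _ _).trans (hsc x y), fun i j x y => (hg i j _ _).trans (hsc x y),
      fun i j x => hgs i j _, fun i j x => ?_, fun i j x => ?_, fun x => ?_⟩
    · rw [p2, norm_smul, Real.norm_of_nonneg (inv_nonneg.2 hX0.le)]
      have h1 : X⁻¹ * ‖pder j (pder i u) (X⁻¹ • x)‖ ≤ X⁻¹ * X := by
        have := (hdd i j (X⁻¹ • x)).trans hXB
        gcongr
      rw [hXi'] at h1
      exact h1.trans (Real.one_le_rpow hq1 hm0)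
    · rw [p1, p1, hqδ]; exact her i j _
    · have : tup (fun x => X • u (X⁻¹ • x)) (fun k x => η k (X⁻¹ • x)) x = tup u η (X⁻¹ • x) := by
        simp only [tup, p1]
      rw [this]; exact hK' _
  obtain ⟨w, w1, w2, ⟨C, w3⟩, w4⟩ := hQ q ((le_max_left _ _).trans hδ) _ _ _ hG
  have p3 : ∀ i, pder i (fun x => X⁻¹ • w (X • x)) = fun x => pder i w (X • x) := fun i => by
    rw [pder_scale (w1.differentiable one_ne_zero), hXi']; simp
  refine ⟨fun x => X⁻¹ • w (X • x), (w1.comp (contDiff_const_smul _)).const_smul _, fun i j x => ?_, ⟨C * X ^ θ, fun i x y => ?_⟩, fun x => ?_⟩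
  · rw [p3, p3]
    have := w2 i j (X • x)
    rwa [smul_smul, hXi', one_smul] at this
  · rw [p3]
    refine (w3 i _ _).trans_eq ?_
    rw [← smul_sub, norm_smul, Real.norm_of_nonneg hX0.le, Real.mul_rpow hX0.le (norm_nonneg _), mul_assoc]
  · have h1 := w4 (X • x)
    rw [smul_smul, hXi', one_smul] at h1
    have h2 : X⁻¹ • w (X • x) - u x = X⁻¹ • (w (X • x) - X • u x) := by
      rw [smul_sub, smul_smul, hXi', one_smul]
    rw [h2, norm_smul, Real.norm_of_nonneg (inv_nonneg.2 hX0.le)]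
    calc _ ≤ X⁻¹ * 1 := by gcongr
      _ ≤ e := by rw [mul_one]; exact inv_le_of_inv_le₀ he (by rwa [← one_div])

end J1
end NK

namespace NK
open Filter Topology Metric MeasureTheory InnerProductSpace
open scoped ContDiff
section K1
set_option linter.unusedSectionVars false

variable {n : ℕ} {F : Type} [NormedAddCommGroup F] [InnerProductSpace ℝ F] [FiniteDimensional ℝ F]


/-- smooth immersions which are linear outside a compact set -/
structure Adm (u : (Fin n → ℝ) → F) : Prop where
  sm : ContDiff ℝ ∞ u
  lin : ∃ (A : (Fin n → ℝ) →L[ℝ] F) (R : ℝ), ∀ x, R < ‖x‖ → u x = A x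
  imm : ∀ x, LinearIndependent ℝ (fun i => pder i u x)

theorem pder_out {u : (Fin n → ℝ) → F} {A : (Fin n → ℝ) →L[ℝ] F} {R : ℝ} (h : ∀ x, R < ‖x‖ → u x = A x) (i : Fin n) {x}
    (hx : R < ‖x‖) : pder i u x = A (Pi.single i 1) := by
  have : u =ᶠ[𝓝 x] A := by
    filter_upwards [(isOpen_lt continuous_const continuous_norm).mem_nhds hx] with y hy using h y hy
  rw [pder, this.fderiv_eq, ContinuousLinearMap.fderiv]

theorem pder_out0 {G : Type} [NormedAddCommGroup G] [NormedSpace ℝ G] {u : (Fin n → ℝ) → G} {c : G} {R : ℝ} (h : ∀ x, R < ‖x‖ → u x = c) (i : Fin n) {x}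
    (hx : R < ‖x‖) : pder i u x = 0 := by
  have : u =ᶠ[𝓝 x] fun _ => c := by
    filter_upwards [(isOpen_lt continuous_const continuous_norm).mem_nhds hx] with y hy using h y hy
  rw [pder, this.fderiv_eq]; simp

theorem bdd_out {G : Type} [NormedAddCommGroup G] {u : (Fin n → ℝ) → G} (hu : Continuous u) {c : G} {R : ℝ}
    (h : ∀ x, R < ‖x‖ → u x = c) : ∃ M, 0 ≤ M ∧ ∀ x, ‖u x‖ ≤ M := by
  obtain ⟨M, hM⟩ := (isCompact_closedBall (0 : Fin n → ℝ) R).exists_bound_of_continuousOn hu.continuousOn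
  refine ⟨max M ‖c‖, (norm_nonneg _).trans (le_max_right _ _), fun x => ?_⟩
  rcases lt_or_ge R ‖x‖ with hx | hx
  · rw [h x hx]; exact le_max_right _ _
  · exact (hM x (by simpa using hx)).trans (le_max_left _ _)

theorem bdd_fam {ι G : Type} [Finite ι] [NormedAddCommGroup G] {u : ι → (Fin n → ℝ) → G} (h : ∀ i, ∃ M, 0 ≤ M ∧ ∀ x, ‖u i x‖ ≤ M) :
    ∃ M, 0 ≤ M ∧ ∀ i x, ‖u i x‖ ≤ M := by
  cases nonempty_fintype ι
  choose M h0 hM using h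
  exact ⟨∑ i, M i, Finset.sum_nonneg fun i _ => h0 i, fun i x => (hM i x).trans (Finset.single_le_sum (f := M) (fun i _ => h0 i) (Finset.mem_univ i))⟩

theorem Adm.bd1 {u : (Fin n → ℝ) → F} (h : Adm u) : ∃ M, 0 ≤ M ∧ ∀ i x, ‖pder i u x‖ ≤ M := by
  obtain ⟨A, R, hA⟩ := h.lin
  exact bdd_fam fun i => bdd_out (sm_pder h.sm i).continuous fun x hx => pder_out hA i hx

theorem Adm.bd2 {u : (Fin n → ℝ) → F} (h : Adm u) : ∃ M, 0 ≤ M ∧ ∀ i j x, ‖pder j (pder i u) x‖ ≤ M := by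
  obtain ⟨A, R, hA⟩ := h.lin
  obtain ⟨M, h0, hM⟩ := bdd_fam (u := fun (p : Fin n × Fin n) x => pder p.2 (pder p.1 u) x) fun p => bdd_out (sm_pder (sm_pder h.sm p.1) p.2).continuous fun x hx => pder_out0 (fun x hx => pder_out hA p.1 hx) p.2 hx
  exact ⟨M, h0, fun i j x => hM (i, j) x⟩

/-- lower bound for a tuple -/
def Low (c : ℝ) (w : Fin n → F) : Prop := ∀ t : Fin n → ℝ, c * ‖t‖ ^ 2 ≤ ‖∑ i, t i • w i‖ ^ 2

theorem Low.li {c : ℝ} (hc : 0 < c) {w : Fin n → F} (h : Low c w) : LinearIndependent ℝ w := by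
  rw [Fintype.linearIndependent_iff]
  intro t ht i
  have := h t
  rw [ht] at this
  have h2 : ‖t‖ = 0 := by
    have : ‖t‖ ^ 2 ≤ 0 := by
      simp only [norm_zero] at this
      nlinarith
    exact pow_eq_zero_iff (two_ne_zero) |>.1 (le_antisymm this (by positivity))
  rw [norm_eq_zero] at h2
  rw [h2]; rfl

theorem low_compact {S : Set (Fin n → F)} (hS : IsCompact S) (hL : S ⊆ LI n F) : ∃ c : ℝ, 0 < c ∧ ∀ w ∈ S, Low c w := by
  have hc : ContinuousOn (fun p : (Fin n → F) × (Fin n → ℝ) => ‖∑ i, p.2 i • p.1 i‖ ^ 2) (S ×ˢ sphere 0 1) := by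
    fun_prop
  obtain ⟨c, hc0, hc⟩ := (hS.prod (isCompact_sphere (0 : Fin n → ℝ) 1)).exists_forall_le' hc (a := 0) (by
    rintro ⟨w, t⟩ ⟨hw, ht⟩
    have hw' : LinearIndependent ℝ w := hL hw
    rw [Fintype.linearIndependent_iff] at hw'
    have : ∑ i, t i • w i ≠ 0 := fun h0 => by
      have : t = 0 := funext fun i => hw' t h0 i
      simp [this] at ht
    positivity)
  refine ⟨c, hc0, fun w hw t => ?_⟩
  by_cases ht : t = 0
  · simp [ht]
  have ht' : 0 < ‖t‖ := norm_pos_iff.2 ht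
  have := hc (w, ‖t‖⁻¹ • t) ⟨hw, by simp [norm_smul, ht'.ne']⟩
  have e : ∑ i, (‖t‖⁻¹ • t) i • w i = ‖t‖⁻¹ • ∑ i, t i • w i := by
    rw [Finset.smul_sum]; simp [smul_smul]
  simp only [e, norm_smul, mul_pow, norm_inv, norm_norm] at this
  calc c * ‖t‖ ^ 2 ≤ (‖t‖⁻¹ ^ 2 * ‖∑ i, t i • w i‖ ^ 2) * ‖t‖ ^ 2 := by gcongr
    _ = _ := by field_simp

theorem Adm.low {u : (Fin n → ℝ) → F} (h : Adm u) : ∃ c : ℝ, 0 < c ∧ ∀ x, Low c (fun i => pder i u x) := by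
  obtain ⟨A, R, hA⟩ := h.lin
  have hcont : Continuous fun x => (fun i => pder i u x) := continuous_pi fun i => (sm_pder h.sm i).continuous
  have hS : IsCompact (Set.image (fun x => (fun i => pder i u x)) (closedBall 0 R) ∪ ({fun i => A (Pi.single i 1)} ∩ LI n F)) :=
    ((isCompact_closedBall _ _).image hcont).union ((Set.finite_singleton _).inter_of_left _).isCompact
  obtain ⟨c, hc, hl⟩ := low_compact hS (by
    rintro _ (⟨x, -, rfl⟩ | ⟨-, h2⟩)
    · exact h.imm x
    · exact h2)
  refine ⟨c, hc, fun x => hl _ ?_⟩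
  rcases lt_or_ge R ‖x‖ with hx | hx
  · right
    exact ⟨funext fun i => pder_out hA i hx, h.imm x⟩
  · left; exact ⟨x, by simpa using hx, rfl⟩

/-- compact set of adapted frames -/
def Kf (n : ℕ) (F : Type) [NormedAddCommGroup F] [InnerProductSpace ℝ F] (c C : ℝ) : Set (Fin (n + n) → F) :=
  {w | (∀ i, ‖w (Fin.castAdd n i)‖ ≤ C) ∧ Low c (fun i => w (Fin.castAdd n i)) ∧
    (∀ k l, (inner ℝ (w (Fin.natAdd n k)) (w (Fin.natAdd n l))) = if k = l then (1:ℝ) else 0) ∧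
    ∀ i k, (inner ℝ (w (Fin.castAdd n i)) (w (Fin.natAdd n k))) = 0}

theorem Kf_compact (c C : ℝ) : IsCompact (Kf n F c C) := by
  refine Metric.isCompact_of_isClosed_isBounded ?_ ?_
  · have : Kf n F c C = (⋂ i, {w | ‖w (Fin.castAdd n i)‖ ≤ C}) ∩ ((⋂ t : Fin n → ℝ, {w | c * ‖t‖ ^ 2 ≤ ‖∑ i, t i • w (Fin.castAdd n i)‖ ^ 2}) ∩
        ((⋂ k, ⋂ l, {w | (inner ℝ (w (Fin.natAdd n k)) (w (Fin.natAdd n l))) = if k = l then (1:ℝ) else 0}) ∩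
        ⋂ i, ⋂ k, {w | (inner ℝ (w (Fin.castAdd n i)) (w (Fin.natAdd n k))) = 0})) := by
      ext w; simp only [Kf, Low, Set.mem_setOf_eq, Set.mem_inter_iff, Set.mem_iInter]
    rw [this]
    refine (isClosed_iInter fun i => isClosed_le (by fun_prop) (by fun_prop)).inter
      ((isClosed_iInter fun i => isClosed_le (by fun_prop) (by fun_prop)).inter
      ((isClosed_iInter fun i => isClosed_iInter fun k => isClosed_eq (by fun_prop) (by fun_prop)).inter
      (isClosed_iInter fun i => isClosed_iInter fun k => isClosed_eq (by fun_prop) (by fun_prop))))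
  · rw [isBounded_iff_forall_norm_le]
    refine ⟨max C 1, fun w hw => ?_⟩
    rw [pi_norm_le_iff_of_nonneg (by positivity)]
    intro i
    refine Fin.addCases (fun i => (hw.1 i).trans (le_max_left _ _)) (fun k => ?_) i
    have h := hw.2.2.1 k k
    rw [if_pos rfl, real_inner_self_eq_norm_sq] at h
    have : ‖w (Fin.natAdd n k)‖ ≤ 1 := by nlinarith [norm_nonneg (w (Fin.natAdd n k))]
    exact this.trans (le_max_right _ _)

theorem li_of {c : ℝ} (hc : 0 < c) {w : Fin (n + n) → F} (h2 : Low c (fun i => w (Fin.castAdd n i)))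
    (h3 : ∀ k l, (inner ℝ (w (Fin.natAdd n k)) (w (Fin.natAdd n l))) = if k = l then (1:ℝ) else 0)
    (h4 : ∀ i k, (inner ℝ (w (Fin.castAdd n i)) (w (Fin.natAdd n k))) = 0) : LinearIndependent ℝ w := by
  rw [Fintype.linearIndependent_iff]
  intro t ht
  rw [Fin.sum_univ_add] at ht
  have hn : ∀ k, t (Fin.natAdd n k) = 0 := fun k => by
    have := congrArg (fun v => (inner ℝ v (w (Fin.natAdd n k)))) ht
    simpa [inner_add_left, sum_inner, real_inner_smul_left, h3, h4, -Fin.natAdd_eq_addNat] using this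
  have hc : ∀ i, t (Fin.castAdd n i) = 0 := by
    have := Fintype.linearIndependent_iff.1 (h2.li hc) (fun i => t (Fin.castAdd n i)) (by simpa [hn, -Fin.natAdd_eq_addNat] using ht)
    exact this
  intro i
  exact Fin.addCases hc hn i

theorem Kf_li {c : ℝ} (hc : 0 < c) (C : ℝ) : Kf n F c C ⊆ LI (n + n) F := fun _ hw => li_of hc hw.2.1 hw.2.2.1 hw.2.2.2

end K1
end NK

namespace NK
open Filter Topology Metric MeasureTheory InnerProductSpace
open scoped ContDiff
section K2
set_option linter.unusedSectionVars false

variable {n : ℕ} {F : Type} [NormedAddCommGroup F] [InnerProductSpace ℝ F] [FiniteDimensional ℝ F]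


theorem cut_exists (R : ℝ) (hR : 0 < R) : ∃ f : ℝ → ℝ, ContDiff ℝ ∞ f ∧ (∀ t, |t| ≤ R → f t = t) ∧
    (∀ t, R < |t| → R ≤ |f t|) ∧ (∀ t, |f t| ≤ R + 1) ∧ (∀ t, f (max (-(R + 1)) (min (R + 1) t)) = f t) := by
  have hs : ContDiff ℝ ∞ Real.smoothTransition := Real.smoothTransition.contDiff
  have key1 : ∀ t, R < t → t + (R - t) * Real.smoothTransition (t - R) - (R + t) * Real.smoothTransition (-t - R) =
      t * (1 - Real.smoothTransition (t - R)) + R * Real.smoothTransition (t - R) := fun t ht => by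
    rw [Real.smoothTransition.zero_of_nonpos (x := -t - R) (by linarith)]; ring
  have key2 : ∀ t, t < -R → t + (R - t) * Real.smoothTransition (t - R) - (R + t) * Real.smoothTransition (-t - R) =
      -(-t * (1 - Real.smoothTransition (-t - R)) + R * Real.smoothTransition (-t - R)) := fun t ht => by
    rw [Real.smoothTransition.zero_of_nonpos (x := t - R) (by linarith)]; ring
  have b1 : ∀ t, R < t → R ≤ t * (1 - Real.smoothTransition (t - R)) + R * Real.smoothTransition (t - R) := fun t ht => by
    nlinarith [Real.smoothTransition.le_one (t - R), Real.smoothTransition.nonneg (t - R)]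
  have b2 : ∀ t, R < t → t * (1 - Real.smoothTransition (t - R)) + R * Real.smoothTransition (t - R) ≤ R + 1 := fun t ht => by
    have h1 := Real.smoothTransition.le_one (t - R)
    have h2 := Real.smoothTransition.nonneg (t - R)
    rcases le_total t (R + 1) with h | h
    · nlinarith
    · rw [Real.smoothTransition.one_of_one_le (x := t - R) (by linarith)]; linarith
  refine ⟨fun t => t + (R - t) * Real.smoothTransition (t - R) - (R + t) * Real.smoothTransition (-t - R), ?_, fun t ht => ?_, fun t ht => ?_, fun t => ?_, fun t => ?_⟩
  · exact (contDiff_id.add ((contDiff_const.sub contDiff_id).mul (hs.comp (contDiff_id.sub contDiff_const)))).sub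
      ((contDiff_const.add contDiff_id).mul (hs.comp (contDiff_neg.sub contDiff_const)))
  · rw [abs_le] at ht
    simp only
    rw [Real.smoothTransition.zero_of_nonpos (x := -t - R) (by linarith), Real.smoothTransition.zero_of_nonpos (x := t - R) (by linarith)]
    ring
  · simp only
    rcases lt_abs.1 ht with h | h
    · rw [key1 t h]; exact (b1 t h).trans (le_abs_self _)
    · rw [key2 t (by linarith), abs_neg]; exact (b1 (-t) h).trans (le_abs_self _)
  · simp only
    rcases lt_trichotomy R |t| with h | h | h
    · rcases lt_abs.1 h with h | h
      · rw [key1 t h, abs_of_nonneg (hR.le.trans (b1 t h))]; exact b2 t h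
      · rw [key2 t (by linarith), abs_neg, abs_of_nonneg (hR.le.trans (b1 _ h))]; exact b2 (-t) h
    all_goals
      have ht := abs_le.1 (show |t| ≤ R by linarith)
      rw [Real.smoothTransition.zero_of_nonpos (x := -t - R) (by linarith), Real.smoothTransition.zero_of_nonpos (x := t - R) (by linarith)]
      rw [show t + (R - t) * 0 - (R + t) * 0 = t by ring]
      linarith
  · simp only
    rcases lt_trichotomy (R + 1) |t| with h | h | h
    · rcases lt_abs.1 h with h | h
      · rw [min_eq_left h.le, max_eq_right (by linarith), key1 t (by linarith), key1 _ (by linarith),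
          Real.smoothTransition.one_of_one_le (x := t - R) (by linarith), Real.smoothTransition.one_of_one_le (x := R + 1 - R) (by linarith)]
        ring
      · rw [min_eq_right (by linarith), max_eq_left (by linarith), key2 t (by linarith), key2 _ (by linarith),
          Real.smoothTransition.one_of_one_le (x := -t - R) (by linarith), Real.smoothTransition.one_of_one_le (x := -(-(R + 1)) - R) (by linarith)]
        ring
    all_goals
      have ht := abs_le.1 (show |t| ≤ R + 1 by linarith)
      rw [min_eq_right ht.2, max_eq_right ht.1]

theorem fr_step {c : ℝ} (hc : 0 < c) (C : ℝ) : ∃ ε : ℝ, 0 < ε ∧ ∀ (B B' η : Fin n → (Fin n → ℝ) → F),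
    (∀ x, Fin.append (fun i => B i x) (fun k => η k x) ∈ Kf n F c C) → (∀ i x, ‖B' i x‖ ≤ C) → (∀ x, Low c (fun i => B' i x)) →
    (∀ i x, ‖B' i x - B i x‖ ≤ ε) → (∀ i, ContDiff ℝ ∞ (B' i)) → (∀ k, ContDiff ℝ ∞ (η k)) →
    ∃ η' : Fin n → (Fin n → ℝ) → F, (∀ k, ContDiff ℝ ∞ (η' k)) ∧ (∀ x, Fin.append (fun i => B' i x) (fun k => η' k x) ∈ Kf n F c C) ∧
      (∀ x y, (∀ i, B' i x = B' i y) → (∀ k, η k x = η k y) → ∀ k, η' k x = η' k y) := by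
  obtain ⟨ε, hε, hK⟩ := (Kf_compact (n := n) (F := F) c C).exists_cthickening_subset_open LI_open (Kf_li hc C)
  refine ⟨ε, hε, fun B B' η h1 h2 h3 h4 h5 h6 => ?_⟩
  have hli : ∀ x, Fin.append (fun i => B' i x) (fun k => η k x) ∈ LI (n + n) F := fun x => by
    refine hK (mem_cthickening_of_dist_le _ _ _ _ (h1 x) ?_)
    rw [dist_pi_le_iff hε.le]
    intro i
    refine Fin.addCases (fun i => ?_) (fun k => ?_) i
    · rw [Fin.append_left, Fin.append_left, dist_eq_norm]; exact h4 i x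
    · rw [Fin.append_right, Fin.append_right, dist_self]; exact hε.le
  have hsm : ContDiff ℝ ∞ fun x => Fin.append (fun i => B' i x) (fun k => η k x) := by
    rw [contDiff_pi]
    intro i
    refine Fin.addCases (fun i => ?_) (fun k => ?_) i
    · simpa only [Fin.append_left] using h5 i
    · simpa only [Fin.append_right] using h6 k
  refine ⟨fun k x => gramSchmidtNormed ℝ (Fin.append (fun i => B' i x) (fun k => η k x)) (Fin.natAdd n k), fun k => ?_, fun x => ?_, fun x y hx hy k => ?_⟩
  · exact (gsn_smooth (Fin.natAdd n k)).comp_contDiff hsm hli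
  · have hl : LinearIndependent ℝ (Fin.append (fun i => B' i x) (fun k => η k x)) := hli x
    have ho := gramSchmidtNormed_orthonormal hl
    refine ⟨fun i => ?_, ?_, fun k l => ?_, fun i k => ?_⟩
    · rw [Fin.append_left]; exact h2 i x
    · simpa only [Fin.append_left] using h3 x
    · rw [Fin.append_right, Fin.append_right]
      rw [orthonormal_iff_ite.1 ho]
      simp only [Fin.natAdd_inj]
    · have hgn : ∀ (w : Fin (n + n) → F) (k), gramSchmidtNormed ℝ w k = (‖gramSchmidt ℝ w k‖⁻¹ : ℝ) • gramSchmidt ℝ w k := fun _ _ => rfl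
      rw [Fin.append_left, Fin.append_right]
      beta_reduce
      rw [hgn, real_inner_smul_right]
      have : inner ℝ (gramSchmidt ℝ (Fin.append (fun i => B' i x) (fun k => η k x)) (Fin.natAdd n k))
        (Fin.append (fun i => B' i x) (fun k => η k x) (Fin.castAdd n i)) = 0 := by
        refine gramSchmidt_inv_triangular _ _ ?_
        rw [Fin.lt_def]; simp; omega
      rw [Fin.append_left, real_inner_comm] at this
      rw [this, mul_zero]
  · simp only [hx, hy]

theorem fr_base (hF : Module.finrank ℝ F = n + n) {w : Fin n → F} (hw : LinearIndependent ℝ w) :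
    ∃ η : Fin n → F, (∀ k l, (inner ℝ (η k) (η l)) = if k = l then (1:ℝ) else 0) ∧ ∀ i k, (inner ℝ (w i) (η k)) = 0 := by
  set S := Submodule.span ℝ (Set.range w)
  have h1 : Module.finrank ℝ S = n := by rw [finrank_span_eq_card hw, Fintype.card_fin]
  have h2 : Module.finrank ℝ Sᗮ = n := by
    have := S.finrank_add_finrank_orthogonal
    omega
  let b := (stdOrthonormalBasis ℝ Sᗮ).reindex (finCongr h2)
  refine ⟨fun k => (b k : F), fun k l => ?_, fun i k => ?_⟩
  · have := orthonormal_iff_ite.1 b.orthonormal k l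
    rw [← this]; rfl
  · exact (Submodule.mem_orthogonal S _).1 (b k).2 _ (Submodule.subset_span ⟨i, rfl⟩)

theorem frame (hF : Module.finrank ℝ F = n + n) {u : (Fin n → ℝ) → F} (h : Adm u) :
    ∃ η : Fin n → (Fin n → ℝ) → F, (∀ k, ContDiff ℝ ∞ (η k)) ∧ (∃ L : ℝ, 0 ≤ L ∧ ∀ k x y, ‖η k x - η k y‖ ≤ L * ‖x - y‖) ∧
      (∀ k l x, (inner ℝ (η k x) (η l x)) = if k = l then (1:ℝ) else 0) ∧ ∀ i k x, (inner ℝ (pder i u x) (η k x)) = 0 := by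
  obtain ⟨A, R0, hA⟩ := h.lin
  obtain ⟨M1, hM10, hM1⟩ := h.bd1
  obtain ⟨M2, hM20, hM2⟩ := h.bd2
  obtain ⟨c, hc, hl⟩ := h.low
  obtain ⟨ε, hε, hst⟩ := fr_step (n := n) (F := F) hc M1
  obtain ⟨R, hR⟩ : ∃ R, R = max R0 0 + 1 := ⟨_, rfl⟩
  have hR0 : 0 < R := by rw [hR]; positivity
  have hR1 : R0 < R := by rw [hR]; linarith [le_max_left R0 0]
  obtain ⟨f, f1, f2, f3, f4, f5⟩ := cut_exists R hR0
  obtain ⟨ψ, hψ⟩ : ∃ ψ : (Fin n → ℝ) → (Fin n → ℝ), ψ = fun x i => f (x i) := ⟨_, rfl⟩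
  have ψs : ContDiff ℝ ∞ ψ := by
    rw [hψ, contDiff_pi]; intro i; exact f1.comp (contDiff_apply ℝ ℝ i)
  have ψb : ∀ x, ‖ψ x‖ ≤ R + 1 := fun x => by
    rw [pi_norm_le_iff_of_nonneg (by positivity), hψ]; exact fun i => f4 _
  have ψu : ∀ i x, pder i u (ψ x) = pder i u x := fun i x => by
    rcases le_or_gt ‖x‖ R with hx | hx
    · have : ψ x = x := by
        rw [hψ]; ext i; exact f2 _ ((norm_le_pi_norm x i).trans hx)
      rw [this]
    · have h2 : R ≤ ‖ψ x‖ := by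
        obtain ⟨i, hi⟩ : ∃ i, R < ‖x i‖ := by
          by_contra! hcon
          exact absurd ((pi_norm_le_iff_of_nonneg hR0.le).2 hcon) (not_le.2 hx)
        refine (f3 _ hi).trans ?_
        have := norm_le_pi_norm (ψ x) i
        rwa [hψ] at this ⊢
      rw [pder_out hA i (hR1.trans hx), pder_out hA i (hR1.trans_le h2)]
  have ψc : ∀ x, ψ (fun i => max (-(R + 1)) (min (R + 1) (x i))) = ψ x := fun x => by
    rw [hψ]; ext i; exact f5 _
  have hLip : ∀ i x y, ‖pder i u x - pder i u y‖ ≤ n * M2 * ‖x - y‖ := fun i =>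
    lip_pder (fun x => sm_diff (sm_pder h.sm i) x) fun j x => hM2 i j x
  obtain ⟨N, hN⟩ := exists_nat_gt (max 0 (n * M2 * (R + 1) / ε))
  have hN0 : (0:ℝ) < N := (le_max_left _ _).trans_lt hN
  have hN1 : n * M2 * ((R + 1) / N) ≤ ε := by
    have := ((le_max_right _ _).trans_lt hN).le
    rw [div_le_iff₀ hε] at this
    rw [← mul_div_assoc, div_le_iff₀ hN0]; linarith
  obtain ⟨η0, e1, e2⟩ := fr_base hF (h.imm 0)
  have main : ∀ j : ℕ, ∃ η : Fin n → (Fin n → ℝ) → F, (∀ k, ContDiff ℝ ∞ (η k)) ∧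
      (∀ x, Fin.append (fun i => pder i u (((j:ℝ) / N) • ψ x)) (fun k => η k x) ∈ Kf n F c M1) ∧
      ∀ x y, ψ x = ψ y → ∀ k, η k x = η k y := by
    intro j
    induction j with
    | zero =>
      refine ⟨fun k _ => η0 k, fun k => contDiff_const, fun x => ⟨fun i => ?_, ?_, fun k l => ?_, fun i k => ?_⟩, fun _ _ _ _ => rfl⟩
      · rw [Fin.append_left]; exact hM1 _ _
      · simp only [Fin.append_left]; exact hl _
      · rw [Fin.append_right, Fin.append_right]; exact e1 k l
      · rw [Fin.append_left, Fin.append_right]; simpa using e2 i k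
    | succ j ih =>
      obtain ⟨η, a1, a2, a3⟩ := ih
      obtain ⟨η', b1, b2, b3⟩ := hst (fun i x => pder i u (((j:ℝ) / N) • ψ x)) (fun i x => pder i u ((((j + 1 : ℕ):ℝ) / N) • ψ x)) η a2
        (fun i x => hM1 _ _) (fun x => hl _) (fun i x => by
          refine (hLip i _ _).trans ?_
          rw [← sub_smul, norm_smul, ← sub_div]
          push_cast
          rw [add_sub_cancel_left, Real.norm_of_nonneg (by positivity)]
          refine le_trans ?_ hN1
          have := ψb x
          have e : 1 / (N:ℝ) * ‖ψ x‖ ≤ (R + 1) / N := by rw [one_div_mul_eq_div]; gcongr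
          gcongr) (fun i => (sm_pder h.sm i).comp (ψs.const_smul _)) a1
      exact ⟨η', b1, b2, fun x y hxy => b3 x y (fun i => by simp only [hxy]) (a3 x y hxy)⟩
  obtain ⟨η, a1, a2, a3⟩ := main N
  refine ⟨η, a1, ?_, fun k l x => ?_, fun i k x => ?_⟩
  · have : ∀ k, ∃ L : ℝ, 0 ≤ L ∧ ∀ x y, ‖η k x - η k y‖ ≤ L * ‖x - y‖ := fun k => by
      obtain ⟨L, hL⟩ := ((a1 k).contDiffOn (s := closedBall 0 (R + 1))).exists_lipschitzOnWith (by simp) (convex_closedBall _ _) (isCompact_closedBall _ _)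
      refine ⟨L, L.2, fun x y => ?_⟩
      rw [← a3 _ _ (ψc x) k, ← a3 _ _ (ψc y) k]
      have hm : ∀ x : Fin n → ℝ, (fun i => max (-(R + 1)) (min (R + 1) (x i))) ∈ closedBall (0 : Fin n → ℝ) (R + 1) := fun x => by
        rw [mem_closedBall_zero_iff, pi_norm_le_iff_of_nonneg (by positivity)]
        intro i
        rw [Real.norm_eq_abs, abs_le]
        exact ⟨le_max_left _ _, max_le (by linarith) (min_le_left _ _)⟩
      have := hL.dist_le_mul _ (hm x) _ (hm y)
      rw [dist_eq_norm, dist_eq_norm] at this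
      refine this.trans (mul_le_mul_of_nonneg_left ?_ L.2)
      rw [pi_norm_le_iff_of_nonneg (norm_nonneg _)]
      intro i
      refine le_trans ?_ (norm_le_pi_norm (x - y) i)
      simp only [Pi.sub_apply, Real.norm_eq_abs]
      refine (abs_max_sub_max_le_max _ _ _ _).trans ?_
      rw [sub_self, abs_zero, max_eq_right (abs_nonneg _)]
      refine (abs_min_sub_min_le_max _ _ _ _).trans ?_
      rw [sub_self, abs_zero, max_eq_right (abs_nonneg _)]
    choose L h0 hL using this
    refine ⟨∑ k, L k, Finset.sum_nonneg fun k _ => h0 k, fun k x y => (hL k x y).trans ?_⟩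
    have := Finset.single_le_sum (f := L) (fun i _ => h0 i) (Finset.mem_univ k)
    gcongr
  · have := (a2 x).2.2.1 k l
    rwa [Fin.append_right, Fin.append_right] at this
  · have := (a2 x).2.2.2 i k
    rwa [Fin.append_left, Fin.append_right, div_self hN0.ne', one_smul, ψu] at this

end K2
end NK

namespace NK
open Filter Topology Metric MeasureTheory InnerProductSpace
open scoped ContDiff
section K3
set_option linter.unusedSectionVars false

variable {n : ℕ} {F : Type} [NormedAddCommGroup F] [InnerProductSpace ℝ F] [FiniteDimensional ℝ F]


theorem gram_sq (w : Fin n → F) (t : Fin n → ℝ) : ‖∑ i, t i • w i‖ ^ 2 = ∑ i, ∑ j, t i * t j * (inner ℝ (w i) (w j)) := by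
  rw [← real_inner_self_eq_norm_sq, sum_inner]
  refine Finset.sum_congr rfl fun i _ => ?_
  rw [inner_sum]
  refine Finset.sum_congr rfl fun j _ => ?_
  rw [real_inner_smul_left, real_inner_smul_right]; ring

theorem quad_bd {M : Fin n → Fin n → ℝ} {ε : ℝ} (h : ∀ i j, |M i j| ≤ ε) (t : Fin n → ℝ) :
    |∑ i, ∑ j, t i * t j * M i j| ≤ n ^ 2 * ε * ‖t‖ ^ 2 := by
  have : ∀ i j, |t i * t j * M i j| ≤ ‖t‖ * ‖t‖ * ε := fun i j => by
    rw [abs_mul, abs_mul]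
    have h1 := norm_le_pi_norm t i
    have h2 := norm_le_pi_norm t j
    rw [Real.norm_eq_abs] at h1 h2
    have := h i j
    gcongr
  calc _ ≤ ∑ i : Fin n, ∑ j : Fin n, ‖t‖ * ‖t‖ * ε := (Finset.abs_sum_le_sum_abs _ _).trans
        (Finset.sum_le_sum fun i _ => (Finset.abs_sum_le_sum_abs _ _).trans (Finset.sum_le_sum fun j _ => this i j))
    _ = _ := by simp; ring

theorem Low.pert {c ε : ℝ} {w w' : Fin n → F} (h : Low c w) {P : Fin n → Fin n → ℝ} (hP : ∀ t : Fin n → ℝ, 0 ≤ ∑ i, ∑ j, t i * t j * P i j)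
    (hw : ∀ i j, |(inner ℝ (w' i) (w' j)) - (inner ℝ (w i) (w j)) - P i j| ≤ ε) : Low (c - n ^ 2 * ε) w' := by
  intro t
  have h1 := h t
  have h2 := hP t
  have h3 := (abs_le.1 (quad_bd hw t)).1
  rw [gram_sq] at h1 ⊢
  simp only [mul_sub, Finset.sum_sub_distrib] at h3
  linarith

theorem twist (hn : 2 ≤ n) (hF : Module.finrank ℝ F = n + n) {u : (Fin n → ℝ) → F} (h : Adm u) {a : (Fin n → ℝ) → ℝ}
    (ha : ContDiff ℝ ∞ a) (hcs : ∃ R, ∀ x, R < ‖x‖ → a x = 0) (ν : Fin n → ℝ) {ε : ℝ} (hε : 0 < ε) :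
    ∃ v : (Fin n → ℝ) → F, Adm v ∧ (∀ x, ‖v x - u x‖ ≤ ε) ∧
      ∀ i j x, |(inner ℝ (pder i v x) (pder j v x)) - (inner ℝ (pder i u x) (pder j u x)) - a x ^ 2 * (ν i * ν j)| ≤ ε := by
  obtain ⟨η, s1, -, s3, s4⟩ := frame hF h
  obtain ⟨R, hR⟩ := hcs
  obtain ⟨A, R0, hA⟩ := h.lin
  obtain ⟨M1, hM10, hM1⟩ := h.bd1
  obtain ⟨c, hc, hl⟩ := h.low
  obtain ⟨Ma, Ma0, hMa⟩ := bdd_out ha.continuous hR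
  obtain ⟨Mb, Mb0, hMb⟩ := bdd_fam (u := fun i x => pder i a x) fun i => bdd_out (sm_pder ha i).continuous fun x hx => pder_out0 hR i hx
  obtain ⟨z1, hz1⟩ : ∃ z, z = η ⟨0, by omega⟩ := ⟨_, rfl⟩
  obtain ⟨z2, hz2⟩ : ∃ z, z = η ⟨1, by omega⟩ := ⟨_, rfl⟩
  have q1 : ContDiff ℝ ∞ z1 := hz1 ▸ s1 _
  have q2 : ContDiff ℝ ∞ z2 := hz2 ▸ s1 _
  have i11 : ∀ x, (inner ℝ (z1 x) (z1 x)) = 1 := fun x => by rw [hz1, s3, if_pos rfl]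
  have i22 : ∀ x, (inner ℝ (z2 x) (z2 x)) = 1 := fun x => by rw [hz2, s3, if_pos rfl]
  have i12 : ∀ x, (inner ℝ (z1 x) (z2 x)) = 0 := fun x => by rw [hz1, hz2, s3, if_neg (by simp)]
  have iu1 : ∀ i x, (inner ℝ (pder i u x) (z1 x)) = 0 := fun i x => by rw [hz1, s4]
  have iu2 : ∀ i x, (inner ℝ (pder i u x) (z2 x)) = 0 := fun i x => by rw [hz2, s4]
  have n1 : ∀ x, ‖z1 x‖ = 1 := fun x => by
    have := i11 x; rw [real_inner_self_eq_norm_sq] at this; nlinarith [norm_nonneg (z1 x)]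
  have n2 : ∀ x, ‖z2 x‖ = 1 := fun x => by
    have := i22 x; rw [real_inner_self_eq_norm_sq] at this; nlinarith [norm_nonneg (z2 x)]
  obtain ⟨Mc, Mc0, hMc⟩ := bdd_fam (u := fun i x => a x • pder i z1 x) fun i => bdd_out (c := 0) (ha.continuous.smul (sm_pder q1 i).continuous) fun x hx => by rw [hR x hx, zero_smul]
  obtain ⟨Md, Md0, hMd⟩ := bdd_fam (u := fun i x => a x • pder i z2 x) fun i => bdd_out (c := 0) (ha.continuous.smul (sm_pder q2 i).continuous) fun x hx => by rw [hR x hx, zero_smul]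
  obtain ⟨M, hM⟩ : ∃ M, M = Mb * 2 + Mc + Md := ⟨_, rfl⟩
  have hM0 : 0 ≤ M := by rw [hM]; positivity
  obtain ⟨M', hM'⟩ : ∃ M', M' = M1 + Ma * ‖ν‖ * 2 := ⟨_, rfl⟩
  have hM'0 : 0 ≤ M' := by rw [hM']; positivity
  obtain ⟨e, he⟩ : ∃ e, e = min ε (c / (2 * (n ^ 2 + 1))) := ⟨_, rfl⟩
  have he0 : 0 < e := by rw [he]; exact lt_min hε (by positivity)
  have he1 : e ≤ ε := he ▸ min_le_left _ _
  have he2 : 0 < c - n ^ 2 * e := by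
    have : e ≤ c / (2 * (n ^ 2 + 1)) := he ▸ min_le_right _ _
    rw [le_div_iff₀ (by positivity)] at this
    nlinarith
  obtain ⟨L, hL⟩ := exists_nat_gt (max 1 ((2 * M' * M + M ^ 2 + 2 * Ma) / e))
  have hL1 : (1:ℝ) < L := (le_max_left _ _).trans_lt hL
  have hL0 : (0:ℝ) < L := by linarith
  have hLe : (L:ℝ)⁻¹ * (2 * M' * M + M ^ 2 + 2 * Ma) ≤ e := by
    have := ((le_max_right _ _).trans_lt hL).le
    rw [div_le_iff₀ he0] at this
    rw [inv_mul_le_iff₀ hL0]; linarith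
  obtain ⟨l, hl'⟩ : ∃ l : ℝ, l = (L:ℝ)⁻¹ := ⟨_, rfl⟩
  have hlL : l * L = 1 := by rw [hl', inv_mul_cancel₀ hL0.ne']
  have hl0 : 0 < l := by rw [hl']; positivity
  have hl1 : l ≤ 1 := by rw [hl']; exact inv_le_one_of_one_le₀ hL1.le
  rw [← hl'] at hLe
  obtain ⟨v, hv⟩ : ∃ v : (Fin n → ℝ) → F, v = fun x => u x + (l * a x) • (Real.cos (L * ph ν x) • z1 x + Real.sin (L * ph ν x) • z2 x) := ⟨_, rfl⟩
  have hcos : ContDiff ℝ ∞ fun x => Real.cos (L * ph ν x) := Real.contDiff_cos.comp (contDiff_const.mul (ph ν).contDiff)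
  have hsin : ContDiff ℝ ∞ fun x => Real.sin (L * ph ν x) := Real.contDiff_sin.comp (contDiff_const.mul (ph ν).contDiff)
  have hvs : ContDiff ℝ ∞ v := by
    rw [hv]
    exact h.sm.add ((contDiff_const.mul ha).smul ((hcos.smul q1).add (hsin.smul q2)))
  obtain ⟨X, hX⟩ : ∃ X : Fin n → (Fin n → ℝ) → F, X = fun i x => pder i u x + (a x * ν i) • (-Real.sin (L * ph ν x) • z1 x + Real.cos (L * ph ν x) • z2 x) := ⟨_, rfl⟩
  obtain ⟨Y, hY⟩ : ∃ Y : Fin n → (Fin n → ℝ) → F, Y = fun i x => pder i a x • (Real.cos (L * ph ν x) • z1 x + Real.sin (L * ph ν x) • z2 x) +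
    (Real.cos (L * ph ν x) • (a x • pder i z1 x) + Real.sin (L * ph ν x) • (a x • pder i z2 x)) := ⟨_, rfl⟩
  have hpv : ∀ i x, pder i v x = X i x + l • Y i x := fun i x => by
    have d1 := sm_diff q1 x
    have d2 := sm_diff q2 x
    have dc := diff_cos L ν x
    have ds := diff_sin L ν x
    have da := sm_diff ha x
    have d3 := dc.fun_smul d1
    have d4 := ds.fun_smul d2
    have d5 := d3.fun_add d4
    have d6 := da.const_mul l
    rw [hv, pder_add' i (sm_diff h.sm x) (d6.fun_smul d5), pder_smul' i d6 d5, pder_add' i d3 d4,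
      pder_smul' i dc d1, pder_smul' i ds d2, pder_const_mul' l i da, pder_cos', pder_sin', hX, hY]
    simp only
    have k1 : l * a x * -(L * ν i * Real.sin (L * ph ν x)) = (a x * ν i) * -Real.sin (L * ph ν x) := by
      linear_combination (a x * ν i * -Real.sin (L * ph ν x)) * hlL
    have k2 : l * a x * (L * ν i * Real.cos (L * ph ν x)) = (a x * ν i) * Real.cos (L * ph ν x) := by
      linear_combination (a x * ν i * Real.cos (L * ph ν x)) * hlL
    simp only [smul_add, smul_smul, k1, k2]
    module
  have hcs2 : ∀ x, Real.cos (L * ph ν x) ^ 2 + Real.sin (L * ph ν x) ^ 2 = 1 := fun x => Real.cos_sq_add_sin_sq _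
  have hXX : ∀ i j x, (inner ℝ (X i x) (X j x)) = (inner ℝ (pder i u x) (pder j u x)) + a x ^ 2 * (ν i * ν j) := fun i j x => by
    have i21 : (inner ℝ (z2 x) (z1 x)) = 0 := by rw [real_inner_comm]; exact i12 x
    have ju1 : (inner ℝ (z1 x) (pder j u x)) = 0 := by rw [real_inner_comm]; exact iu1 j x
    have ju2 : (inner ℝ (z2 x) (pder j u x)) = 0 := by rw [real_inner_comm]; exact iu2 j x
    rw [hX]
    simp only [inner_add_left, inner_add_right, real_inner_smul_left, real_inner_smul_right, i11, i22, i12, i21, iu1, iu2, ju1, ju2]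
    linear_combination (a x ^ 2 * (ν i * ν j)) * hcs2 x
  have tb : ∀ (p q : ℝ) (v w : F) (m : ℝ), |p| ≤ 1 → |q| ≤ 1 → ‖p • v + q • w‖ ≤ ‖v‖ + ‖w‖ := fun p q v w m hp hq => by
    refine (norm_add_le _ _).trans ?_
    rw [norm_smul, norm_smul, Real.norm_eq_abs, Real.norm_eq_abs]
    exact add_le_add (mul_le_of_le_one_left (norm_nonneg _) hp) (mul_le_of_le_one_left (norm_nonneg _) hq)
  have hYb : ∀ i x, ‖Y i x‖ ≤ M := fun i x => by
    rw [hY, hM, add_assoc]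
    refine (norm_add_le _ _).trans (add_le_add ?_ ?_)
    · rw [norm_smul]
      have := tb _ _ (z1 x) (z2 x) 0 (Real.abs_cos_le_one (L * ph ν x)) (Real.abs_sin_le_one (L * ph ν x))
      rw [n1, n2] at this
      have h2 := hMb i x
      gcongr
      linarith
    · exact (tb _ _ _ _ 0 (Real.abs_cos_le_one _) (Real.abs_sin_le_one _)).trans (add_le_add (hMc i x) (hMd i x))
  have hXb : ∀ i x, ‖X i x‖ ≤ M' := fun i x => by
    rw [hX, hM']
    refine (norm_add_le _ _).trans (add_le_add (hM1 i x) ?_)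
    rw [norm_smul, norm_mul]
    have := tb _ _ (z1 x) (z2 x) 0 (show |-Real.sin (L * ph ν x)| ≤ 1 by rw [abs_neg]; exact Real.abs_sin_le_one _) (Real.abs_cos_le_one (L * ph ν x))
    rw [n1, n2] at this
    have h2 := hMa x
    have h3 := norm_le_pi_norm ν i
    gcongr
    linarith
  have hmet : ∀ i j x, |(inner ℝ (pder i v x) (pder j v x)) - (inner ℝ (pder i u x) (pder j u x)) - a x ^ 2 * (ν i * ν j)| ≤ e := fun i j x => by
    have e1 : (inner ℝ (pder i v x) (pder j v x)) - (inner ℝ (pder i u x) (pder j u x)) - a x ^ 2 * (ν i * ν j) =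
        l * ((inner ℝ (X i x) (Y j x)) + (inner ℝ (Y i x) (X j x)) + l * (inner ℝ (Y i x) (Y j x))) := by
      rw [hpv, hpv, inner_add_left, inner_add_right, inner_add_right, hXX]
      simp only [real_inner_smul_left, real_inner_smul_right]
      ring
    have b1 : |(inner ℝ (X i x) (Y j x))| ≤ M' * M := (abs_real_inner_le_norm _ _).trans (mul_le_mul (hXb _ _) (hYb _ _) (norm_nonneg _) hM'0)
    have b2 : |(inner ℝ (Y i x) (X j x))| ≤ M * M' := (abs_real_inner_le_norm _ _).trans (mul_le_mul (hYb _ _) (hXb _ _) (norm_nonneg _) hM0)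
    have b3 : |(inner ℝ (Y i x) (Y j x))| ≤ M * M := (abs_real_inner_le_norm _ _).trans (mul_le_mul (hYb _ _) (hYb _ _) (norm_nonneg _) hM0)
    have b4 : |l * (inner ℝ (Y i x) (Y j x))| ≤ M * M := by
      rw [abs_mul, abs_of_pos hl0]; exact (mul_le_of_le_one_left (abs_nonneg _) hl1).trans b3
    rw [e1, abs_mul, abs_of_pos hl0]
    refine le_trans ?_ hLe
    gcongr
    calc _ ≤ |(inner ℝ (X i x) (Y j x))| + |(inner ℝ (Y i x) (X j x))| + |l * (inner ℝ (Y i x) (Y j x))| := abs_add_three _ _ _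
      _ ≤ _ := by nlinarith
  refine ⟨v, ⟨hvs, ⟨A, max R R0, fun x hx => ?_⟩, fun x => ?_⟩, fun x => ?_, fun i j x => (hmet i j x).trans he1⟩
  · rw [hv]
    simp only
    rw [hR x ((le_max_left _ _).trans_lt hx), hA x ((le_max_right _ _).trans_lt hx)]; simp
  · refine Low.li he2 ((hl x).pert (P := fun i j => a x ^ 2 * (ν i * ν j)) (fun t => ?_) fun i j => hmet i j x)
    have : ∑ i, ∑ j, t i * t j * (a x ^ 2 * (ν i * ν j)) = a x ^ 2 * (∑ i, t i * ν i) ^ 2 := by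
      rw [sq (∑ i, t i * ν i), Finset.sum_mul_sum, Finset.mul_sum]
      refine Finset.sum_congr rfl fun i _ => ?_
      rw [Finset.mul_sum]
      exact Finset.sum_congr rfl fun j _ => by ring
    rw [this]; positivity
  · rw [hv]
    simp only [add_sub_cancel_left]
    rw [norm_smul, norm_mul, Real.norm_of_nonneg hl0.le]
    have := tb _ _ (z1 x) (z2 x) 0 (Real.abs_cos_le_one (L * ph ν x)) (Real.abs_sin_le_one (L * ph ν x))
    rw [n1, n2] at this
    refine le_trans ?_ (hLe.trans he1)
    rw [mul_assoc]
    have h2 := hMa x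
    gcongr
    calc _ ≤ Ma * (1 + 1) := by gcongr
      _ ≤ _ := by nlinarith [mul_nonneg hM'0 hM0]

theorem twists (hn : 2 ≤ n) (hF : Module.finrank ℝ F = n + n) {u : (Fin n → ℝ) → F} (h : Adm u) {ι : Type} (s : Finset ι)
    {a : ι → (Fin n → ℝ) → ℝ} (ha : ∀ m, ContDiff ℝ ∞ (a m)) (hcs : ∀ m, ∃ R, ∀ x, R < ‖x‖ → a m x = 0) (ν : ι → Fin n → ℝ) {ε : ℝ} (hε : 0 < ε) :
    ∃ v : (Fin n → ℝ) → F, Adm v ∧ (∀ x, ‖v x - u x‖ ≤ ε) ∧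
      ∀ i j x, |(inner ℝ (pder i v x) (pder j v x)) - (inner ℝ (pder i u x) (pder j u x)) - ∑ m ∈ s, a m x ^ 2 * (ν m i * ν m j)| ≤ ε := by
  classical
  induction s using Finset.induction_on generalizing ε with
  | empty => exact ⟨u, h, fun x => by simp [hε.le], fun i j x => by simp [hε.le]⟩
  | insert m s hm ih =>
    obtain ⟨v, v1, v2, v3⟩ := ih (half_pos hε)
    obtain ⟨w, w1, w2, w3⟩ := twist hn hF v1 (ha m) (hcs m) (ν m) (half_pos hε)
    refine ⟨w, w1, fun x => ?_, fun i j x => ?_⟩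
    · have : w x - u x = (w x - v x) + (v x - u x) := by abel
      rw [this]; linarith [norm_add_le (w x - v x) (v x - u x), v2 x, w2 x]
    · rw [Finset.sum_insert hm]
      have a1 := abs_le.1 (v3 i j x)
      have a2 := abs_le.1 (w3 i j x)
      rw [abs_le]; constructor <;> linarith [a1.1, a1.2, a2.1, a2.2]

end K3
end NK

namespace NK
open Filter Topology Metric MeasureTheory InnerProductSpace
open scoped ContDiff
section K4
set_option linter.unusedSectionVars false

variable {n : ℕ} {F : Type} [NormedAddCommGroup F] [InnerProductSpace ℝ F] [FiniteDimensional ℝ F]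


theorem unif_near {G : Type} [NormedAddCommGroup G] {h : (Fin n → ℝ) → G} (hh : Continuous h) (R : ℝ) {ε : ℝ} (hε : 0 < ε) :
    ∃ r : ℝ, 0 < r ∧ r ≤ 1 ∧ ∀ x, ‖x‖ ≤ R → ∀ y, ‖y - x‖ ≤ r → ‖h y - h x‖ ≤ ε := by
  have hu := (isCompact_closedBall (0 : Fin n → ℝ) (R + 1)).uniformContinuousOn_of_continuous hh.continuousOn
  obtain ⟨d, hd, hd2⟩ := Metric.uniformContinuousOn_iff.1 hu ε hε
  refine ⟨min 1 (d / 2), by positivity, min_le_left _ _, fun x hx y hy => ?_⟩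
  have h1 : ‖y - x‖ ≤ 1 := hy.trans (min_le_left _ _)
  have h2 : ‖y - x‖ < d := (hy.trans (min_le_right _ _)).trans_lt (by linarith)
  have h3 : ‖y‖ ≤ R + 1 := by
    have := norm_add_le (y - x) x
    rw [sub_add_cancel] at this; linarith
  have := hd2 y (by simpa using h3) x (by simpa using by linarith) (by rwa [dist_eq_norm])
  rw [dist_eq_norm] at this
  exact this.le

theorem pou {C : Set (Fin n → ℝ)} (hC : IsCompact C) {r : ℝ} (hr : 0 < r) :
    ∃ (t : Finset (Fin n → ℝ)) (σ : (Fin n → ℝ) → (Fin n → ℝ) → ℝ), (∀ p ∈ t, p ∈ C) ∧ (∀ p, ContDiff ℝ ∞ (σ p)) ∧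
      (∀ p x, r ≤ ‖x - p‖ → σ p x = 0) ∧ (∀ x, ∑ p ∈ t, σ p x ^ 2 ≤ 1) ∧ ∀ x ∈ C, ∑ p ∈ t, σ p x ^ 2 = 1 := by
  obtain ⟨t, ht, hcov⟩ := hC.elim_nhds_subcover (fun x => ball x (r / 2)) fun x _ => ball_mem_nhds x (half_pos hr)
  let b : ∀ p : Fin n → ℝ, ContDiffBump p := fun p => ⟨r / 2, r, half_pos hr, by linarith⟩
  obtain ⟨s, hs⟩ : ∃ s : (Fin n → ℝ) → ℝ, s = fun x => ∑ p ∈ t, (b p x) ^ 2 := ⟨_, rfl⟩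
  have hs0 : ∀ x, 0 ≤ s x := fun x => by rw [hs]; exact Finset.sum_nonneg fun p _ => sq_nonneg _
  have hss : ContDiff ℝ ∞ s := by rw [hs]; exact ContDiff.sum fun p _ => (b p).contDiff.pow 2
  obtain ⟨f, hf⟩ : ∃ f : (Fin n → ℝ) → ℝ, f = fun x => s x + 1 - Real.smoothTransition (s x) := ⟨_, rfl⟩
  have hfs : ContDiff ℝ ∞ f := by
    rw [hf]; exact (hss.add contDiff_const).sub (Real.smoothTransition.contDiff.comp hss)
  have hfge : ∀ x, s x ≤ f x := fun x => by rw [hf]; simp only; linarith [Real.smoothTransition.le_one (s x)]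
  have hf0 : ∀ x, 0 < f x := fun x => by
    rcases (hs0 x).eq_or_lt with h | h
    · rw [hf]; simp only; rw [← h, Real.smoothTransition.zero_of_nonpos le_rfl]; norm_num
    · exact h.trans_le (hfge x)
  have hsum : ∀ x, ∑ p ∈ t, (b p x / √(f x)) ^ 2 = s x / f x := fun x => by
    simp only [div_pow, Real.sq_sqrt (hf0 x).le]
    rw [← Finset.sum_div, hs]
  refine ⟨t, fun p x => b p x / √(f x), ht, fun p => ?_, fun p x hx => ?_, fun x => ?_, fun x hx => ?_⟩
  · exact (b p).contDiff.div (hfs.sqrt fun x => (hf0 x).ne') fun x => (Real.sqrt_pos.2 (hf0 x)).ne'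
  · simp only
    rw [(b p).zero_of_le_dist (by rw [dist_eq_norm]; exact hx), zero_div]
  · rw [hsum, div_le_one (hf0 x)]; exact hfge x
  · obtain ⟨p, hp, hxp⟩ : ∃ p ∈ t, x ∈ ball p (r / 2) := by simpa using hcov hx
    have h1 : 1 ≤ s x := by
      have hb : b p x = 1 := (b p).one_of_mem_closedBall (ball_subset_closedBall hxp)
      rw [hs]
      refine le_trans ?_ (Finset.single_le_sum (f := fun p => b p x ^ 2) (fun p _ => sq_nonneg _) hp)
      simp [hb]
    have : f x = s x := by rw [hf]; simp only; rw [Real.smoothTransition.one_of_one_le h1]; ring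
    rw [hsum, this, div_self (by linarith)]

theorem smooth_near {ubar : (Fin n → ℝ) → F} (hu : ContDiff ℝ 1 ubar) (R : ℝ) {ε : ℝ} (hε : 0 < ε) :
    ∃ w : (Fin n → ℝ) → F, ContDiff ℝ ∞ w ∧ (∃ R', ∀ x, R' < ‖x‖ → w x = 0) ∧
      ∀ x, ‖x‖ ≤ R → ‖w x - ubar x‖ ≤ ε ∧ ∀ i, ‖pder i w x - pder i ubar x‖ ≤ ε := by
  obtain ⟨R1, hR1⟩ : ∃ R1, R1 = max R 0 + 1 := ⟨_, rfl⟩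
  have hR10 : 0 < R1 := by rw [hR1]; positivity
  have hRR : R < R1 := by rw [hR1]; linarith [le_max_left R 0]
  let b : ContDiffBump (0 : Fin n → ℝ) := ⟨R1, R1 + 1, hR10, by linarith⟩
  obtain ⟨h, hh⟩ : ∃ h : (Fin n → ℝ) → F, h = fun x => b x • ubar x := ⟨_, rfl⟩
  have hc : ContDiff ℝ 1 h := by rw [hh]; exact b.contDiff.smul hu
  have h0 : ∀ x, R1 + 1 ≤ ‖x‖ → h x = 0 := fun x hx => by
    rw [hh]; simp only; rw [b.zero_of_le_dist (by simpa using hx), zero_smul]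
  have h1 : ∀ x, ‖x‖ ≤ R1 → h x = ubar x := fun x hx => by
    rw [hh]; simp only; rw [b.one_of_mem_closedBall (by simpa using hx), one_smul]
  have hp : ∀ i x, ‖x‖ ≤ R → pder i h x = pder i ubar x := fun i x hx => by
    have : h =ᶠ[𝓝 x] ubar := by
      filter_upwards [(isOpen_lt continuous_norm continuous_const).mem_nhds (hx.trans_lt hRR)] with y hy using h1 y (le_of_lt hy)
    rw [pder, this.fderiv_eq, pder]
  have hpc : ∀ i, Continuous (pder i h) := fun i => (hc.continuous_fderiv one_ne_zero).clm_apply continuous_const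
  obtain ⟨M, -, hM⟩ := bdd_out (hc.continuous_fderiv one_ne_zero) (c := 0) (R := R1 + 1) fun x hx => by
    have : h =ᶠ[𝓝 x] fun _ => 0 := by
      filter_upwards [(isOpen_lt continuous_const continuous_norm).mem_nhds hx] with y hy using h0 y (le_of_lt hy)
    rw [this.fderiv_eq]; simp
  obtain ⟨r, hr, hr1, hrn⟩ := unif_near (h := fun x => (h x, fun i => pder i h x)) (hc.continuous.prodMk (continuous_pi hpc)) R hε
  refine ⟨mol r h, mol_smooth hr hc.continuous, ⟨R1 + 2, fun x hx => ?_⟩, fun x hx => ⟨?_, fun i => ?_⟩⟩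
  · have := mol_near hr hc.continuous x 0 fun y hy => by
      have h3 : R1 + 1 ≤ ‖y‖ := by
        have := norm_sub_le y (y - x)
        rw [sub_sub_cancel] at this; linarith
      rw [h0 x (by linarith), h0 y h3]; simp
    rw [h0 x (by linarith), sub_zero] at this
    exact norm_le_zero_iff.1 this
  · rw [← h1 x (hx.trans hRR.le)]
    exact mol_near hr hc.continuous x _ fun y hy => (norm_fst_le _).trans (hrn x hx y hy)
  · rw [← hp i x hx, mol_pder hc hM]
    refine mol_near hr (hpc i) x _ fun y hy => le_trans ?_ (hrn x hx y hy)
    exact (norm_le_pi_norm (fun i => pder i h y - pder i h x) i).trans (norm_snd_le (h y - h x, fun i => pder i h y - pder i h x))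

theorem gen_cols (hF : Module.finrank ℝ F = n + n) {w : (Fin n → ℝ) → F} (hw : ContDiff ℝ ∞ w) {ε : ℝ} (hε : 0 < ε) (k : ℕ) (hk : k ≤ n) :
    ∃ A : Fin k → F, (∀ i, ‖A i‖ ≤ ε) ∧ ∀ x, LinearIndependent ℝ fun i : Fin k => pder (Fin.castLE hk i) w x + A i := by
  induction k with
  | zero => exact ⟨fun i => i.elim0, fun i => i.elim0, fun x => linearIndependent_empty_type⟩
  | succ k ih =>
    obtain ⟨A, hA, hl⟩ := ih (by omega)
    obtain ⟨Φ, hΦ⟩ : ∃ Φ : (Fin k → ℝ) × (Fin n → ℝ) → F, Φ = fun p => ∑ i, p.1 i • (pder (Fin.castLE (by omega) i) w p.2 + A i) -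
        pder (Fin.castLE hk (Fin.last k)) w p.2 := ⟨_, rfl⟩
    have hs : ContDiff ℝ 1 Φ := by
      have h1 : ∀ i, ContDiff ℝ 1 (pder i w) := fun i => (sm_pder hw i).of_le (nn 1 le_rfl)
      rw [hΦ]
      refine ContDiff.sub (ContDiff.sum fun i _ => ContDiff.smul (by fun_prop) (((h1 _).comp contDiff_snd).add contDiff_const)) ((h1 _).comp contDiff_snd)
    have hd := hs.dense_compl_range_of_finrank_lt_finrank (by rw [Module.finrank_prod, Module.finrank_fin_fun, Module.finrank_fin_fun, hF]; omega)
    obtain ⟨a, ha, ha2⟩ := hd.exists_dist_lt 0 hε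
    refine ⟨Fin.snoc A a, fun i => ?_, fun x => ?_⟩
    · refine Fin.lastCases ?_ (fun i => ?_) i
      · rw [Fin.snoc_last]; rw [dist_zero_left] at ha2; exact ha2.le
      · rw [Fin.snoc_castSucc]; exact hA i
    · have : (fun i : Fin (k + 1) => pder (Fin.castLE hk i) w x + (Fin.snoc A a : Fin (k + 1) → F) i) =
          Fin.snoc (fun i : Fin k => pder (Fin.castLE (by omega) i) w x + A i) (pder (Fin.castLE hk (Fin.last k)) w x + a) := by
        ext i
        refine Fin.lastCases ?_ (fun i => ?_) i
        · rw [Fin.snoc_last, Fin.snoc_last]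
        · rw [Fin.snoc_castSucc, Fin.snoc_castSucc]; rfl
      rw [this, linearIndependent_finSnoc]
      refine ⟨hl x, fun hmem => ha ?_⟩
      obtain ⟨t, ht⟩ := (Submodule.mem_span_range_iff_exists_fun ℝ).1 hmem
      refine ⟨(t, x), ?_⟩
      rw [hΦ]
      simp only
      rw [ht]; abel

theorem generic (hF : Module.finrank ℝ F = n + n) {ubar : (Fin n → ℝ) → F} (hu : ContDiff ℝ 1 ubar) (R : ℝ) {ε : ℝ} (hε : 0 < ε) :
    ∃ u : (Fin n → ℝ) → F, Adm u ∧ ∀ x, ‖x‖ ≤ R → ‖u x - ubar x‖ ≤ ε ∧ ∀ i, ‖pder i u x - pder i ubar x‖ ≤ ε := by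
  obtain ⟨w, hw, ⟨R', hR'⟩, hn⟩ := smooth_near hu R (half_pos hε)
  obtain ⟨e, he⟩ : ∃ e, e = ε / 2 / (n * max R 0 + 1) := ⟨_, rfl⟩
  have hD : 0 < n * max R 0 + 1 := by positivity
  have he0 : 0 < e := by rw [he]; positivity
  have he1 : e * (n * max R 0 + 1) = ε / 2 := by rw [he]; field_simp
  have he2 : e ≤ ε / 2 := by rw [← he1]; nlinarith [show 0 ≤ n * max R 0 by positivity]
  obtain ⟨A, hA, hl⟩ := gen_cols hF hw he0 n le_rfl
  obtain ⟨L, hL⟩ : ∃ L : (Fin n → ℝ) →L[ℝ] F, ∀ x, L x = ∑ i, x i • A i :=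
    ⟨∑ i, (ContinuousLinearMap.proj (R := ℝ) (φ := fun _ : Fin n => ℝ) i).smulRight (A i), fun x => by simp⟩
  have hp : ∀ i x, pder i (fun x => w x + L x) x = pder i w x + A i := fun i x => by
    rw [pder_add' i (sm_diff hw x) L.differentiableAt]
    congr 1
    rw [pder, ContinuousLinearMap.fderiv, hL, Finset.sum_eq_single i]
    · simp
    · intro j _ hj; simp [hj]
    · simp
  refine ⟨fun x => w x + L x, ⟨hw.add L.contDiff, ⟨L, R', fun x hx => by rw [hR' x hx, zero_add]⟩, fun x => ?_⟩, fun x hx => ⟨?_, fun i => ?_⟩⟩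
  · simp only [hp]; exact hl x
  · have h1 := (hn x hx).1
    have h2 : ‖L x‖ ≤ ε / 2 := by
      rw [hL, ← he1]
      calc _ ≤ ∑ i : Fin n, ‖x i • A i‖ := norm_sum_le _ _
        _ ≤ ∑ i : Fin n, max R 0 * e := Finset.sum_le_sum fun i _ => by
            rw [norm_smul]
            exact mul_le_mul ((norm_le_pi_norm x i).trans (hx.trans (le_max_left _ _))) (hA i) (norm_nonneg _) (le_max_right _ _)
        _ ≤ _ := by simp; nlinarith
    calc _ = ‖(w x - ubar x) + L x‖ := by rw [add_sub_right_comm]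
      _ ≤ _ := (norm_add_le _ _).trans (by linarith)
  · rw [hp]
    calc _ = ‖(pder i w x - pder i ubar x) + A i‖ := by congr 1; abel
      _ ≤ _ := (norm_add_le _ _).trans (by linarith [(hn x hx).2 i, hA i])

end K4
end NK

namespace NK
open Filter Topology Metric MeasureTheory InnerProductSpace
open scoped ContDiff
section K5
set_option linter.unusedSectionVars false

variable {n : ℕ} {F : Type} [NormedAddCommGroup F] [InnerProductSpace ℝ F] [FiniteDimensional ℝ F]


theorem psd_dec (P : Fin n → Fin n → ℝ) (hs : ∀ i j, P i j = P j i)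
    (hP : ∀ t : Fin n → ℝ, 0 ≤ ∑ i, ∑ j, t i * t j * P i j) :
    ∃ (m : ℕ) (ν : Fin m → Fin n → ℝ), ∀ i j, P i j = ∑ k, ν k i * ν k j := by
  have h : (Matrix.of P).PosSemidef := by
    refine Matrix.PosSemidef.of_dotProduct_mulVec_nonneg ?_ fun t => ?_
    · ext i j; simpa using hs j i
    · have := hP t
      simp only [dotProduct, Matrix.mulVec, Finset.mul_sum, Matrix.of_apply]
      simpa [mul_comm, mul_left_comm, mul_assoc] using this
  obtain ⟨m, v, hv⟩ := Matrix.posSemidef_iff_eq_sum_vecMulVec.1 h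
  refine ⟨m, v, fun i j => ?_⟩
  have := congrFun (congrFun hv i) j
  simpa [Matrix.sum_apply, Matrix.vecMulVec_apply] using this

/-- compactness: uniform positivity of a continuous family of quadratic forms -/
theorem quad_low {C : Set (Fin n → ℝ)} (hC : IsCompact C) {h : Fin n → Fin n → (Fin n → ℝ) → ℝ}
    (hc : ∀ i j, Continuous (h i j)) (hp : ∀ x ∈ C, ∀ t : Fin n → ℝ, t ≠ 0 → 0 < ∑ i, ∑ j, t i * t j * h i j x) :
    ∃ m : ℝ, 0 < m ∧ ∀ x ∈ C, ∀ t : Fin n → ℝ, m * ‖t‖ ^ 2 ≤ ∑ i, ∑ j, t i * t j * h i j x := by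
  have hcc : ContinuousOn (fun p : (Fin n → ℝ) × (Fin n → ℝ) => ∑ i, ∑ j, p.2 i * p.2 j * h i j p.1) (C ×ˢ sphere 0 1) := by
    fun_prop
  obtain ⟨c, hc0, hc⟩ := (hC.prod (isCompact_sphere (0 : Fin n → ℝ) 1)).exists_forall_le' hcc (a := 0) (by
    rintro ⟨x, t⟩ ⟨hx, ht⟩
    exact hp x hx t fun h0 => by simp [h0] at ht)
  refine ⟨c, hc0, fun x hx t => ?_⟩
  by_cases ht : t = 0
  · simp [ht]
  have ht' : 0 < ‖t‖ := norm_pos_iff.2 ht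
  have := hc (x, ‖t‖⁻¹ • t) ⟨hx, by simp [norm_smul, ht'.ne']⟩
  have e : ∑ i, ∑ j, (‖t‖⁻¹ • t) i * (‖t‖⁻¹ • t) j * h i j x = ‖t‖⁻¹ ^ 2 * ∑ i, ∑ j, t i * t j * h i j x := by
    rw [Finset.mul_sum]
    refine Finset.sum_congr rfl fun i _ => ?_
    rw [Finset.mul_sum]
    refine Finset.sum_congr rfl fun j _ => ?_
    simp only [Pi.smul_apply, smul_eq_mul]; ring
  simp only [e] at this
  calc c * ‖t‖ ^ 2 ≤ (‖t‖⁻¹ ^ 2 * ∑ i, ∑ j, t i * t j * h i j x) * ‖t‖ ^ 2 := by gcongr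
    _ = _ := by field_simp

theorem Hm_bd (hn : 2 ≤ n) (i j : Fin n) : |Hm n i j| ≤ n := by
  have : (1:ℝ) ≤ n := by exact_mod_cast (by omega : 1 ≤ n)
  unfold Hm; split_ifs <;> simp [this]

theorem lip_out {f : (Fin n → ℝ) → ℝ} (hf : ContDiff ℝ 1 f) {c R : ℝ} (h : ∀ x, R < ‖x‖ → f x = c) :
    ∃ L, 0 ≤ L ∧ ∀ x y, ‖f x - f y‖ ≤ L * ‖x - y‖ := by
  have h2 : HasCompactSupport (fun x => f x - c) :=
    HasCompactSupport.intro (isCompact_closedBall (0 : Fin n → ℝ) R) fun x hx => by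
      rw [h x (by simpa using hx), sub_self]
  obtain ⟨L, hL⟩ := ContDiff.lipschitzWith_of_hasCompactSupport h2 (hf.sub contDiff_const) one_ne_zero
  refine ⟨L, L.2, fun x y => ?_⟩
  have := hL.dist_le_mul x y
  rw [dist_eq_norm, dist_eq_norm] at this
  simpa using this

end K5
end NK

namespace NK
open Filter Topology Metric MeasureTheory InnerProductSpace
open scoped ContDiff
section K6
set_option linter.unusedSectionVars false

variable {n J : ℕ} {F : Type} [NormedAddCommGroup F] [InnerProductSpace ℝ F] [FiniteDimensional ℝ F]


theorem approx (hn : 2 ≤ n) (hF : Module.finrank ℝ F = n + n) (pr : Prim n J) (hJ : 1 ≤ J) {θ : ℝ} (hθ0 : 0 < θ)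
    (hθ1 : θ * (1 + 2 * J) < 1) {C : Set (Fin n → ℝ)} (hC : IsCompact C) {g : Fin n → Fin n → (Fin n → ℝ) → ℝ}
    (hg : ∀ i j, ContDiff ℝ 1 (g i j)) (hgs : ∀ i j x, g i j x = g j i x) {u0 : (Fin n → ℝ) → F} (h : Adm u0)
    (hp : ∀ x ∈ C, ∀ t : Fin n → ℝ, t ≠ 0 → 0 < ∑ i, ∑ j, t i * t j * (g i j x - (inner ℝ (pder i u0 x) (pder j u0 x)))) {e : ℝ} (he : 0 < e) :
    ∃ v : (Fin n → ℝ) → F, ContDiff ℝ 1 v ∧ (∀ i j, ∀ x ∈ C, (inner ℝ (pder i v x) (pder j v x)) = g i j x) ∧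
      (∃ C', ∀ i x y, ‖pder i v x - pder i v y‖ ≤ C' * ‖x - y‖ ^ θ) ∧ ∀ x, ‖v x - u0 x‖ ≤ e := by
  obtain ⟨q, hq⟩ : ∃ q : Fin n → Fin n → (Fin n → ℝ) → ℝ, q = fun i j x => (inner ℝ (pder i u0 x) (pder j u0 x)) := ⟨_, rfl⟩
  have hqs : ∀ i j, ContDiff ℝ ∞ (q i j) := fun i j => by
    rw [hq]; exact (sm_pder h.sm i).inner ℝ (sm_pder h.sm j)
  have hqy : ∀ i j x, q i j x = q j i x := fun i j x => by rw [hq]; exact real_inner_comm _ _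
  obtain ⟨hh, hhh⟩ : ∃ hh : Fin n → Fin n → (Fin n → ℝ) → ℝ, hh = fun i j x => g i j x - q i j x := ⟨_, rfl⟩
  have hhc : ∀ i j, ContDiff ℝ 1 (hh i j) := fun i j => by
    rw [hhh]; exact (hg i j).sub ((hqs i j).of_le (by simp))
  obtain ⟨m, hm0, hm⟩ := quad_low (h := hh) hC (fun i j => (hhc i j).continuous) (by
    intro x hx t ht; rw [hhh, hq]; exact hp x hx t ht)
  obtain ⟨c, hc0, hlow⟩ := h.low
  obtain ⟨M1, hM10, hM1⟩ := h.bd1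
  obtain ⟨Mh, hMh⟩ := hC.exists_bound_of_continuousOn (f := fun x => ∑ i, |hh i i x|)
    (continuous_finsetSum _ fun i _ => (hhc i i).continuous.abs).continuousOn
  have hMh' : ∀ i, ∀ x ∈ C, hh i i x ≤ |Mh| := fun i x hx => by
    have h1 := hMh x hx
    have h2 := Finset.single_le_sum (f := fun i => |hh i i x|) (fun i _ => abs_nonneg _) (Finset.mem_univ i)
    exact (le_abs_self _).trans (h2.trans ((le_abs_self _).trans (h1.trans (le_abs_self _))))
  obtain ⟨Cup, hCup⟩ : ∃ Cup, Cup = M1 ^ 2 + |Mh| + 1 := ⟨_, rfl⟩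
  have hCup1 : 1 ≤ Cup := by rw [hCup]; nlinarith [abs_nonneg Mh, sq_nonneg M1]
  obtain ⟨r0, hr0, hsolve⟩ := solve (F := F) pr hJ hθ0 hθ1
  have hev := hsolve (Kf n F (c / 2) Cup) (Kf_compact _ _) (Kf_li (half_pos hc0) _)
  obtain ⟨δ, hδ, hδm⟩ := (hev.and (Ioo_mem_nhdsGT (show (0:ℝ) < m / (n ^ 3 + 1) by positivity))).exists
  obtain ⟨hδ0, hδ1⟩ : 0 < δ ∧ δ < m / (n ^ 3 + 1) := hδm
  rw [lt_div_iff₀ (by positivity)] at hδ1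
  clear hev hsolve
  obtain ⟨h0, hh0⟩ : ∃ h0 : Fin n → Fin n → (Fin n → ℝ) → ℝ, h0 = fun i j x => hh i j x - δ * Hm n i j := ⟨_, rfl⟩
  have h0c : ∀ i j, ContDiff ℝ 1 (h0 i j) := fun i j => by
    rw [hh0]; exact (hhc i j).sub contDiff_const
  have h0s : ∀ i j x, h0 i j x = h0 j i x := fun i j x => by
    rw [hh0, hhh]; simp only [hgs i j x, hqy i j x, Hm, eq_comm]
  have h0p : ∀ x ∈ C, ∀ t : Fin n → ℝ, 0 ≤ ∑ i, ∑ j, t i * t j * h0 i j x := fun x hx t => by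
    have a1 := hm x hx t
    have a2 := (abs_le.1 (quad_bd (M := fun i j => δ * Hm n i j) (ε := δ * n) (fun i j => by
      rw [abs_mul, abs_of_pos hδ0]; exact mul_le_mul_of_nonneg_left (Hm_bd hn i j) hδ0.le) t)).2
    rw [hh0]
    simp only [mul_sub, Finset.sum_sub_distrib] at a2 ⊢
    have a3 : (n:ℝ) ^ 2 * (δ * n) * ‖t‖ ^ 2 ≤ m * ‖t‖ ^ 2 := by
      gcongr; nlinarith
    linarith
  obtain ⟨R, hR⟩ := hC.isBounded.exists_norm_le
  obtain ⟨r, hr, hr1, hrn⟩ := unif_near (h := fun x => fun i j => h0 i j x)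
    (continuous_pi fun i => continuous_pi fun j => (h0c i j).continuous) R (show 0 < r0 * δ / 2 by positivity)
  have hrn' : ∀ p, ‖p‖ ≤ R → ∀ x, ‖x - p‖ ≤ r → ∀ i j, |h0 i j x - h0 i j p| ≤ r0 * δ / 2 := fun p hp' x hx i j => by
    have h1 := norm_le_pi_norm ((fun i j => h0 i j x) - fun i j => h0 i j p) i
    have h2 := norm_le_pi_norm (((fun i j => h0 i j x) - fun i j => h0 i j p) i) j
    exact (h2.trans h1).trans (hrn p hp' x hx)
  obtain ⟨t, σ, ht, hσs, hσ0, hσ1, hσC⟩ := pou hC hr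
  obtain ⟨ρ, hρ⟩ : ∃ ρ : (Fin n → ℝ) → ℝ, ρ = fun x => ∑ p ∈ t, σ p x ^ 2 := ⟨_, rfl⟩
  have hρs : ContDiff ℝ ∞ ρ := by rw [hρ]; exact ContDiff.sum fun p _ => (hσs p).pow 2
  obtain ⟨A, R0, hA⟩ := h.lin
  obtain ⟨g', hg'⟩ : ∃ g' : Fin n → Fin n → (Fin n → ℝ) → ℝ, g' = fun i j x => q i j x + δ * Hm n i j + ρ x * h0 i j x := ⟨_, rfl⟩
  have hg's : ∀ i j, ContDiff ℝ 1 (g' i j) := fun i j => by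
    rw [hg']; exact (((hqs i j).of_le (by simp)).add contDiff_const).add ((hρs.of_le (by simp)).mul (h0c i j))
  have hg'C : ∀ i j, ∀ x ∈ C, g' i j x = g i j x := fun i j x hx => by
    rw [hg', hρ, hh0, hhh]; simp only; rw [hσC x hx]; ring
  have hσout : ∀ p x, ‖p‖ + r < ‖x‖ → σ p x = 0 := fun p x hx => hσ0 p x (by
    have := norm_sub_norm_le x p; linarith)
  have hρout : ∀ x, R + 1 < ‖x‖ → ρ x = 0 := fun x hx => by
    rw [hρ]
    refine Finset.sum_eq_zero fun p hp' => ?_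
    rw [hσout p x (by linarith [hR p (ht p hp')])]; norm_num
  have hlip : ∀ i j, ∃ L, 0 ≤ L ∧ ∀ x y, ‖g' i j x - g' i j y‖ ≤ L * ‖x - y‖ := fun i j =>
    lip_out (hg's i j) (c := (inner ℝ (A (Pi.single i 1)) (A (Pi.single j 1))) + δ * Hm n i j) (R := max R0 (R + 1)) fun x hx => by
      rw [hg']; simp only
      rw [hρout x ((le_max_right _ _).trans_lt hx), hq]
      simp only
      rw [pder_out hA i ((le_max_left _ _).trans_lt hx), pder_out hA j ((le_max_left _ _).trans_lt hx)]; ring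
  choose L hL0 hL using hlip
  have hdec : ∀ p, ∃ (k : ℕ) (ν : Fin k → Fin n → ℝ), p ∈ C → ∀ i j, h0 i j p = ∑ l, ν l i * ν l j := fun p => by
    by_cases hpC : p ∈ C
    · obtain ⟨k, ν, hν⟩ := psd_dec (fun i j => h0 i j p) (fun i j => h0s i j p) (h0p p hpC)
      exact ⟨k, ν, fun _ => hν⟩
    · exact ⟨0, fun _ _ => 0, fun hh => absurd hh hpC⟩
  choose k ν hν using hdec
  obtain ⟨ε, hε⟩ : ∃ ε, ε = min (min (r0 * δ / 2) (e / 2)) (min (c / (2 * (n ^ 2 + 1))) 1) := ⟨_, rfl⟩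
  have hε0 : 0 < ε := by rw [hε]; refine lt_min (lt_min ?_ ?_) (lt_min ?_ ?_) <;> positivity
  have hε1 : ε ≤ r0 * δ / 2 := by rw [hε]; exact (min_le_left _ _).trans (min_le_left _ _)
  have hε2 : ε ≤ e / 2 := by rw [hε]; exact (min_le_left _ _).trans (min_le_right _ _)
  have hε3 : ε ≤ c / (2 * (n ^ 2 + 1)) := by rw [hε]; exact (min_le_right _ _).trans (min_le_left _ _)
  have hε4 : ε ≤ 1 := by rw [hε]; exact (min_le_right _ _).trans (min_le_right _ _)
  rw [le_div_iff₀ (by positivity)] at hε3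
  obtain ⟨w, w1, w2, w3⟩ := twists hn hF h (ι := Σ p : Fin n → ℝ, Fin (k p)) (t.sigma fun p => Finset.univ)
    (a := fun m => σ m.1) (fun m => hσs m.1) (fun m => ⟨‖m.1‖ + r, fun x hx => hσout m.1 x hx⟩) (fun m => ν m.1 m.2) hε0
  obtain ⟨S, hS⟩ : ∃ S : Fin n → Fin n → (Fin n → ℝ) → ℝ, S = fun i j x => ∑ p ∈ t, σ p x ^ 2 * h0 i j p := ⟨_, rfl⟩
  have w4 : ∀ i j x, |(inner ℝ (pder i w x) (pder j w x)) - (inner ℝ (pder i u0 x) (pder j u0 x)) - S i j x| ≤ ε := fun i j x => by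
    have h1 := w3 i j x
    rw [Finset.sum_sigma] at h1
    have h2 : S i j x = ∑ p ∈ t, ∑ l : Fin (k p), σ p x ^ 2 * (ν p l i * ν p l j) := by
      rw [hS]
      refine Finset.sum_congr rfl fun p hp' => ?_
      rw [hν p (ht p hp') i j, Finset.mul_sum]
    rw [h2]; exact h1
  clear w3
  have hSp : ∀ x, ∀ s : Fin n → ℝ, 0 ≤ ∑ i, ∑ j, s i * s j * S i j x := fun x s => by
    have : ∑ i, ∑ j, s i * s j * S i j x = ∑ p ∈ t, σ p x ^ 2 * ∑ i, ∑ j, s i * s j * h0 i j p := by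
      rw [hS]
      simp only [Finset.mul_sum]
      rw [Finset.sum_comm (s := t)]
      refine Finset.sum_congr rfl fun i _ => ?_
      rw [Finset.sum_comm (s := t)]
      refine Finset.sum_congr rfl fun j _ => ?_
      refine Finset.sum_congr rfl fun p _ => by ring
    rw [this]
    exact Finset.sum_nonneg fun p hp' => mul_nonneg (sq_nonneg _) (h0p p (ht p hp') s)
  have hSd : ∀ i x, S i i x ≤ |Mh| := fun i x => by
    have : S i i x ≤ ∑ p ∈ t, σ p x ^ 2 * |Mh| := by
      rw [hS]
      refine Finset.sum_le_sum fun p hp' => mul_le_mul_of_nonneg_left ?_ (sq_nonneg _)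
      rw [hh0]
      have h1 := hMh' i p (ht p hp')
      have h2 : 0 ≤ δ * Hm n i i := by simp only [Hm, if_true]; positivity
      simp only; linarith
    rw [← Finset.sum_mul] at this
    exact this.trans (mul_le_of_le_one_left (abs_nonneg _) (hσ1 x))
  have herr : ∀ i j x, |g' i j x - (inner ℝ (pder i w x) (pder j w x)) - δ * Hm n i j| ≤ r0 * δ := fun i j x => by
    have b1 : |ρ x * h0 i j x - S i j x| ≤ r0 * δ / 2 := by
      have e1 : ρ x * h0 i j x - S i j x = ∑ p ∈ t, σ p x ^ 2 * (h0 i j x - h0 i j p) := by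
        rw [hρ, hS]; simp only [Finset.sum_mul, mul_sub, Finset.sum_sub_distrib]
      rw [e1]
      calc _ ≤ ∑ p ∈ t, σ p x ^ 2 * (r0 * δ / 2) := by
            refine (Finset.abs_sum_le_sum_abs _ _).trans (Finset.sum_le_sum fun p hp' => ?_)
            rw [abs_mul, abs_of_nonneg (sq_nonneg _)]
            rcases le_or_gt r ‖x - p‖ with hx | hx
            · rw [hσ0 p x hx]; simp
            · exact mul_le_mul_of_nonneg_left (hrn' p (hR p (ht p hp')) x hx.le i j) (sq_nonneg _)
        _ ≤ _ := by
            rw [← Finset.sum_mul]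
            exact mul_le_of_le_one_left (by positivity) (hσ1 x)
    have b2 := abs_le.1 (w4 i j x)
    have b1' := abs_le.1 b1
    rw [hg', hq]
    simp only
    rw [abs_le]; constructor <;> linarith [b1'.1, b1'.2, b2.1, b2.2]
  obtain ⟨η, -, ⟨Lη, Lη0, hLη⟩, η3, η4⟩ := frame hF w1
  obtain ⟨M2, M20, hM2⟩ := w1.bd2
  obtain ⟨B, hB⟩ : ∃ B, B = M2 + Lη + ∑ i, ∑ j, L i j := ⟨_, rfl⟩
  have hLs0 : 0 ≤ ∑ i, ∑ j, L i j := Finset.sum_nonneg fun i _ => Finset.sum_nonneg fun j _ => hL0 i j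
  have hLs : ∀ i j, L i j ≤ ∑ i, ∑ j, L i j := fun i j =>
    (Finset.single_le_sum (f := fun j => L i j) (fun j _ => hL0 i j) (Finset.mem_univ j)).trans
      (Finset.single_le_sum (f := fun i => ∑ j, L i j) (fun i _ => Finset.sum_nonneg fun j _ => hL0 i j) (Finset.mem_univ i))
  obtain ⟨v, v1, v2, v3, v4⟩ := hδ w η g' B w1.sm (fun i j x => (hM2 i j x).trans (by linarith))
    (fun k x y => (hLη k x y).trans (mul_le_mul_of_nonneg_right (by linarith) (norm_nonneg _)))
    (fun i j x y => (hL i j x y).trans (mul_le_mul_of_nonneg_right (by linarith [hLs i j]) (norm_nonneg _)))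
    (fun i j x => by rw [hg']; simp only [hqy i j x, h0s i j x, Hm, eq_comm]) herr (fun x => by
      refine ⟨fun i => ?_, ?_, fun k l => ?_, fun i k => ?_⟩
      · simp only [tup, Fin.append_left]
        have b := (abs_le.1 (w4 i i x)).2
        rw [real_inner_self_eq_norm_sq, real_inner_self_eq_norm_sq] at b
        have b1 := hSd i x
        have b2 : ‖pder i u0 x‖ ^ 2 ≤ M1 ^ 2 := by have := hM1 i x; gcongr
        have b3 : ‖pder i w x‖ ^ 2 ≤ Cup := by rw [hCup]; linarith
        nlinarith [norm_nonneg (pder i w x)]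
      · simp only [tup, Fin.append_left]
        intro s
        refine le_trans ?_ (((hlow x).pert (hSp x) fun i j => w4 i j x) s)
        gcongr
        nlinarith
      · simp only [tup, Fin.append_right]; exact η3 k l x
      · simp only [tup, Fin.append_left, Fin.append_right]; exact η4 i k x) (e / 2) (half_pos he)
  refine ⟨v, v1, fun i j x hx => by rw [v2, hg'C i j x hx], v3, fun x => ?_⟩
  have : v x - u0 x = (v x - w x) + (w x - u0 x) := by abel
  rw [this]; linarith [norm_add_le (v x - w x) (w x - u0 x), v4 x, w2 x]

end K6
end NK

namespace NK
open Filter Topology Metric MeasureTheory InnerProductSpace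
open scoped ContDiff
section K7
set_option linter.unusedSectionVars false

variable {n J : ℕ} {F : Type} [NormedAddCommGroup F] [InnerProductSpace ℝ F] [FiniteDimensional ℝ F]


theorem main (hn : 2 ≤ n) (hF : Module.finrank ℝ F = n + n) (pr : Prim n J) (hJ : 1 ≤ J) {θ : ℝ} (hθ0 : 0 < θ)
    (hθ1 : θ * (1 + 2 * J) < 1) {C : Set (Fin n → ℝ)} (hC : IsCompact C) {g : Fin n → Fin n → (Fin n → ℝ) → ℝ}
    (hg : ∀ i j, ContDiff ℝ 1 (g i j)) (hgs : ∀ i j x, g i j x = g j i x) {ub : (Fin n → ℝ) → F} (hub : ContDiff ℝ 1 ub)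
    (hp : ∀ x ∈ C, ∀ t : Fin n → ℝ, t ≠ 0 → 0 < ∑ i, ∑ j, t i * t j * (g i j x - (inner ℝ (pder i ub x) (pder j ub x)))) {e : ℝ} (he : 0 < e) :
    ∃ v : (Fin n → ℝ) → F, ContDiff ℝ 1 v ∧ (∀ i j, ∀ x ∈ C, (inner ℝ (pder i v x) (pder j v x)) = g i j x) ∧
      (∃ C', ∀ i x y, ‖pder i v x - pder i v y‖ ≤ C' * ‖x - y‖ ^ θ) ∧ ∀ x ∈ C, ‖v x - ub x‖ ≤ e := by
  have hpc : ∀ i, Continuous (pder i ub) := fun i => (hub.continuous_fderiv one_ne_zero).clm_apply continuous_const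
  obtain ⟨m, hm0, hm⟩ := quad_low hC (h := fun i j x => g i j x - (inner ℝ (pder i ub x) (pder j ub x)))
    (fun i j => (hg i j).continuous.sub ((hpc i).inner (hpc j))) hp
  obtain ⟨M, hM⟩ := hC.exists_bound_of_continuousOn (f := fun x => ∑ i, ‖pder i ub x‖)
    (continuous_finsetSum _ fun i _ => (hpc i).norm).continuousOn
  have hM' : ∀ i, ∀ x ∈ C, ‖pder i ub x‖ ≤ |M| := fun i x hx => by
    have h2 := Finset.single_le_sum (f := fun i => ‖pder i ub x‖) (fun i _ => norm_nonneg _) (Finset.mem_univ i)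
    exact h2.trans ((le_abs_self _).trans ((hM x hx).trans (le_abs_self _)))
  obtain ⟨R, hR⟩ := hC.isBounded.exists_norm_le
  obtain ⟨ε, hε⟩ : ∃ ε, ε = min (min 1 (e / 2)) (m / (2 * (n ^ 2 + 1) * (2 * |M| + 1))) := ⟨_, rfl⟩
  have hε0 : 0 < ε := by rw [hε]; refine lt_min (lt_min ?_ ?_) ?_ <;> positivity
  have hε1 : ε ≤ 1 := by rw [hε]; exact (min_le_left _ _).trans (min_le_left _ _)
  have hε2 : ε ≤ e / 2 := by rw [hε]; exact (min_le_left _ _).trans (min_le_right _ _)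
  have hε3 : ε ≤ m / (2 * (n ^ 2 + 1) * (2 * |M| + 1)) := by rw [hε]; exact min_le_right _ _
  rw [le_div_iff₀ (by positivity)] at hε3
  obtain ⟨u0, h0, h1⟩ := generic hF hub R hε0
  have hin : ∀ i j, ∀ x ∈ C, |(inner ℝ (pder i u0 x) (pder j u0 x)) - (inner ℝ (pder i ub x) (pder j ub x))| ≤ ε * (2 * |M| + 1) := fun i j x hx => by
    have a1 := (h1 x (hR x hx)).2 i
    have a2 := (h1 x (hR x hx)).2 j
    have b1 := hM' i x hx
    have b2 := hM' j x hx
    have e1 : (inner ℝ (pder i u0 x) (pder j u0 x)) - (inner ℝ (pder i ub x) (pder j ub x)) = (inner ℝ (pder i u0 x - pder i ub x) (pder j u0 x - pder j ub x))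
        + (inner ℝ (pder i u0 x - pder i ub x) (pder j ub x)) + (inner ℝ (pder i ub x) (pder j u0 x - pder j ub x)) := by
      simp only [inner_sub_left, inner_sub_right]; ring
    rw [e1]
    refine (abs_add_three _ _ _).trans ?_
    have c1 := (abs_real_inner_le_norm (pder i u0 x - pder i ub x) (pder j u0 x - pder j ub x)).trans
      (mul_le_mul a1 (a2.trans hε1) (norm_nonneg _) hε0.le)
    have c2 := (abs_real_inner_le_norm (pder i u0 x - pder i ub x) (pder j ub x)).trans
      (mul_le_mul a1 b2 (norm_nonneg _) hε0.le)
    have c3 := (abs_real_inner_le_norm (pder i ub x) (pder j u0 x - pder j ub x)).trans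
      (mul_le_mul b1 a2 (norm_nonneg _) (abs_nonneg _))
    linarith
  obtain ⟨v, v1, v2, v3, v4⟩ := approx hn hF pr hJ hθ0 hθ1 hC hg hgs h0 (by
    intro x hx t ht
    have ht' : 0 < ‖t‖ ^ 2 := by have := norm_pos_iff.2 ht; positivity
    have a1 := hm x hx t
    have a2 := (abs_le.1 (quad_bd (fun i j => hin i j x hx) t)).2
    simp only [mul_sub, Finset.sum_sub_distrib] at a1 a2 ⊢
    have a3 : (n:ℝ) ^ 2 * (ε * (2 * |M| + 1)) * ‖t‖ ^ 2 < m * ‖t‖ ^ 2 := by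
      refine mul_lt_mul_of_pos_right ?_ ht'
      have : 0 < ε * (2 * |M| + 1) := by positivity
      nlinarith
    linarith) (half_pos he)
  refine ⟨v, v1, v2, v3, fun x hx => ?_⟩
  have : v x - ub x = (v x - u0 x) + (u0 x - ub x) := by abel
  rw [this]; linarith [norm_add_le (v x - u0 x) (u0 x - ub x), v4 x, (h1 x (hR x hx)).1]

theorem exps (hn : 3 ≤ n) : ∃ J : ℕ, 1 ≤ J ∧ n.choose 2 ≤ J * n ∧ ∀ ε : ℝ, 0 < ε → ε < 1 / (2 * (n + 1)) →
    0 < thetaExp n ε ∧ thetaExp n ε * (1 + 2 * J) < 1 := by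
  have hn' : (3:ℝ) ≤ n := by exact_mod_cast hn
  have key : ∀ ε : ℝ, ε < 1 / (2 * ((n:ℝ) + 1)) → ε < 1 / (n + 1) := fun ε h => h.trans
    (one_div_lt_one_div_of_lt (by positivity) (by linarith))
  rcases Nat.even_or_odd n with h | h
  · obtain ⟨k, hk⟩ := h
    have hno : ¬ Odd n := by rw [Nat.not_odd_iff_even]; exact ⟨k, hk⟩
    refine ⟨k, by omega, ?_, fun ε h0 h1 => ?_⟩
    · rw [Nat.choose_two_right]
      refine Nat.div_le_of_le_mul ?_
      have : n - 1 ≤ 2 * k := by omega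
      calc n * (n - 1) ≤ n * (2 * k) := Nat.mul_le_mul_left _ this
        _ = _ := by ring
    · have hk' : (1:ℝ) + 2 * k = n + 1 := by rw [hk]; push_cast; ring
      rw [thetaExp, if_neg hno, hk']
      refine ⟨by linarith [key ε h1], ?_⟩
      rw [sub_mul, one_div, inv_mul_cancel₀ (by positivity)]
      have : 0 < ε * (n + 1) := by positivity
      linarith
  · obtain ⟨k, hk⟩ := h
    refine ⟨k, by omega, ?_, fun ε h0 h1 => ?_⟩
    · rw [Nat.choose_two_right]
      refine Nat.div_le_of_le_mul ?_
      have : n - 1 ≤ 2 * k := by omega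
      calc n * (n - 1) ≤ n * (2 * k) := Nat.mul_le_mul_left _ this
        _ = _ := by ring
    · have hk' : (1:ℝ) + 2 * k = n := by rw [hk]; push_cast; ring
      rw [thetaExp, if_pos ⟨k, hk⟩, hk']
      constructor
      · have : (1:ℝ) / (n + 1) ≤ 1 / n := one_div_le_one_div_of_le (by positivity) (by linarith)
        linarith [key ε h1]
      · rw [sub_mul, one_div, inv_mul_cancel₀ (by positivity)]
        have : 0 < ε * n := by positivity
        linarith

theorem pder_clm {d : Type} [Fintype d] (L : F ≃L[ℝ] (d → ℝ)) (f : (Fin n → ℝ) → F) (i : Fin n) (x) :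
    pder i (fun y => L (f y)) x = L (pder i f x) := by
  have := L.comp_fderiv (f := f) (x := x)
  simp only [pder]
  change fderiv ℝ (L ∘ f) x _ = _
  rw [this]; rfl

end K7
end NK

/-- Corollary 1.2: Nash–Kuiper approximation for `C^{1,κ}` short immersions. -/
theorem statement1 (n : ℕ) (hn : 3 ≤ n) :
    ∃ ε₀ : ℝ, 0 < ε₀ ∧ ε₀ < 1 / (n + 1) ∧
    ∀ Ω : Set (Fin n → ℝ), IsOpen Ω → Bornology.IsBounded Ω → Ω.Nonempty →
    SimplyConnectedSpace Ω →
    (∃ ρ : (Fin n → ℝ) → ℝ, ContDiff ℝ (⊤ : ℕ∞) ρ ∧ Ω = {x | ρ x < 0} ∧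
      ∀ x ∈ frontier Ω, fderiv ℝ ρ x ≠ 0) →
    ∀ g : (Fin n → ℝ) → Matrix (Fin n) (Fin n) ℝ, ContDiff ℝ 1 g →
    (∀ x ∈ closure Ω, (g x).PosDef) →
    ∀ ε : ℝ, 0 < ε → ε < ε₀ →
    ∀ κ ς : ℝ, 0 < κ → κ < 1 → 0 < ς → ς < 1 →
    ∀ ubar : (Fin n → ℝ) → (Fin (2 * n) → ℝ),
      MemC1Holder (closure Ω) κ ubar →
      (∀ x ∈ closure Ω, (g x - pullback ubar x).PosDef) →
    ∃ u : (Fin n → ℝ) → (Fin (2 * n) → ℝ),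
      MemC1Holder (closure Ω) (thetaExp n ε) u ∧
      (∀ x ∈ closure Ω, pullback u x = g x) ∧
      sNorm (closure Ω) (fun x => u x - ubar x) < ς := by
  have hn' : (3:ℝ) ≤ n := by exact_mod_cast hn
  refine ⟨1 / (2 * (n + 1)), by positivity, one_div_lt_one_div_of_lt (by positivity) (by linarith), ?_⟩
  intro Ω hΩo hΩb hΩn _ _ g hg hgp ε hε0 hε1 κ ς _ _ hς _ ubar hub hshort
  obtain ⟨J, hJ, hJn, hθ⟩ := NK.exps hn
  obtain ⟨hθ0, hθ1⟩ := hθ ε hε0 hε1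
  obtain ⟨pr⟩ := NK.prim_exists (by omega) J hJn
  have hC : IsCompact (closure Ω) := hΩb.isCompact_closure
  obtain ⟨L, hL⟩ : ∃ L, L = EuclideanSpace.equiv (Fin (2 * n)) ℝ := ⟨_, rfl⟩
  have hLa : ∀ v a, L v a = v a := fun v a => by rw [hL]; rfl
  have hLi : ∀ v w : EuclideanSpace ℝ (Fin (2 * n)), inner ℝ v w = ∑ a, L v a * L w a := fun v w => by
    simp only [hLa, PiLp.inner_apply]
    exact Finset.sum_congr rfl fun a _ => by simp [mul_comm]
  have hLn : ∀ v : EuclideanSpace ℝ (Fin (2 * n)), ‖L v‖ ≤ ‖v‖ := fun v => by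
    rw [pi_norm_le_iff_of_nonneg (norm_nonneg _)]
    intro a; rw [hLa]; exact PiLp.norm_apply_le v a
  obtain ⟨U, hU⟩ : ∃ U : (Fin n → ℝ) → EuclideanSpace ℝ (Fin (2 * n)), U = fun x => L.symm (ubar x) := ⟨_, rfl⟩
  have hUs : ContDiff ℝ 1 U := by rw [hU]; exact L.symm.contDiff.comp hub.1
  have hub' : ubar = fun x => L (U x) := by rw [hU]; simp
  have hpb : ∀ (f : (Fin n → ℝ) → EuclideanSpace ℝ (Fin (2 * n))) x i j, pullback (fun x => L (f x)) x i j =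
      inner ℝ (pder i f x) (pder j f x) := fun f x i j => by
    simp only [pullback, Matrix.of_apply, NK.pder_clm, hLi]
  have hgij : ∀ i j, ContDiff ℝ 1 fun x => g x i j := fun i j => contDiff_pi.1 (contDiff_pi.1 hg i) j
  have hsym : ∀ x ∈ closure Ω, ∀ i j, g x i j = g x j i := fun x hx i j => by
    simpa using (hgp x hx).isHermitian.apply j i
  obtain ⟨v, v1, v2, ⟨C', v3⟩, v4⟩ := NK.main (F := EuclideanSpace ℝ (Fin (2 * n))) (by omega) (by simp; ring) pr hJ hθ0 hθ1 hC
    (g := fun i j x => (g x i j + g x j i) / 2) (fun i j => ((hgij i j).add (hgij j i)).div_const 2)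
    (fun i j x => by ring) hUs (by
      intro x hx t ht
      have := (hshort x hx).dotProduct_mulVec_pos ht
      simp only [dotProduct, Matrix.mulVec, Finset.mul_sum, Matrix.sub_apply, hub', hpb] at this
      refine this.trans_eq (Finset.sum_congr rfl fun i _ => Finset.sum_congr rfl fun j _ => ?_)
      rw [hsym x hx j i]
      simp only [Pi.star_apply, star_trivial]
      ring) (half_pos hς)
  refine ⟨fun x => L (v x), ⟨L.contDiff.comp v1, C', fun i x _ y _ => ?_⟩, fun x hx => ?_, ?_⟩
  · rw [NK.pder_clm, NK.pder_clm, ← map_sub]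
    exact (hLn _).trans (v3 i x y)
  · ext i j
    rw [hpb, v2 i j x hx, hsym x hx j i]; ring
  · refine lt_of_le_of_lt (b := ς / 2) ?_ (by linarith)
    refine Real.iSup_le (fun x => ?_) (by positivity)
    simp only [hub']
    rw [← map_sub]
    exact (hLn _).trans (v4 x.1 x.2)
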